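/- arXiv:2311.08343 — 2 statements merged into one kernel-verified Lean document; each statement's English description precedes it below -/
import Mathlib

section
/- Let N ≥ 1 and let A be Haar-distributed on U(N). Then Var( Σ_{k≥1} |Tr(A^k)|²/k² ) = Σ_{k≥1} T(k)/k⁴ + Σ_{k,ℓ≥1, k≠ℓ} V(k,ℓ)/(k²ℓ²), where T(k) = min{k², N²} + min{2k, N} − 2·min{k, N} and V(k,ℓ) = 2(N − max{k,ℓ})⁺ − (N − k − ℓ)⁺ − (N − |k−ℓ|)⁺, with x⁺ = max{x, 0}. -/
open MeasureTheory ProbabilityTheory Matrix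

noncomputable section

instance matrixMeasurableSpace {m n α : Type*} [MeasurableSpace α] :
    MeasurableSpace (Matrix m n α) :=
  show MeasurableSpace (m → n → α) from inferInstance

/-- `T(k) = min{k², N²} + min{2k, N} − 2·min{k, N}`. -/
def T (N k : ℕ) : ℝ :=
  min ((k : ℝ) ^ 2) ((N : ℝ) ^ 2) + min (2 * (k : ℝ)) (N : ℝ) - 2 * min (k : ℝ) (N : ℝ)

/-- `V(k,ℓ) = 2(N − max{k,ℓ})⁺ − (N − k − ℓ)⁺ − (N − |k−ℓ|)⁺`. -/
def V (N k l : ℕ) : ℝ :=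
  2 * max ((N : ℝ) - max (k : ℝ) (l : ℝ)) 0 - max ((N : ℝ) - (k : ℝ) - (l : ℝ)) 0
    - max ((N : ℝ) - |(k : ℝ) - (l : ℝ)|) 0

namespace CUE

/-- The sum of `F` over the integers from `0` (included) to `m` (excluded), counted with a minus
sign when `m` is negative. -/
def osum {R : Type*} [AddCommGroup R] (m : ℤ) (F : ℤ → R) : R :=
  ∑ a ∈ Finset.Ico 0 m, F a - ∑ a ∈ Finset.Ico m 0, F a

section osum
variable {R : Type*} [AddCommGroup R]

@[simp] lemma osum_zero (F : ℤ → R) : osum 0 F = 0 := by simp [osum]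

lemma osum_succ (m : ℤ) (F : ℤ → R) : osum (m + 1) F = osum m F + F m := by
  unfold osum
  rcases le_or_gt 0 m with h | h
  · have h1 : Finset.Ico 0 (m + 1) = insert m (Finset.Ico 0 m) := by
      ext x; simp; omega
    rw [h1, Finset.sum_insert (by simp), Finset.Ico_eq_empty (by omega : ¬ (m + 1 < 0)),
      Finset.Ico_eq_empty (by omega : ¬ (m < 0))]
    abel
  · have h1 : Finset.Ico m 0 = insert m (Finset.Ico (m + 1) 0) := by
      ext x; simp; omega
    rw [h1, Finset.sum_insert (by simp), Finset.Ico_eq_empty (by omega : ¬ (0 < m + 1)),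
      Finset.Ico_eq_empty (by omega : ¬ (0 < m))]
    abel

lemma map_osum {S F : Type*} [AddCommGroup S] [FunLike F R S] [AddMonoidHomClass F R S]
    (f : F) (m : ℤ) (G : ℤ → R) : f (osum m G) = osum m (fun a => f (G a)) := by
  simp [osum, map_sub, map_sum]

lemma osum_telescope (m : ℤ) (G : ℤ → R) : osum m (fun a => G a - G (a + 1)) = G 0 - G m := by
  induction m using Int.induction_on with
  | zero => simp
  | succ n ih => rw [osum_succ, ih]; abel
  | pred n ih =>
    have h := osum_succ (-(n : ℤ) - 1) (fun a => G a - G (a + 1))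
    rw [sub_add_cancel, ih] at h
    rw [← sub_eq_iff_eq_add] at h
    rw [← h]; abel

lemma osum_const {R : Type*} [Ring R] (m : ℤ) (x : R) : osum m (fun _ => x) = (m : R) * x := by
  induction m using Int.induction_on with
  | zero => simp
  | succ n ih => rw [osum_succ, ih]; simp [add_mul]
  | pred n ih =>
    have h := osum_succ (-(n : ℤ) - 1) (fun _ => x)
    rw [sub_add_cancel, ih] at h
    rw [eq_sub_of_add_eq h.symm]; simp [sub_mul]

lemma sum_osum {ι : Type*} (s : Finset ι) (m : ℤ) (F : ι → ℤ → R) :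
    ∑ i ∈ s, osum m (F i) = osum m (fun a => ∑ i ∈ s, F i a) := by
  simp only [osum, Finset.sum_sub_distrib]
  rw [Finset.sum_comm, Finset.sum_comm (t := Finset.Ico m 0)]

lemma mul_osum {R : Type*} [Ring R] (m : ℤ) (x : R) (F : ℤ → R) :
    x * osum m F = osum m (fun a => x * F a) := by
  simp [osum, mul_sub, Finset.mul_sum]

end osum

variable {N : ℕ}

/-- The algebra of Laurent polynomials in `N` variables. -/
abbrev Lau (N : ℕ) := AddMonoidAlgebra ℂ (Fin N → ℤ)

/-- The operator multiplying the monomial of exponent `v` by `q v`. -/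
def diagOp (q : (Fin N → ℤ) → ℂ) : Lau N →ₗ[ℂ] Lau N where
  toFun f := .ofCoeff (Finsupp.onFinset f.coeff.support (fun v => q v * f.coeff v)
    (fun v hv => by
      rw [Finsupp.mem_support_iff]; exact right_ne_zero_of_mul hv))
  map_add' f g := by
    ext v; simp [mul_add]
  map_smul' c f := by
    ext v; simp; ring

@[simp] lemma diagOp_coeff (q : (Fin N → ℤ) → ℂ) (f : Lau N) (v : Fin N → ℤ) :
    (diagOp q f).coeff v = q v * f.coeff v := rfl

lemma diagOp_single (q : (Fin N → ℤ) → ℂ) (v : Fin N → ℤ) (c : ℂ) :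
    diagOp q (.single v c) = .single v (q v * c) := by
  ext w
  simp only [diagOp_coeff, AddMonoidAlgebra.coeff_single, Finsupp.single_apply]
  split_ifs with h <;> simp [h]

lemma diagOp_leibniz (q : (Fin N → ℤ) → ℂ) (hq : ∀ v w, q (v + w) = q v + q w) (f g : Lau N) :
    diagOp q (f * g) = f * diagOp q g + g * diagOp q f := by
  induction f using AddMonoidAlgebra.induction_linear with
  | zero => simp
  | add f₁ f₂ h₁ h₂ => rw [add_mul, map_add, map_add, h₁, h₂]; ring
  | single v c =>
    induction g using AddMonoidAlgebra.induction_linear with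
    | zero => simp
    | add g₁ g₂ h₁ h₂ => rw [mul_add, map_add, map_add, h₁, h₂]; ring
    | single w d =>
      rw [diagOp_single, diagOp_single, AddMonoidAlgebra.single_mul_single,
        AddMonoidAlgebra.single_mul_single, AddMonoidAlgebra.single_mul_single, diagOp_single,
        hq, add_comm w v, ← AddMonoidAlgebra.single_add]
      congr 1
      ring

/-- The Euler derivation `z_i ∂/∂z_i` on Laurent polynomials. -/
def theta (i : Fin N) : Derivation ℂ (Lau N) (Lau N) :=
  Derivation.mk' (diagOp fun v => (v i : ℂ)) fun f g => by
    simpa using diagOp_leibniz (fun v => (v i : ℂ)) (fun v w => by simp) f g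

@[simp] lemma theta_coeff (i : Fin N) (f : Lau N) (v : Fin N → ℤ) :
    (theta i f).coeff v = v i * f.coeff v := rfl

lemma theta_single (i : Fin N) (v : Fin N → ℤ) (c : ℂ) :
    theta i (.single v c) = .single v (v i * c) := diagOp_single _ v c

/-- The `m`-th power of the `i`-th variable. -/
def Z (i : Fin N) (m : ℤ) : Lau N := .single (Pi.single i m) 1

lemma Z_zero (i : Fin N) : Z i 0 = 1 := by
  simp [Z, AddMonoidAlgebra.one_def]

lemma Z_add (i : Fin N) (m n : ℤ) : Z i (m + n) = Z i m * Z i n := by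
  simp [Z, AddMonoidAlgebra.single_mul_single, Pi.single_add]

lemma theta_Z (i j : Fin N) (m : ℤ) :
    theta i (Z j m) = if i = j then (m : Lau N) * Z j m else 0 := by
  rw [Z, theta_single]
  split_ifs with h
  · subst h
    rw [Pi.single_eq_same, ← zsmul_eq_mul (AddMonoidAlgebra.single _ _),
      ← Int.cast_smul_eq_zsmul ℂ m,
      AddMonoidAlgebra.smul_single, smul_eq_mul]
  · simp [Pi.single_eq_of_ne h]

/-- The power sum `∑ i, z_i ^ m`. -/
def pw (m : ℤ) : Lau N := ∑ i, Z i m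

lemma pw_zero : (pw 0 : Lau N) = N := by simp [pw, Z_zero]

lemma theta_pw (i : Fin N) (m : ℤ) : theta i (pw m) = (m : Lau N) * Z i m := by
  simp [pw, theta_Z]

/-- The derivation `∑ i, z_i ^ (m + 1) ∂/∂z_i` on Laurent polynomials. -/
def wittOp (m : ℤ) : Derivation ℂ (Lau N) (Lau N) := ∑ i, Z i m • theta i

lemma wittOp_apply (m : ℤ) (f : Lau N) : wittOp m f = ∑ i, Z i m * theta i f := by
  have h : ∀ s : Finset (Fin N),
      (∑ i ∈ s, Z i m • theta i) f = ∑ i ∈ s, Z i m * theta i f := by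
    intro s
    induction s using Finset.induction_on with
    | empty => simp
    | insert a s ha ih => simp [Finset.sum_insert ha, ih]
  exact h _

lemma wittOp_Z (m n : ℤ) (i : Fin N) : wittOp m (Z i n) = (n : Lau N) * Z i (m + n) := by
  simp [wittOp_apply, theta_Z, Z_add]; ring

lemma wittOp_pw (m n : ℤ) : wittOp m (pw n : Lau N) = (n : Lau N) * pw (m + n) := by
  simp [pw, map_sum, wittOp_Z, Finset.mul_sum]

lemma derivation_prod {ι : Type*} (D : Derivation ℂ (Lau N) (Lau N)) (s : Finset ι)
    (x h : ι → Lau N) (hx : ∀ i ∈ s, D (x i) = x i * h i) :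
    D (∏ i ∈ s, x i) = (∏ i ∈ s, x i) * ∑ i ∈ s, h i := by
  classical
  induction s using Finset.induction_on with
  | empty => simp
  | insert a s ha ih =>
    rw [Finset.prod_insert ha, Finset.sum_insert ha, Derivation.leibniz,
      ih fun i hi => hx i (Finset.mem_insert_of_mem hi), hx a (Finset.mem_insert_self a s)]
    simp only [smul_eq_mul]
    ring

/-- The Vandermonde determinant of the variables. -/
def vdm (N : ℕ) : Lau N := (Matrix.vandermonde fun i : Fin N => Z i 1).det

/-- The quadratic expression `∑_{0 ≤ a < m} P_a P_{m-a}` (with `osum` conventions). -/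
def quad {R : Type*} [Ring R] (P : ℤ → R) (m : ℤ) : R := osum m fun a => P a * P (m - a)

lemma sub_mul_osum (i j : Fin N) (m : ℤ) :
    (Z j 1 - Z i 1) * osum m (fun b => Z i b * Z j (m - 1 - b)) = Z j m - Z i m := by
  have h := osum_telescope m fun b => Z i b * Z j (m - b)
  simp only [sub_zero, sub_self, Z_zero, one_mul, mul_one] at h
  rw [← h, mul_osum]
  congr 1
  funext b
  rw [Z_add i b 1, show m - b = 1 + (m - 1 - b) by ring, Z_add j 1,
    show m - (b + 1) = m - 1 - b by ring]
  ring

lemma two_mul_sum_Ioi {R : Type*} [CommRing R] (h : Fin N → Fin N → R)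
    (hs : ∀ i j, h i j = h j i) :
    2 * ∑ i, ∑ j ∈ Finset.Ioi i, h i j = ∑ i, ∑ j, h i j - ∑ i, h i i := by
  have h1 : ∀ i : Fin N, ∑ j, h i j
      = ∑ j ∈ Finset.Ioi i, h i j + ∑ j ∈ Finset.Iio i, h i j + h i i := by
    intro i
    rw [← Finset.sum_filter_add_sum_filter_not Finset.univ (fun j => i < j),
      ← Finset.sum_filter_add_sum_filter_not (Finset.univ.filter fun j => ¬ i < j) (fun j => j < i),
      Finset.filter_filter, Finset.filter_filter, add_assoc]
    congr 2
    · ext; simp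
    · apply Finset.sum_congr _ fun _ _ => rfl
      ext; simp; intro h; exact h.le
    · rw [show (Finset.univ.filter fun j => ¬ i < j ∧ ¬ j < i) = {i} by
        ext; simp; rw [le_antisymm_iff], Finset.sum_singleton]
  have h2 : ∑ i : Fin N, ∑ j ∈ Finset.Iio i, h i j = ∑ i, ∑ j ∈ Finset.Ioi i, h i j := by
    rw [Finset.sum_comm' (t' := Finset.univ) (s' := fun j => Finset.Ioi j) (by simp)]
    exact Finset.sum_congr rfl fun i _ => Finset.sum_congr rfl fun j _ => hs _ _
  simp only [h1, Finset.sum_add_distrib, h2]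
  ring

lemma osum_reflect {R : Type*} [AddCommGroup R] (m : ℤ) (F : ℤ → R) :
    osum m F = osum m fun a => F (m - 1 - a) := by
  unfold osum
  congr 1
  · exact Finset.sum_bij' (fun a _ => m - 1 - a) (fun a _ => m - 1 - a)
      (by simp; omega) (by simp; omega) (by simp) (by simp) (by simp)
  · exact Finset.sum_bij' (fun a _ => m - 1 - a) (fun a _ => m - 1 - a)
      (by simp; omega) (by simp; omega) (by simp) (by simp) (by simp)

lemma two_mul_wittOp_vdm (m : ℤ) :
    2 * wittOp m (vdm N) = vdm N * (quad pw m + (((N : ℤ) - 1 - m : ℤ) : Lau N) * pw m) := by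
  set h : Fin N → Fin N → Lau N := fun i j => osum (m + 1) fun b => Z i b * Z j (m - b) with hh
  have hD : wittOp m (vdm N) = vdm N * ∑ i, ∑ j ∈ Finset.Ioi i, h i j := by
    rw [vdm, Matrix.det_vandermonde]
    refine derivation_prod _ _ _ _ fun i _ => derivation_prod _ _ _ _ fun j _ => ?_
    rw [map_sub, wittOp_Z, wittOp_Z]
    have := sub_mul_osum i j (m + 1)
    simp only [add_sub_cancel_right] at this
    simpa using this.symm
  have hs : ∀ i j, h i j = h j i := by
    intro i j
    simp only [hh]
    rw [osum_reflect]
    congr 1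
    funext b
    rw [show m + 1 - 1 - b = m - b by ring, show m - (m - b) = b by ring, mul_comm]
  have h1 : ∑ i, ∑ j, h i j = quad pw m + (N : Lau N) * pw m := by
    simp only [hh, sum_osum]
    rw [quad, ← pw_zero, osum_succ]
    simp only [sub_self, pw, Finset.sum_mul_sum]
    congr 1
    rw [Finset.sum_comm]
    refine Finset.sum_congr rfl fun i _ => Finset.sum_congr rfl fun j _ => mul_comm _ _
  have h2 : ∑ i, h i i = ((m + 1 : ℤ) : Lau N) * pw m := by
    simp only [hh, ← Z_add, add_sub_cancel, osum_const, pw, Finset.mul_sum]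
  rw [hD, mul_left_comm, two_mul_sum_Ioi h hs, h1, h2]
  push_cast
  ring

variable {N : ℕ}

/-- The sign of the permutation sorting `v` if `v` enumerates `0, …, N - 1`, and `0` otherwise. -/
def eps (v : Fin N → ℤ) : ℂ :=
  (Matrix.of fun r c : Fin N => if v r = (c : ℤ) then (1 : ℂ) else 0).det

lemma prod_Z (w : Fin N → ℤ) : ∏ i, Z i (w i) = (.single w 1 : Lau N) := by
  have h : ∀ s : Finset (Fin N),
      ∏ i ∈ s, Z i (w i) = (.single (∑ i ∈ s, Pi.single i (w i)) 1 : Lau N) := by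
    intro s
    induction s using Finset.induction_on with
    | empty => simp [AddMonoidAlgebra.one_def]
    | insert a s ha ih =>
      rw [Finset.prod_insert ha, Finset.sum_insert ha, ih, Z, AddMonoidAlgebra.single_mul_single,
        one_mul]
  rw [h, Finset.univ_sum_single]

lemma eps_eq_sum (v : Fin N → ℤ) :
    eps v = ∑ σ : Equiv.Perm (Fin N), Equiv.Perm.sign σ •
      (if ∀ i, v (σ i) = (i : ℤ) then (1 : ℂ) else 0) := by
  rw [eps, Matrix.det_apply]
  refine Finset.sum_congr rfl fun σ _ => ?_
  congr 1
  simp only [Matrix.of_apply]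
  rw [Finset.prod_ite_zero]
  simp

lemma Z_one_pow (i : Fin N) (n : ℕ) : Z i 1 ^ n = Z i n := by
  induction n with
  | zero => simp [Z_zero]
  | succ n ih => rw [pow_succ, ih, ← Z_add]; simp

lemma vdm_coeff (v : Fin N → ℤ) : (vdm N).coeff v = eps v := by
  rw [eps_eq_sum, vdm, Matrix.det_apply, AddMonoidAlgebra.coeff_sum, Finsupp.finsetSum_apply]
  refine Finset.sum_congr rfl fun σ _ => ?_
  have h : ∏ i, Matrix.vandermonde (fun i : Fin N => Z i 1) (σ i) i
      = (.single (fun r => ((σ⁻¹ r : Fin N) : ℤ)) 1 : Lau N) := by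
    rw [← prod_Z, ← Equiv.prod_comp σ (fun r => Z r ((σ⁻¹ r : Fin N) : ℤ))]
    simp [Matrix.vandermonde_apply, Z_one_pow]
  rw [h]
  have h2 : ((fun r => ((σ⁻¹ r : Fin N) : ℤ)) = v) ↔ ∀ i, v (σ i) = (i : ℤ) := by
    constructor
    · rintro rfl i; simp
    · intro h; funext r; rw [← h]; simp
  rcases Int.units_eq_one_or (Equiv.Perm.sign σ) with hs | hs <;>
    simp only [hs, one_smul, Units.neg_smul, AddMonoidAlgebra.coeff_neg, Finsupp.neg_apply,
      AddMonoidAlgebra.coeff_single, Finsupp.single_apply, h2]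

lemma exists_perm_of_eps_ne_zero {v : Fin N → ℤ} (h : eps v ≠ 0) :
    ∃ σ : Equiv.Perm (Fin N), ∀ i, v (σ i) = (i : ℤ) := by
  by_contra! hc
  apply h
  rw [eps_eq_sum]
  refine Finset.sum_eq_zero fun σ _ => ?_
  rw [if_neg (by simpa using hc σ), smul_zero]

lemma eps_comp (v : Fin N → ℤ) (σ : Equiv.Perm (Fin N)) :
    eps (v ∘ σ) = (Equiv.Perm.sign σ : ℂ) * eps v := by
  rw [eps, eps, ← Matrix.det_permute]
  rfl

lemma eps_id : eps (fun i : Fin N => (i : ℤ)) = 1 := by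
  rw [eps, ← Matrix.det_one (n := Fin N)]
  congr 1
  ext i j
  simp [Matrix.one_apply, Fin.ext_iff]

lemma vdm_ne_zero : vdm N ≠ 0 := by
  intro h
  have := vdm_coeff (fun i : Fin N => (i : ℤ))
  rw [h, eps_id] at this
  simp at this

/-- The Casimir eigenvalue attached to an exponent vector. -/
def cas (v : Fin N → ℤ) : ℤ :=
  ∑ i, v i * (v i - (N - 1)) - ∑ i : Fin N, (i : ℤ) * ((i : ℤ) - (N - 1))

lemma cas_perm (σ : Equiv.Perm (Fin N)) {v : Fin N → ℤ} (h : ∀ i, v (σ i) = (i : ℤ)) :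
    cas v = 0 := by
  rw [cas, ← Equiv.sum_comp σ (fun i => v i * (v i - (N - 1)))]
  simp [h]

lemma exists_perm_of_cas_eq_zero {v : Fin N → ℤ} (hv : Function.Injective v) (h : cas v = 0) :
    ∃ σ : Equiv.Perm (Fin N), ∀ i, v (σ i) = (i : ℤ) := by
  classical
  rcases Nat.eq_zero_or_pos N with h0 | h0
  · subst h0
    exact ⟨1, fun i => i.elim0⟩
  set g : ℤ → ℤ := fun x => x * (x - (N - 1)) with hg
  set I := Finset.univ.image v
  set J := Finset.univ.image (fun i : Fin N => (i : ℤ))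
  have hinj : Function.Injective (fun i : Fin N => (i : ℤ)) := fun a b hab => by
    simpa [Fin.ext_iff] using hab
  have hI : ∑ x ∈ I, g x = ∑ i, g (v i) := Finset.sum_image fun a _ b _ hab => hv hab
  have hJ : ∑ x ∈ J, g x = ∑ i : Fin N, g i := Finset.sum_image fun a _ b _ hab => hinj hab
  have hJmem : ∀ x, x ∈ J ↔ 0 ≤ x ∧ x < N := by
    intro x
    simp only [J, Finset.mem_image, Finset.mem_univ, true_and]
    constructor
    · rintro ⟨i, rfl⟩; have := i.2; omega
    · rintro ⟨h0, h1⟩; exact ⟨⟨x.toNat, by omega⟩, by simp [h0]⟩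
  have hpos : ∀ x, x ∉ J → 0 < g x := by
    intro x hx
    rw [hJmem, not_and_or, not_le, not_lt] at hx
    simp only [hg]
    rcases hx with hx | hx
    · exact mul_pos_of_neg_of_neg hx (by omega)
    · exact mul_pos (by omega) (by omega)
  have hneg : ∀ x ∈ J, g x ≤ 0 := by
    intro x hx
    rw [hJmem] at hx
    exact mul_nonpos_of_nonneg_of_nonpos hx.1 (by omega)
  have hIJ : ∑ x ∈ I, g x = ∑ x ∈ J, g x := by
    rw [hI, hJ]; exact sub_eq_zero.1 h
  have hsub : I \ J = ∅ := by
    by_contra hne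
    have h1 : 0 < ∑ x ∈ I \ J, g x :=
      Finset.sum_pos (fun x hx => hpos x (Finset.mem_sdiff.1 hx).2)
        (Finset.nonempty_iff_ne_empty.2 hne)
    have h2 : ∑ x ∈ J \ I, g x ≤ 0 :=
      Finset.sum_nonpos fun x hx => hneg x (Finset.mem_sdiff.1 hx).1
    have h3 := Finset.sum_inter_add_sum_sdiff I J g
    have h4 := Finset.sum_inter_add_sum_sdiff J I g
    rw [Finset.inter_comm] at h4
    linarith
  have hcard : I.card = J.card := by
    rw [Finset.card_image_of_injective _ hv, Finset.card_image_of_injective _ hinj]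
  have hEq : I = J :=
    Finset.eq_of_subset_of_card_le (Finset.sdiff_eq_empty_iff_subset.1 hsub) hcard.ge
  have hex : ∀ i : Fin N, ∃ j, v j = (i : ℤ) := by
    intro i
    have : (i : ℤ) ∈ I := hEq ▸ (Finset.mem_image_of_mem _ (Finset.mem_univ i))
    simpa [I] using this
  choose s hs using hex
  have hsinj : Function.Injective s := fun a b hab => hinj (by
    have := hs a; rw [hab, hs b] at this; exact this.symm)
  exact ⟨Equiv.ofBijective s (Finite.injective_iff_bijective.1 hsinj), hs⟩

/-- The Casimir operator, diagonal in the monomial basis. -/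
def casOp (N : ℕ) : Lau N →ₗ[ℂ] Lau N := diagOp fun v => (cas v : ℂ)

lemma casOp_vdm : casOp N (vdm N) = 0 := by
  ext v
  simp only [casOp, diagOp_coeff, vdm_coeff, AddMonoidAlgebra.coeff_zero, Finsupp.coe_zero,
    Pi.zero_apply, mul_eq_zero]
  by_cases h : eps v = 0
  · exact Or.inr h
  · obtain ⟨σ, hσ⟩ := exists_perm_of_eps_ne_zero h
    left; simp [cas_perm σ hσ]

lemma casOp_eq (f : Lau N) :
    casOp N f = ∑ i, theta i (theta i f) - ((N : ℂ) - 1) • ∑ i, theta i f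
      - (∑ i : Fin N, ((i : ℂ) * ((i : ℂ) - (N - 1)))) • f := by
  ext v
  simp only [casOp, diagOp_coeff, cas, AddMonoidAlgebra.coeff_sub, AddMonoidAlgebra.coeff_sum,
    AddMonoidAlgebra.coeff_smul, Finsupp.sub_apply, Finsupp.smul_apply, Finsupp.finsetSum_apply,
    theta_coeff, smul_eq_mul]
  push_cast
  rw [sub_mul, Finset.sum_mul, Finset.mul_sum, ← Finset.sum_sub_distrib]
  congr 1
  refine Finset.sum_congr rfl fun i _ => ?_
  ring

/-- The action of a permutation of the variables on Laurent polynomials. -/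
def permHom (σ : Equiv.Perm (Fin N)) : Lau N ≃ₐ[ℂ] Lau N :=
  AddMonoidAlgebra.domCongr ℂ ℂ
    { toFun := fun v : Fin N → ℤ => v ∘ σ.symm
      invFun := fun v => v ∘ σ
      left_inv := fun v => by ext; simp
      right_inv := fun v => by ext; simp
      map_add' := fun _ _ => rfl }

lemma permHom_coeff (σ : Equiv.Perm (Fin N)) (f : Lau N) (v : Fin N → ℤ) :
    (permHom σ f).coeff v = f.coeff (v ∘ σ) := by
  rw [permHom, AddMonoidAlgebra.coeff_domCongr]
  rfl

lemma permHom_Z (σ : Equiv.Perm (Fin N)) (i : Fin N) (m : ℤ) : permHom σ (Z i m) = Z (σ i) m := by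
  rw [permHom, Z, AddMonoidAlgebra.domCongr_single, Z]
  congr 1
  ext j
  simp only [AddEquiv.coe_mk, Equiv.coe_fn_mk, Function.comp_apply, Pi.single_apply]
  simp only [Equiv.symm_apply_eq]

lemma permHom_pw (σ : Equiv.Perm (Fin N)) (m : ℤ) : permHom σ (pw m) = pw m := by
  simp only [pw, map_sum, permHom_Z]
  exact Equiv.sum_comp σ fun i => Z i m

/-- Polynomials in formal variables standing for the traces of all powers. -/
abbrev Formal := MvPolynomial ℤ ℂ

/-- Substitution of power sums for the formal traces. -/
def toLau (N : ℕ) : Formal →ₐ[ℂ] Lau N := MvPolynomial.aeval pw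

@[simp] lemma toLau_X (m : ℤ) : toLau N (MvPolynomial.X m) = pw m := MvPolynomial.aeval_X _ _

lemma toLau_quad (m : ℤ) : toLau N (quad MvPolynomial.X m) = quad pw m := by
  simp [quad, map_osum]

lemma permHom_toLau (σ : Equiv.Perm (Fin N)) (f : Formal) :
    permHom σ (toLau N f) = toLau N f := by
  have : (permHom σ).toAlgHom.comp (toLau N) = toLau N := by
    apply MvPolynomial.algHom_ext
    intro m
    simp [permHom_pw]
  exact congrArg (fun g => g f) this

lemma permHom_vdm (σ : Equiv.Perm (Fin N)) :
    permHom σ (vdm N) = (Equiv.Perm.sign σ : ℂ) • vdm N := by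
  ext v
  rw [permHom_coeff, vdm_coeff, eps_comp, AddMonoidAlgebra.coeff_smul, Finsupp.smul_apply,
    vdm_coeff, smul_eq_mul]

lemma coeff_comp_perm (σ : Equiv.Perm (Fin N)) (f : Formal) (v : Fin N → ℤ) :
    (vdm N * toLau N f).coeff (v ∘ σ) =
      (Equiv.Perm.sign σ : ℂ) * (vdm N * toLau N f).coeff v := by
  rw [← permHom_coeff, map_mul, permHom_vdm, permHom_toLau, smul_mul_assoc,
    AddMonoidAlgebra.coeff_smul, Finsupp.smul_apply, smul_eq_mul]

lemma coeff_eq_zero_of_not_injective (f : Formal) {v : Fin N → ℤ}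
    (hv : ¬ Function.Injective v) : (vdm N * toLau N f).coeff v = 0 := by
  rw [Function.Injective] at hv
  push Not at hv
  obtain ⟨i, j, hij, hne⟩ := hv
  have h := coeff_comp_perm (Equiv.swap i j) f v
  have hs : v ∘ Equiv.swap i j = v := by
    ext r
    simp only [Function.comp_apply, Equiv.swap_apply_def]
    split_ifs with h1 h2
    · rw [h1, hij]
    · rw [h2, hij]
    · rfl
  rw [hs, Equiv.Perm.sign_swap hne] at h
  simp only [Units.val_neg, Units.val_one, Int.cast_neg, Int.cast_one, neg_mul, one_mul] at h
  exact self_eq_neg.1 h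

/-- The formal counterpart of `wittOp`. -/
def formalWitt (m : ℤ) : Derivation ℂ Formal Formal :=
  MvPolynomial.mkDerivation ℂ fun n => (n : Formal) * MvPolynomial.X (m + n)

lemma formalWitt_X (m n : ℤ) :
    formalWitt m (MvPolynomial.X n) = (n : Formal) * MvPolynomial.X (m + n) :=
  MvPolynomial.mkDerivation_X _ _ _

lemma toLau_formalWitt (m : ℤ) (f : Formal) :
    toLau N (formalWitt m f) = wittOp m (toLau N f) := by
  induction f using MvPolynomial.induction_on with
  | C a =>
    rw [← MvPolynomial.algebraMap_eq, AlgHom.commutes, Derivation.map_algebraMap,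
      Derivation.map_algebraMap, map_zero]
  | add p q hp hq => simp only [map_add, hp, hq]
  | mul_X p n hp =>
    simp only [Derivation.leibniz, map_add, smul_eq_mul, map_mul, hp, formalWitt_X, toLau_X,
      map_intCast, wittOp_pw]

lemma exists_theta_toLau (f : Formal) : ∃ s : Finset ℤ, ∀ t, s ⊆ t → ∀ i : Fin N,
    theta i (toLau N f)
      = ∑ m ∈ t, (m : Lau N) * Z i m * toLau N (MvPolynomial.pderiv m f) := by
  induction f using MvPolynomial.induction_on with
  | C a =>
    refine ⟨∅, fun t _ i => ?_⟩
    rw [← MvPolynomial.algebraMap_eq, AlgHom.commutes, Derivation.map_algebraMap]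
    simp
  | add p q hp hq =>
    obtain ⟨s, hs⟩ := hp
    obtain ⟨s', hs'⟩ := hq
    refine ⟨s ∪ s', fun t ht i => ?_⟩
    rw [map_add, map_add, hs t (Finset.union_subset_left ht), hs' t (Finset.union_subset_right ht),
      ← Finset.sum_add_distrib]
    simp [mul_add]
  | mul_X p n hp =>
    obtain ⟨s, hs⟩ := hp
    refine ⟨insert n s, fun t ht i => ?_⟩
    have hst : s ⊆ t := (Finset.subset_insert _ _).trans ht
    have hnt : n ∈ t := ht (Finset.mem_insert_self _ _)
    simp only [Derivation.leibniz, map_mul, toLau_X, theta_pw, hs t hst, map_add, smul_eq_mul,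
      MvPolynomial.pderiv_X, mul_add, Finset.sum_add_distrib, Finset.mul_sum]
    congr 1
    · rw [Finset.sum_eq_single_of_mem n hnt]
      · simp; ring
      · intro b _ hb
        simp [hb]
    · refine Finset.sum_congr rfl fun m _ => ?_
      ring

/-- The summand of the Casimir operator on formal polynomials. -/
def formalCasTerm (f : Formal) (m : ℤ) : Formal :=
  (m : Formal) * (quad MvPolynomial.X m * MvPolynomial.pderiv m f
    + formalWitt m (MvPolynomial.pderiv m f))

lemma exists_formalCas (N : ℕ) (f : Formal) : ∃ t : Finset ℤ,
    vdm N * toLau N (∑ m ∈ t, formalCasTerm f m) = casOp N (vdm N * toLau N f) := by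
  obtain ⟨t, ht⟩ := exists_theta_toLau (N := N) f
  refine ⟨t, ?_⟩
  have ht := ht t subset_rfl
  set g := toLau N f
  set d : ℤ → Lau N := fun m => toLau N (MvPolynomial.pderiv m f) with hd
  have hθ : ∑ i, theta i g = ∑ m ∈ t, (m : Lau N) * pw m * d m := by
    simp only [ht]
    rw [Finset.sum_comm]
    simp only [pw, Finset.mul_sum, Finset.sum_mul, hd]
  have hθθ : ∑ i, theta i (theta i g)
      = ∑ m ∈ t, (m : Lau N) * ((m : Lau N) * pw m * d m + wittOp m (d m)) := by
    simp only [ht, map_sum]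
    rw [Finset.sum_comm]
    refine Finset.sum_congr rfl fun m _ => ?_
    rw [wittOp_apply, pw, Finset.mul_sum, Finset.sum_mul, ← Finset.sum_add_distrib, Finset.mul_sum]
    refine Finset.sum_congr rfl fun i _ => ?_
    simp only [Derivation.leibniz, theta_Z, smul_eq_mul, if_true, Derivation.map_intCast]
    ring
  have hcross : ∑ i, theta i (vdm N) * theta i g
      = ∑ m ∈ t, (m : Lau N) * wittOp m (vdm N) * d m := by
    simp only [ht, Finset.mul_sum]
    rw [Finset.sum_comm]
    refine Finset.sum_congr rfl fun m _ => ?_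
    rw [wittOp_apply, Finset.mul_sum, Finset.sum_mul]
    refine Finset.sum_congr rfl fun i _ => ?_
    ring
  have h0 := casOp_vdm (N := N)
  rw [casOp_eq] at h0 ⊢
  set c : ℂ := ∑ i : Fin N, ((i : ℂ) * ((i : ℂ) - (N - 1)))
  have e1 : ∑ i, theta i (theta i (vdm N * g)) = (∑ i, theta i (theta i (vdm N))) * g
      + 2 * ∑ i, theta i (vdm N) * theta i g + vdm N * ∑ i, theta i (theta i g) := by
    simp only [Finset.mul_sum, Finset.sum_mul, ← Finset.sum_add_distrib]
    refine Finset.sum_congr rfl fun i _ => ?_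
    simp only [Derivation.leibniz, map_add, smul_eq_mul]
    ring
  have e2 : ∑ i, theta i (vdm N * g) = (∑ i, theta i (vdm N)) * g + vdm N * ∑ i, theta i g := by
    simp only [Finset.mul_sum, Finset.sum_mul, ← Finset.sum_add_distrib]
    refine Finset.sum_congr rfl fun i _ => ?_
    simp only [Derivation.leibniz, smul_eq_mul]
    ring
  have e3 : ∑ i, theta i (theta i (vdm N * g)) - ((N : ℂ) - 1) • ∑ i, theta i (vdm N * g)
        - c • (vdm N * g)
      = (∑ i, theta i (theta i (vdm N)) - ((N : ℂ) - 1) • ∑ i, theta i (vdm N) - c • vdm N) * g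
        + 2 * ∑ i, theta i (vdm N) * theta i g
        + vdm N * (∑ i, theta i (theta i g) - ((N : ℂ) - 1) • ∑ i, theta i g) := by
    rw [e1, e2]
    simp only [sub_mul, mul_sub, smul_mul_assoc, mul_smul_comm, smul_add]
    ring
  have hN : ∀ x : Lau N, ((N : ℂ) - 1) • x = ((N : Lau N) - 1) * x := by
    intro x
    rw [Algebra.smul_def, map_sub, map_natCast, map_one]
  rw [e3, h0, zero_mul, zero_add, hcross, hθθ, hθ, hN, map_sum, Finset.mul_sum, Finset.mul_sum,
    Finset.mul_sum, ← Finset.sum_sub_distrib, Finset.mul_sum, ← Finset.sum_add_distrib]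
  refine Finset.sum_congr rfl fun m _ => ?_
  have hw := two_mul_wittOp_vdm (N := N) m
  push_cast at hw
  rw [formalCasTerm, map_mul, map_add, map_mul, toLau_quad, toLau_formalWitt, map_intCast]
  linear_combination (-(m : Lau N) * d m) * hw

/-! ### Functionals annihilated by the loop equations -/

section loop

variable {L : Formal →ₗ[ℂ] ℂ}

lemma map_formalCasTerm
    (hloop : ∀ m f, L (quad MvPolynomial.X m * f + formalWitt m f) = 0) (f : Formal) (m : ℤ) :
    L (formalCasTerm f m) = 0 := by
  have : formalCasTerm f m = (m : ℂ) •
      (quad MvPolynomial.X m * MvPolynomial.pderiv m f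
        + formalWitt m (MvPolynomial.pderiv m f)) := by
    rw [formalCasTerm, Algebra.smul_def]
    simp
  rw [this, map_smul, hloop, smul_zero]

lemma map_eq_zero_of_support (hker : ∀ x, toLau N x = 0 → L x = 0)
    (hloop : ∀ m f, L (quad MvPolynomial.X m * f + formalWitt m f) = 0) (Q : Finset ℤ) :
    0 ∉ Q → ∀ x : Formal, (∀ v, (vdm N * toLau N x).coeff v ≠ 0 → cas v ∈ Q) → L x = 0 := by
  induction Q using Finset.induction_on with
  | empty =>
    intro _ x hx
    apply hker
    have h : vdm N * toLau N x = 0 := by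
      ext v
      by_contra hv
      exact absurd (hx v hv) (by simp)
    exact (mul_eq_zero.mp h).resolve_left vdm_ne_zero
  | insert q Q hq ih =>
    intro h0 x hx
    obtain ⟨t, ht⟩ := exists_formalCas N x
    have hq0 : (q : ℂ) ≠ 0 := by
      intro h
      apply h0
      have : q = 0 := by exact_mod_cast h
      simp [this]
    have key : L (∑ m ∈ t, formalCasTerm x m - (q : ℂ) • x) = 0 := by
      refine ih (fun h => h0 (Finset.mem_insert_of_mem h)) _ fun v hv => ?_
      have hc : (vdm N * toLau N (∑ m ∈ t, formalCasTerm x m - (q : ℂ) • x)).coeff v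
          = ((cas v : ℂ) - q) * (vdm N * toLau N x).coeff v := by
        rw [map_sub, mul_sub, ht, map_smul, mul_smul_comm, AddMonoidAlgebra.coeff_sub,
          Finsupp.sub_apply, casOp, diagOp_coeff, AddMonoidAlgebra.coeff_smul, Finsupp.smul_apply,
          smul_eq_mul, sub_mul]
      rw [hc] at hv
      refine Finset.mem_of_mem_insert_of_ne (hx v (right_ne_zero_of_mul hv)) fun h => ?_
      exact left_ne_zero_of_mul hv (by rw [h, sub_self])
    rw [map_sub, map_smul, map_sum,
      Finset.sum_eq_zero fun m _ => map_formalCasTerm hloop x m, zero_sub, neg_eq_zero,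
      smul_eq_mul] at key
    exact (mul_eq_zero.mp key).resolve_left hq0

theorem functional_eq_coeff (hone : L 1 = 1) (hker : ∀ x, toLau N x = 0 → L x = 0)
    (hloop : ∀ m f, L (quad MvPolynomial.X m * f + formalWitt m f) = 0) (f : Formal) :
    L f = (vdm N * toLau N f).coeff fun i => (i : ℤ) := by
  classical
  set κ := (vdm N * toLau N f).coeff fun i => (i : ℤ) with hκ
  set x : Formal := f - MvPolynomial.C κ with hx
  have hcoeff : (vdm N * toLau N x).coeff (fun i => (i : ℤ)) = 0 := by
    rw [hx, map_sub, mul_sub, AddMonoidAlgebra.coeff_sub, Finsupp.sub_apply, ← hκ,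
      ← MvPolynomial.algebraMap_eq, AlgHom.commutes, ← Algebra.commutes, ← Algebra.smul_def,
      AddMonoidAlgebra.coeff_smul, Finsupp.smul_apply, vdm_coeff, eps_id]
    simp
  have hL : L x = 0 := by
    refine map_eq_zero_of_support (N := N) hker hloop
      ((vdm N * toLau N x).coeff.support.image cas) ?_ x ?_
    · rw [Finset.mem_image]
      rintro ⟨v, hv, hc⟩
      rw [Finsupp.mem_support_iff] at hv
      have hinj : Function.Injective v := by
        by_contra h
        exact hv (coeff_eq_zero_of_not_injective x h)
      obtain ⟨σ, hσ⟩ := exists_perm_of_cas_eq_zero hinj hc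
      have h := coeff_comp_perm σ x v
      rw [show v ∘ σ = fun i : Fin N => (i : ℤ) from funext hσ, hcoeff] at h
      rcases mul_eq_zero.mp h.symm with h | h
      · rcases Int.units_eq_one_or (Equiv.Perm.sign σ) with h' | h' <;> simp [h'] at h
      · exact hv h
    · intro v hv
      exact Finset.mem_image_of_mem _ (Finsupp.mem_support_iff.mpr hv)
  rw [hx, map_sub, sub_eq_zero] at hL
  rw [hL, ← mul_one (MvPolynomial.C κ), ← MvPolynomial.smul_eq_C_mul, map_smul, hone, smul_eq_mul,
    mul_one]

end loop

/-! ### Calculus on the unitary group -/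

section calculus

open scoped Matrix.Norms.L2Operator

/-- The group of unitary matrices. -/
abbrev UGroup (N : ℕ) := ↥(Matrix.unitaryGroup (Fin N) ℂ)

instance : BorelSpace (Matrix (Fin N) (Fin N) ℂ) :=
  show BorelSpace (Fin N → Fin N → ℂ) from inferInstance

instance : CompactSpace (UGroup N) := by
  have : IsCompact (Matrix.unitaryGroup (Fin N) ℂ : Set (Matrix (Fin N) (Fin N) ℂ)) := by
    refine Metric.isCompact_of_isClosed_isBounded isClosed_unitary ?_
    refine (Metric.isBounded_iff_subset_closedBall 0).mpr ⟨1, fun A hA => ?_⟩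
    rw [mem_closedBall_zero_iff]
    rcases subsingleton_or_nontrivial (Matrix (Fin N) (Fin N) ℂ) with h | h
    · rw [Subsingleton.elim A 0, norm_zero]; exact zero_le_one
    · exact (CStarRing.norm_of_mem_unitary hA).le
  exact isCompact_iff_compactSpace.mp this

lemma exp_mem_unitaryGroup {X : Matrix (Fin N) (Fin N) ℂ} (hX : star X = -X) :
    NormedSpace.exp X ∈ Matrix.unitaryGroup (Fin N) ℂ := by
  rw [Matrix.mem_unitaryGroup_iff, NormedSpace.star_exp, hX,
    ← Matrix.exp_add_of_commute _ _ (Commute.refl X).neg_right, add_neg_cancel,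
    NormedSpace.exp_zero]

lemma star_smul_of_skew {X : Matrix (Fin N) (Fin N) ℂ} (hX : star X = -X) (t : ℝ) :
    star (t • X) = -(t • X) := by
  rw [star_smul, hX, star_trivial, smul_neg]

/-- The one-parameter subgroup generated by a skew-Hermitian matrix. -/
def flow {X : Matrix (Fin N) (Fin N) ℂ} (hX : star X = -X) (t : ℝ) : UGroup N :=
  ⟨NormedSpace.exp (t • X), exp_mem_unitaryGroup (star_smul_of_skew hX t)⟩

variable {X : Matrix (Fin N) (Fin N) ℂ} (hX : star X = -X)

lemma flow_zero : flow hX 0 = 1 := by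
  ext1; simp [flow]

lemma flow_add (s t : ℝ) : flow hX (s + t) = flow hX s * flow hX t := by
  apply Subtype.ext
  simp only [flow, add_smul]
  exact Matrix.exp_add_of_commute _ _ (((Commute.refl X).smul_left s).smul_right t)

lemma hasDerivAt_flow : HasDerivAt (fun t => ((flow hX t : UGroup N) : Matrix _ _ ℂ)) X 0 := by
  have := hasDerivAt_exp_smul_const (𝕂 := ℝ) X 0
  simp only [zero_smul, NormedSpace.exp_zero, one_mul] at this
  exact this

lemma hasDerivAt_flow_inv :
    HasDerivAt (fun t => (((flow hX t)⁻¹ : UGroup N) : Matrix _ _ ℂ)) (-X) 0 := by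
  have := hasDerivAt_exp_smul_const (𝕂 := ℝ) (-X) 0
  simp only [zero_smul, NormedSpace.exp_zero, one_mul] at this
  refine HasDerivAt.congr_of_eventuallyEq this (Filter.Eventually.of_forall fun t => ?_)
  have : (flow hX t)⁻¹ = flow hX (-t) := by
    rw [inv_eq_iff_mul_eq_one, ← flow_add, add_neg_cancel, flow_zero]
  show (((flow hX t)⁻¹ : UGroup N) : Matrix (Fin N) (Fin N) ℂ) = _
  rw [this]
  simp only [flow, smul_neg, neg_smul]

/-- The power of a unitary matrix, as a matrix. -/
def zp (A : UGroup N) (m : ℤ) : Matrix (Fin N) (Fin N) ℂ := ((A ^ m : UGroup N) : Matrix _ _ ℂ)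

lemma zp_zero (A : UGroup N) : zp A 0 = 1 := by simp [zp]

lemma zp_one (A : UGroup N) : zp A 1 = (A : Matrix _ _ ℂ) := by simp [zp]

lemma zp_add (A : UGroup N) (m n : ℤ) : zp A (m + n) = zp A m * zp A n := by
  simp only [zp, _root_.zpow_add]; rfl

lemma continuous_zp (m : ℤ) : Continuous fun A : UGroup N => zp A m :=
  continuous_subtype_val.comp (continuous_zpow m)

lemma osum_mul {R : Type*} [Ring R] (m : ℤ) (x : R) (F : ℤ → R) :
    osum m F * x = osum m (fun a => F a * x) := by
  simp [osum, sub_mul, Finset.sum_mul]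

lemma hasDerivAt_zp_flow_mul (A : UGroup N) (m : ℤ) :
    HasDerivAt (fun t => zp (flow hX t * A) m)
      (osum m fun a => zp A a * X * zp A (m - a)) 0 := by
  induction m using Int.induction_on with
  | zero => simpa [zp_zero] using hasDerivAt_const _ _
  | succ n ih =>
    have h := HasDerivAt.mul ih ((hasDerivAt_flow hX).mul_const (A : Matrix (Fin N) (Fin N) ℂ))
    refine HasDerivAt.congr_deriv (HasDerivAt.congr_of_eventuallyEq h
      (Filter.Eventually.of_forall fun t => ?_)) ?_
    · simp [zp_add, zp_one]
    · simp only [flow_zero, one_mul, osum_succ, add_sub_cancel_left, zp_one, osum_mul]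
      congr 1
      · congr 1
        ext1 a
        rw [mul_assoc, OneMemClass.coe_one, one_mul, ← zp_one A, ← zp_add]
        congr 2
        ring
      · simp [mul_assoc]
  | pred n ih =>
    have h := HasDerivAt.mul ih
      ((hasDerivAt_flow_inv hX).const_mul (zp A (-1)))
    refine HasDerivAt.congr_deriv (HasDerivAt.congr_of_eventuallyEq h
      (Filter.Eventually.of_forall fun t => ?_)) ?_
    · simp [sub_eq_add_neg, zp_add]
      simp [zp]
    · have h1 : osum (-(n : ℤ) - 1) (fun a => zp A a * X * zp A (-(n : ℤ) - 1 - a))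
          + zp A (-(n : ℤ) - 1) * X * zp A 0
          = osum (-(n : ℤ)) fun a => zp A a * X * zp A (-(n : ℤ) - 1 - a) := by
        have := osum_succ (-(n : ℤ) - 1) fun a => zp A a * X * zp A (-(n : ℤ) - 1 - a)
        rw [sub_add_cancel, sub_self] at this
        exact this.symm
      have h2 : (osum (-(n : ℤ)) fun a => zp A a * X * zp A (-(n : ℤ) - a)) * zp A (-1)
          = osum (-(n : ℤ)) fun a => zp A a * X * zp A (-(n : ℤ) - 1 - a) := by
        rw [osum_mul]
        congr 1
        ext1 a
        rw [mul_assoc, ← zp_add]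
        congr 2
        ring
      have h3 : zp A (-(n : ℤ) - 1) = zp A (-(n : ℤ)) * zp A (-1) := by
        rw [← zp_add, sub_eq_add_neg]
      rw [eq_sub_of_add_eq h1, ← h2, h3, flow_zero, inv_one, one_mul, zp_zero, OneMemClass.coe_one]
      noncomm_ring

end calculus

section grad

lemma integrable_of_continuous {ν : Measure (UGroup N)} [IsProbabilityMeasure ν] {E : Type*}
    [NormedAddCommGroup E] {F : UGroup N → E} (h : Continuous F) : Integrable F ν :=
  h.integrable_of_hasCompactSupport (HasCompactSupport.of_compactSpace F)

/-- `W` is the gradient of `F` with respect to left translations. -/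
structure HasGrad (F : UGroup N → ℂ) (W : UGroup N → Matrix (Fin N) (Fin N) ℂ) : Prop where
  continuous_fun : Continuous F
  continuous_grad : Continuous W
  deriv : ∀ (X : Matrix (Fin N) (Fin N) ℂ) (hX : star X = -X) (A : UGroup N),
    HasDerivAt (fun t => F (flow hX t * A)) (trace (X * W A)) 0

namespace HasGrad

variable {F F₁ F₂ : UGroup N → ℂ} {W W₁ W₂ : UGroup N → Matrix (Fin N) (Fin N) ℂ}

lemma const (c : ℂ) : HasGrad (N := N) (fun _ => c) 0 where
  continuous_fun := continuous_const
  continuous_grad := continuous_const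
  deriv X hX A := by simpa using hasDerivAt_const (0 : ℝ) c

lemma add (h₁ : HasGrad F₁ W₁) (h₂ : HasGrad F₂ W₂) :
    HasGrad (fun A => F₁ A + F₂ A) (fun A => W₁ A + W₂ A) where
  continuous_fun := h₁.1.add h₂.1
  continuous_grad := h₁.2.add h₂.2
  deriv X hX A := by
    rw [mul_add, trace_add]
    exact (h₁.3 X hX A).add (h₂.3 X hX A)

lemma mul (h₁ : HasGrad F₁ W₁) (h₂ : HasGrad F₂ W₂) :
    HasGrad (fun A => F₁ A * F₂ A) (fun A => F₂ A • W₁ A + F₁ A • W₂ A) where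
  continuous_fun := h₁.1.mul h₂.1
  continuous_grad := (h₂.1.smul h₁.2).add (h₁.1.smul h₂.2)
  deriv X hX A := by
    refine ((h₁.3 X hX A).mul (h₂.3 X hX A)).congr_deriv ?_
    simp only [flow_zero, one_mul, mul_add, mul_smul_comm, trace_add, trace_smul, smul_eq_mul]
    ring

lemma sum {ι : Type*} (s : Finset ι) {F : ι → UGroup N → ℂ}
    {W : ι → UGroup N → Matrix (Fin N) (Fin N) ℂ} (h : ∀ i ∈ s, HasGrad (F i) (W i)) :
    HasGrad (fun A => ∑ i ∈ s, F i A) (fun A => ∑ i ∈ s, W i A) := by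
  classical
  induction s using Finset.induction_on with
  | empty => exact const 0
  | insert a s ha ih =>
    simp only [Finset.sum_insert ha]
    exact (h a (by simp)).add (ih fun i hi => h i (by simp [hi]))

lemma congr_grad (h : HasGrad F W) {W' : UGroup N → Matrix (Fin N) (Fin N) ℂ}
    (hW : ∀ A, W A = W' A) : HasGrad F W' := by
  rwa [← funext hW]

variable {ν : Measure (UGroup N)} [IsProbabilityMeasure ν]

lemma hasDerivAt (h : HasGrad F W) {X : Matrix (Fin N) (Fin N) ℂ} (hX : star X = -X)
    (A : UGroup N) (t : ℝ) :
    HasDerivAt (fun t => F (flow hX t * A)) (trace (X * W (flow hX t * A))) t := by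
  have h1 := h.deriv X hX (flow hX t * A)
  have h2 : HasDerivAt (fun s : ℝ => s - t) 1 t := (hasDerivAt_id t).sub_const t
  have h3 := HasDerivAt.scomp_of_eq t h1 h2 (sub_self t).symm
  simp only [one_smul, Function.comp_def, ← mul_assoc, ← flow_add, sub_add_cancel] at h3
  exact h3

lemma integral_trace_of_skew (hν : ∀ g : UGroup N, ν.map (g * ·) = ν) (h : HasGrad F W)
    {X : Matrix (Fin N) (Fin N) ℂ} (hX : star X = -X) : ∫ A, trace (X * W A) ∂ν = 0 := by
  have hc : Continuous fun A => trace (X * W A) :=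
    (continuous_const.matrix_mul h.2).matrix_trace
  obtain ⟨C, hC⟩ := isCompact_univ.exists_bound_of_continuousOn hc.continuousOn
  have h1 := hasDerivAt_integral_of_dominated_loc_of_deriv_le (μ := ν) (x₀ := (0 : ℝ))
    (F := fun t A => F (flow hX t * A)) (F' := fun t A => trace (X * W (flow hX t * A)))
    (bound := fun _ => C) (s := Set.univ) Filter.univ_mem
    (Filter.Eventually.of_forall fun t =>
      (h.1.comp (continuous_const.mul continuous_id)).aestronglyMeasurable)
    (integrable_of_continuous (h.1.comp (continuous_const.mul continuous_id)))
    (hc.comp (continuous_const.mul continuous_id)).aestronglyMeasurable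
    (Filter.Eventually.of_forall fun A t _ => hC _ (Set.mem_univ _))
    (integrable_const _)
    (Filter.Eventually.of_forall fun A t _ => h.hasDerivAt hX A t)
  have h2 : ∀ t, ∫ A, F (flow hX t * A) ∂ν = ∫ A, F A ∂ν := by
    intro t
    conv_rhs => rw [← hν (flow hX t)]
    rw [integral_map (measurable_const_mul _).aemeasurable h.1.aestronglyMeasurable]
  have h3 := h1.2
  simp only [h2, flow_zero, one_mul] at h3
  exact h3.unique (hasDerivAt_const _ _)

lemma integral_trace (hν : ∀ g : UGroup N, ν.map (g * ·) = ν) (h : HasGrad F W)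
    (X : Matrix (Fin N) (Fin N) ℂ) : ∫ A, trace (X * W A) ∂ν = 0 := by
  have h1 : star (X - star X) = -(X - star X) := by simp
  have h2 : star (Complex.I • (X + star X)) = -(Complex.I • (X + star X)) := by
    simp [add_comm]
  have e : ∀ A, trace (X * W A) = (1 / 2 : ℂ) * trace ((X - star X) * W A)
      + (-Complex.I / 2) * trace ((Complex.I • (X + star X)) * W A) := by
    intro A
    simp only [sub_mul, add_mul, smul_mul_assoc, trace_sub, trace_add, trace_smul, smul_eq_mul]
    ring_nf
    simp
    ring
  have hc : ∀ Y : Matrix (Fin N) (Fin N) ℂ, Integrable (fun A => trace (Y * W A)) ν :=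
    fun Y => integrable_of_continuous (continuous_const.matrix_mul h.2).matrix_trace
  simp_rw [e]
  rw [integral_add ((hc _).const_mul _) ((hc _).const_mul _), integral_const_mul,
    integral_const_mul, h.integral_trace_of_skew hν h1, h.integral_trace_of_skew hν h2]
  simp

lemma integral_apply (hν : ∀ g : UGroup N, ν.map (g * ·) = ν) (h : HasGrad F W) (i j : Fin N) :
    ∫ A, W A i j ∂ν = 0 := by
  simpa [trace_single_mul] using h.integral_trace hν (Matrix.single j i 1)

end HasGrad

lemma hasGrad_zp (m : ℤ) (i j : Fin N) :
    HasGrad (fun A => zp A m i j)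
      (fun A => osum m fun a => zp A (m - a) * Matrix.single j i 1 * zp A a) where
  continuous_fun := (continuous_zp m).matrix_elem i j
  continuous_grad := by
    unfold osum
    have : ∀ a, Continuous fun A : UGroup N => zp A (m - a) * Matrix.single j i 1 * zp A a :=
      fun a => ((continuous_zp _).matrix_mul continuous_const).matrix_mul (continuous_zp _)
    exact (continuous_finsetSum _ fun a _ => this a).sub
      (continuous_finsetSum _ fun a _ => this a)
  deriv X hX A := by
    have h := hasDerivAt_zp_flow_mul hX A m
    have h2 := hasDerivAt_pi.mp (hasDerivAt_pi.mp h i) j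
    refine HasDerivAt.congr_deriv h2 ?_
    show (osum m fun a => zp A a * X * zp A (m - a)) i j = _
    have e1 := map_osum (Matrix.entryAddMonoidHom ℂ i j) m fun a => zp A a * X * zp A (m - a)
    simp only [Matrix.entryAddMonoidHom_apply] at e1
    have e2 := map_osum (Matrix.traceAddMonoidHom (Fin N) ℂ) m fun a =>
      X * (zp A (m - a) * Matrix.single j i 1 * zp A a)
    simp only [Matrix.traceAddMonoidHom_apply] at e2
    rw [e1, mul_osum, e2]
    congr 1
    ext1 a
    rw [← mul_assoc, trace_mul_comm, ← mul_assoc, ← mul_assoc, trace_mul_single]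
    simp

end grad

section loopEquation

/-- Evaluation of a formal polynomial at the traces of the powers of a unitary matrix. -/
def evalTr (A : UGroup N) : Formal →ₐ[ℂ] ℂ := MvPolynomial.aeval fun m => trace (zp A m)

@[simp] lemma evalTr_X (A : UGroup N) (m : ℤ) :
    evalTr A (MvPolynomial.X m) = trace (zp A m) := MvPolynomial.aeval_X _ _

lemma hasGrad_trace (n : ℤ) :
    HasGrad (fun A : UGroup N => trace (zp A n)) (fun A => (n : ℂ) • zp A n) := by
  refine (HasGrad.sum Finset.univ fun i _ => hasGrad_zp n i i).congr_grad fun A => ?_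
  rw [sum_osum]
  have : ∀ a : ℤ, ∑ i, zp A (n - a) * Matrix.single i i 1 * zp A a = zp A n := by
    intro a
    rw [← Finset.sum_mul, ← Finset.mul_sum, Matrix.sum_single_one, mul_one, ← zp_add,
      sub_add_cancel]
  simp only [this, osum_const]
  rw [← zsmul_eq_mul, Int.cast_smul_eq_zsmul]

lemma exists_hasGrad_evalTr (f : Formal) :
    ∃ W : UGroup N → Matrix (Fin N) (Fin N) ℂ, HasGrad (fun A => evalTr A f) W ∧
      ∀ m A, trace (zp A m * W A) = evalTr A (formalWitt m f) := by
  induction f using MvPolynomial.induction_on with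
  | C a =>
    refine ⟨0, ?_, fun m A => ?_⟩
    · simpa [← MvPolynomial.algebraMap_eq] using HasGrad.const a
    · rw [← MvPolynomial.algebraMap_eq, Derivation.map_algebraMap]
      simp
  | add p q hp hq =>
    obtain ⟨W₁, h₁, h₁'⟩ := hp
    obtain ⟨W₂, h₂, h₂'⟩ := hq
    refine ⟨fun A => W₁ A + W₂ A, ?_, fun m A => ?_⟩
    · simpa only [map_add] using h₁.add h₂
    · rw [mul_add, trace_add, h₁', h₂', map_add, map_add]
  | mul_X p n hp =>
    obtain ⟨W, h, h'⟩ := hp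
    refine ⟨fun A => trace (zp A n) • W A + evalTr A p • (n : ℂ) • zp A n, ?_, fun m A => ?_⟩
    · simpa only [map_mul, evalTr_X] using h.mul (hasGrad_trace n)
    · rw [Derivation.leibniz, formalWitt_X]
      simp only [mul_add, mul_smul_comm, trace_add, trace_smul, h', smul_eq_mul, map_add, map_mul,
        evalTr_X, ← zp_add, map_intCast]
      ring

lemma continuous_evalTr (f : Formal) : Continuous fun A : UGroup N => evalTr A f :=
  (exists_hasGrad_evalTr f).choose_spec.1.1

variable {ν : Measure (UGroup N)} [IsProbabilityMeasure ν]

theorem integral_evalTr_loop (hν : ∀ g : UGroup N, ν.map (g * ·) = ν) (m : ℤ) (f : Formal) :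
    ∫ A, evalTr A (quad MvPolynomial.X m * f + formalWitt m f) ∂ν = 0 := by
  obtain ⟨W, h, h'⟩ := exists_hasGrad_evalTr (N := N) f
  have key : ∀ A : UGroup N, evalTr A (quad MvPolynomial.X m * f + formalWitt m f)
      = ∑ i, ∑ j, (evalTr A f • (osum m fun a => zp A (m - a) * Matrix.single j i 1 * zp A a)
        + zp A m i j • W A) j i := by
    intro A
    have e1 : ∀ i j,
        (osum m fun a => zp A (m - a) * Matrix.single j i (1 : ℂ) * zp A a : Matrix _ _ ℂ) j i
        = osum m fun a => zp A a i i * zp A (m - a) j j := by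
      intro i j
      have := map_osum (Matrix.entryAddMonoidHom ℂ j i) m fun a =>
        zp A (m - a) * Matrix.single j i 1 * zp A a
      simp only [Matrix.entryAddMonoidHom_apply] at this
      rw [this]
      congr 1
      ext1 a
      rw [mul_assoc, Matrix.mul_apply, Finset.sum_eq_single j]
      · simp [mul_comm]
      · intro b _ hb
        rw [Matrix.single_mul_apply_of_ne _ _ _ _ _ hb, mul_zero]
      · simp
    simp only [Matrix.add_apply, Matrix.smul_apply, smul_eq_mul, e1, Finset.sum_add_distrib,
      ← Finset.mul_sum, sum_osum]
    rw [map_add, map_mul, ← h', mul_comm]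
    congr 1
    congr 1
    rw [quad, map_osum]
    congr 1
    ext1 a
    simp only [map_mul, evalTr_X, trace, Matrix.diag_apply, Finset.sum_mul, Finset.mul_sum]
    exact Finset.sum_comm
  simp_rw [key]
  have hG : ∀ i j, HasGrad (fun A => zp A m i j * evalTr A f)
      (fun A => evalTr A f • (osum m fun a => zp A (m - a) * Matrix.single j i 1 * zp A a)
        + zp A m i j • W A) := fun i j => (hasGrad_zp m i j).mul h
  have hI : ∀ i j, Integrable (fun A => (evalTr A f •
      (osum m fun a => zp A (m - a) * Matrix.single j i 1 * zp A a) + zp A m i j • W A) j i) ν :=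
    fun i j => integrable_of_continuous ((hG i j).2.matrix_elem j i)
  rw [integral_finsetSum _ fun i _ => integrable_finsetSum _ fun j _ => hI i j]
  refine Finset.sum_eq_zero fun i _ => ?_
  rw [integral_finsetSum _ fun j _ => hI i j]
  exact Finset.sum_eq_zero fun j _ => (hG i j).integral_apply hν j i

end loopEquation

section eigenvalues

open Polynomial

lemma exists_charpoly_eq_prod (A : Matrix (Fin N) (Fin N) ℂ) :
    ∃ z : Fin N → ℂ, A.charpoly = ∏ i, (X - C (z i)) := by
  have hs : ∀ s : Multiset ℂ, s.card = N → ∃ z : Fin N → ℂ, s = Finset.univ.val.map z := by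
    intro s hs
    induction s using Quotient.inductionOn with
    | h l =>
      obtain rfl : l.length = N := hs
      exact ⟨l.get, by rw [Fin.univ_val_map, List.ofFn_get]; rfl⟩
  obtain ⟨z, hz⟩ := hs A.charpoly.roots (by
    rw [IsAlgClosed.card_roots_eq_natDegree, Matrix.charpoly_natDegree_eq_dim, Fintype.card_fin])
  refine ⟨z, ?_⟩
  have h := (IsAlgClosed.splits A.charpoly).eq_prod_roots
  rw [A.charpoly_monic.leadingCoeff, C_1, one_mul, hz, Multiset.map_map] at h
  exact h

lemma det_aeval {A : Matrix (Fin N) (Fin N) ℂ} {z : Fin N → ℂ}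
    (hz : A.charpoly = ∏ i, (X - C (z i))) (p : ℂ[X]) :
    (aeval A p).det = ∏ i, p.eval (z i) := by
  have hmul : ∀ p q : ℂ[X], (aeval A p).det = ∏ i, p.eval (z i) →
      (aeval A q).det = ∏ i, q.eval (z i) → (aeval A (p * q)).det = ∏ i, (p * q).eval (z i) := by
    intro p q hp hq
    simp only [map_mul, det_mul, hp, hq, eval_mul, Finset.prod_mul_distrib]
  rw [(IsAlgClosed.splits p).eq_prod_roots]
  apply hmul
  · rw [aeval_C, Matrix.algebraMap_eq_diagonal, det_diagonal]
    simp
  · induction p.roots using Multiset.induction_on with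
    | empty => simp
    | cons r s ih =>
      rw [Multiset.map_cons, Multiset.prod_cons]
      refine hmul _ _ ?_ ih
      have h1 : aeval A (X - C r) = -(Matrix.scalar (Fin N) r - A) := by
        simp [Matrix.algebraMap_eq_diagonal, Matrix.scalar_apply]
      rw [h1, det_neg, ← Matrix.eval_charpoly, hz, eval_prod]
      simp only [eval_sub, eval_X, eval_C, Fintype.card_fin]
      have h2 : (-1 : ℂ) ^ N = ∏ _i : Fin N, (-1 : ℂ) := by simp
      rw [h2, ← Finset.prod_mul_distrib]
      simp

lemma trace_pow_eq_sum {A : Matrix (Fin N) (Fin N) ℂ} {z : Fin N → ℂ}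
    (hz : A.charpoly = ∏ i, (X - C (z i))) (k : ℕ) : (A ^ k).trace = ∑ i, z i ^ k := by
  have h : (A ^ k).charpoly = ∏ i, (X - C (z i ^ k)) := by
    apply Polynomial.funext
    intro r
    have := det_aeval hz (C r - X ^ k)
    rw [Matrix.eval_charpoly, eval_prod]
    simp only [map_sub, aeval_C, map_pow, aeval_X, eval_sub, eval_C, eval_pow, eval_X] at this ⊢
    exact this
  rw [Matrix.trace_eq_sum_roots_charpoly, h]
  have := roots_multiset_prod_X_sub_C (Finset.univ.val.map fun i => z i ^ k)
  rw [Multiset.map_map] at this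
  erw [this]
  rfl

open scoped Matrix.Norms.L2Operator in
lemma norm_eigenvalue {A : UGroup N} {z : Fin N → ℂ}
    (hz : (A : Matrix (Fin N) (Fin N) ℂ).charpoly = ∏ i, (X - C (z i))) (i : Fin N) :
    ‖z i‖ = 1 := by
  have h : z i ∈ spectrum ℂ (A : Matrix (Fin N) (Fin N) ℂ) := by
    rw [Matrix.mem_spectrum_iff_isRoot_charpoly, hz, IsRoot, eval_prod]
    exact Finset.prod_eq_zero (Finset.mem_univ i) (by simp)
  simpa using spectrum.subset_circle_of_unitary A.2 h

lemma trace_zp_neg (A : UGroup N) (m : ℤ) : (zp A (-m)).trace = star (zp A m).trace := by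
  rw [← Matrix.trace_conjTranspose, zp, _root_.zpow_neg]
  rfl

lemma trace_zp_eq_sum {A : UGroup N} {z : Fin N → ℂ}
    (hz : (A : Matrix (Fin N) (Fin N) ℂ).charpoly = ∏ i, (X - C (z i))) (m : ℤ) :
    (zp A m).trace = ∑ i, z i ^ m := by
  have hpos : ∀ k : ℕ, (zp A k).trace = ∑ i, z i ^ (k : ℤ) := by
    intro k
    rw [zp, _root_.zpow_natCast, SubmonoidClass.coe_pow, trace_pow_eq_sum hz]
    simp
  obtain ⟨k, rfl | rfl⟩ := m.eq_nat_or_neg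
  · exact hpos k
  · rw [trace_zp_neg, hpos, star_sum]
    refine Finset.sum_congr rfl fun i _ => ?_
    have h : star (z i) = (z i)⁻¹ := by
      rw [Complex.inv_def, Complex.normSq_eq_norm_sq, norm_eigenvalue hz]
      simp
    rw [star_zpow₀, h, _root_.inv_zpow, _root_.zpow_neg]

/-- Evaluation of Laurent polynomials at a point with nonzero coordinates. -/
def evalLau (z : Fin N → ℂ) (hz : ∀ i, z i ≠ 0) : Lau N →ₐ[ℂ] ℂ :=
  AddMonoidAlgebra.lift ℂ ℂ (Fin N → ℤ)
    { toFun := fun v => ∏ i, z i ^ (v.toAdd i)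
      map_one' := by simp
      map_mul' := fun v w => by
        simp [zpow_add₀ (hz _), Finset.prod_mul_distrib] }

lemma evalLau_pw (z : Fin N → ℂ) (hz : ∀ i, z i ≠ 0) (m : ℤ) :
    evalLau z hz (pw m) = ∑ i, z i ^ m := by
  rw [pw, map_sum]
  refine Finset.sum_congr rfl fun i _ => ?_
  rw [Z, evalLau, AddMonoidAlgebra.lift_single, one_smul]
  simp only [MonoidHom.coe_mk, OneHom.coe_mk, toAdd_ofAdd]
  rw [Finset.prod_eq_single i]
  · simp
  · intro j _ hj
    simp [hj]
  · simp

lemma evalTr_eq_zero (A : UGroup N) {f : Formal} (hf : toLau N f = 0) : evalTr A f = 0 := by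
  obtain ⟨z, hz⟩ := exists_charpoly_eq_prod (A : Matrix (Fin N) (Fin N) ℂ)
  have h0 : ∀ i, z i ≠ 0 := fun i h => by simpa [h] using norm_eigenvalue hz i
  have : evalTr A = (evalLau z h0).comp (toLau N) := by
    apply MvPolynomial.algHom_ext
    intro m
    simp [evalLau_pw, trace_zp_eq_sum hz]
  rw [this, AlgHom.comp_apply, hf, map_zero]

lemma norm_trace_zp_le (A : UGroup N) (m : ℤ) : ‖(zp A m).trace‖ ≤ N := by
  obtain ⟨z, hz⟩ := exists_charpoly_eq_prod (A : Matrix (Fin N) (Fin N) ℂ)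
  rw [trace_zp_eq_sum hz]
  refine (norm_sum_le _ _).trans ?_
  simp [norm_zpow, norm_eigenvalue hz]

end eigenvalues

section integral

variable {ν : Measure (UGroup N)} [IsProbabilityMeasure ν]

theorem integral_evalTr (hν : ∀ g : UGroup N, ν.map (g * ·) = ν) (f : Formal) :
    ∫ A, evalTr A f ∂ν = (vdm N * toLau N f).coeff fun i => (i : ℤ) := by
  have hI : ∀ f, Integrable (fun A => evalTr A f) ν :=
    fun f => integrable_of_continuous (continuous_evalTr f)
  let L : Formal →ₗ[ℂ] ℂ :=
    { toFun := fun f => ∫ A, evalTr A f ∂ν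
      map_add' := fun f g => by
        simp only [map_add]
        exact integral_add (hI f) (hI g)
      map_smul' := fun c f => by
        simp only [map_smul, RingHom.id_apply, smul_eq_mul]
        exact integral_const_mul c _ }
  refine functional_eq_coeff (L := L) ?_ ?_ ?_ f
  · simp [L]
  · intro x hx
    simp [L, evalTr_eq_zero _ hx]
  · exact integral_evalTr_loop hν

end integral

section counting

/-- The staircase exponent. -/
abbrev stair (N : ℕ) : Fin N → ℤ := fun i => (i : ℤ)

lemma coeff_mul_pw (f : Lau N) (m : ℤ) (v : Fin N → ℤ) :
    (f * pw m).coeff v = ∑ i, f.coeff (v - Pi.single i m) := by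
  rw [pw, Finset.mul_sum, AddMonoidAlgebra.coeff_sum, Finsupp.finsetSum_apply]
  refine Finset.sum_congr rfl fun i _ => ?_
  rw [Z, AddMonoidAlgebra.coeff_mul_single_eq_coeff_mul (v - Pi.single i m)
    fun a _ => eq_sub_iff_add_eq.symm, mul_one]

lemma eps_eq_zero_of_le {w : Fin N → ℤ} (r : Fin N) (h : (N : ℤ) ≤ w r) : eps w = 0 := by
  by_contra h0
  obtain ⟨σ, hσ⟩ := exists_perm_of_eps_ne_zero h0
  have := hσ (σ.symm r)
  rw [Equiv.apply_symm_apply] at this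
  have := (σ.symm r).2
  omega

lemma exists_val_eq_of_eps_ne_zero {w : Fin N → ℤ} (h : eps w ≠ 0) (r : Fin N) :
    ∃ t : Fin N, w r = t := by
  obtain ⟨σ, hσ⟩ := exists_perm_of_eps_ne_zero h
  exact ⟨σ.symm r, by simpa using hσ (σ.symm r)⟩

lemma injective_of_eps_ne_zero {w : Fin N → ℤ} (h : eps w ≠ 0) : Function.Injective w := by
  obtain ⟨σ, hσ⟩ := exists_perm_of_eps_ne_zero h
  intro r s hrs
  have h1 := hσ (σ.symm r)
  have h2 := hσ (σ.symm s)
  rw [Equiv.apply_symm_apply] at h1 h2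
  have : σ.symm r = σ.symm s := Fin.ext (by omega)
  exact σ.symm.injective this

lemma stair_comp_swap {r s : Fin N} (h : r ≠ s) :
    stair N ∘ Equiv.swap r s
      = stair N + Pi.single r ((s : ℤ) - r) + Pi.single s ((r : ℤ) - s) := by
  ext t
  simp only [Function.comp_apply, Pi.add_apply, Pi.single_apply, Equiv.swap_apply_def]
  by_cases h1 : t = r
  · subst h1; simp [h]
  · by_cases h2 : t = s
    · subst h2; simp [h1]
    · simp [h1, h2]

lemma eps_stair_add_single (r : Fin N) (x : ℤ) :
    eps (stair N + Pi.single r x) = if x = 0 then 1 else 0 := by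
  split_ifs with h
  · rw [h, Pi.single_zero, add_zero]; exact eps_id
  · by_contra h0
    obtain ⟨t, ht⟩ := exists_val_eq_of_eps_ne_zero h0 r
    have htr : t ≠ r := by
      rintro rfl
      apply h
      simpa using ht
    apply htr
    apply injective_of_eps_ne_zero h0
    rw [ht]
    simp [htr]

lemma eps_stair_add_pair {r s : Fin N} (hrs : r ≠ s) (x y : ℤ) :
    eps (stair N + Pi.single r x + Pi.single s y) = (if x = 0 ∧ y = 0 then 1 else 0)
      - if (r : ℤ) + x = s ∧ (s : ℤ) + y = r then 1 else 0 := by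
  have hne : (r : ℤ) ≠ s := by
    intro h; exact hrs (Fin.ext (by omega))
  by_cases hx : x = 0
  · subst hx
    rw [Pi.single_zero, add_zero, eps_stair_add_single]
    simp [hne]
  by_cases hy : y = 0
  · subst hy
    rw [Pi.single_zero, add_zero, eps_stair_add_single]
    simp [hne.symm, hx]
  by_cases h : (r : ℤ) + x = s ∧ (s : ℤ) + y = r
  · obtain ⟨h1, h2⟩ := h
    rw [show x = (s : ℤ) - r by omega, show y = (r : ℤ) - s by omega, ← stair_comp_swap hrs,
      eps_comp, Equiv.Perm.sign_swap hrs, show eps (stair N) = 1 from eps_id]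
    simp [sub_eq_zero, hne.symm]
  · rw [if_neg (by tauto), if_neg h, sub_zero]
    by_contra h0
    apply h
    constructor
    · obtain ⟨t, ht⟩ := exists_val_eq_of_eps_ne_zero h0 r
      have hw : (r : ℤ) + x = t := by simpa [hrs] using ht
      have htr : t ≠ r := by rintro rfl; omega
      by_contra hc
      have hts : t ≠ s := by rintro rfl; omega
      apply htr
      apply injective_of_eps_ne_zero h0
      rw [ht]
      simp [htr, hts]
    · obtain ⟨t, ht⟩ := exists_val_eq_of_eps_ne_zero h0 s
      have hw : (s : ℤ) + y = t := by simpa [hrs.symm] using ht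
      have hts : t ≠ s := by rintro rfl; omega
      by_contra hc
      have htr : t ≠ r := by rintro rfl; omega
      apply hts
      apply injective_of_eps_ne_zero h0
      rw [ht]
      simp [htr, hts]

lemma sum_val_eq (a : ℕ) :
    ∑ i : Fin N, (if (i : ℕ) = a then (1 : ℂ) else 0) = if a < N then 1 else 0 := by
  split_ifs with h
  · rw [Finset.sum_eq_single ⟨a, h⟩]
    · simp
    · intro b _ hb
      rw [if_neg fun h' => hb (Fin.ext h')]
    · simp
  · refine Finset.sum_eq_zero fun i _ => if_neg ?_
    have := i.2
    omega

lemma sum_le_val_lt (a b : ℕ) :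
    ∑ i : Fin N, (if a ≤ (i : ℕ) ∧ (i : ℕ) < b then (1 : ℂ) else 0) = ((min N b - a : ℕ) : ℂ) := by
  rw [Fin.sum_univ_eq_sum_range fun i => if a ≤ i ∧ i < b then (1 : ℂ) else 0, Finset.sum_boole]
  congr 1
  rw [← Nat.card_Ico]
  congr 1
  ext i
  simp only [Finset.mem_filter, Finset.mem_range, Finset.mem_Ico]
  omega

lemma sum_val_add_lt (k : ℕ) :
    ∑ i : Fin N, (if (i : ℕ) + k < N then (1 : ℂ) else 0) = ((N - k : ℕ) : ℂ) := by
  have h := sum_le_val_lt (N := N) 0 (N - k)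
  rw [show min N (N - k) - 0 = N - k by omega] at h
  rw [← h]
  exact Finset.sum_congr rfl fun i _ => if_congr (by omega) rfl rfl

lemma coeff_two_point (k : ℕ) (hk : 0 < k) :
    (vdm N * toLau N (MvPolynomial.X (k : ℤ) * MvPolynomial.X (-(k : ℤ)))).coeff (stair N)
      = ((min k N : ℕ) : ℂ) := by
  rw [map_mul, toLau_X, toLau_X, ← mul_assoc, coeff_mul_pw]
  have h : ∀ i j : Fin N, eps (stair N - Pi.single i (-(k : ℤ)) - Pi.single j (k : ℤ))
      = (if j = i then 1 else 0) - if (j : ℕ) = i + k then 1 else 0 := by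
    intro i j
    by_cases hij : j = i
    · subst hij
      have e : stair N - Pi.single j (-(k : ℤ)) - Pi.single j (k : ℤ) = stair N := by
        simp [Pi.single_neg]
      rw [e, show eps (stair N) = 1 from eps_id]
      simp [hk.ne']
    · have e : stair N - Pi.single i (-(k : ℤ)) - Pi.single j (k : ℤ)
          = stair N + Pi.single i (k : ℤ) + Pi.single j (-(k : ℤ)) := by
        simp [Pi.single_neg, sub_eq_add_neg]
      rw [e, eps_stair_add_pair (Ne.symm hij), if_neg (by omega), if_neg hij]
      congr 1
      exact if_congr (by omega) rfl rfl
  simp only [coeff_mul_pw, vdm_coeff, h, Finset.sum_sub_distrib, sum_val_eq, Finset.sum_ite_eq',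
    Finset.mem_univ, if_true]
  have h2 := sum_val_add_lt (N := N) k
  rw [h2, Finset.sum_const, Finset.card_univ, Fintype.card_fin, nsmul_one, sub_eq_iff_eq_add,
    ← Nat.cast_add]
  congr 1
  omega

end counting

section fourPoint

/-- The alternating product of the power sums of degrees `k` and `l` with the Vandermonde. -/
def altPair (N k l : ℕ) : Lau N :=
  vdm N * toLau N (MvPolynomial.X (k : ℤ) * MvPolynomial.X (l : ℤ))

lemma altPair_comm (k l : ℕ) : altPair N k l = altPair N l k := by
  rw [altPair, mul_comm (MvPolynomial.X _), altPair]

lemma altPair_coeff (k l : ℕ) (w : Fin N → ℤ) : (altPair N k l).coeff w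
    = ∑ j, ∑ i, eps (w - Pi.single j (l : ℤ) - Pi.single i (k : ℤ)) := by
  simp only [altPair, map_mul, toLau_X, ← mul_assoc, coeff_mul_pw, vdm_coeff]

/-- The contribution of a single particle moved by `k + l`. -/
def single₂ (N k l : ℕ) (r : Fin N) : ℂ :=
  if (r : ℕ) + k + l < N then 0 else
    1 - (if (r : ℕ) + k < N then 1 else 0) - (if (r : ℕ) + l < N then 1 else 0)

lemma sum_sum_eq_pair {M : Type*} [AddCommMonoid M] {ι : Type*} [Fintype ι] {m n : ι}
    [DecidableEq ι] (h : m ≠ n) (F : ι → ι → M)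
    (hm : ∀ i j, i ≠ m → j ≠ m → F i j = 0) (hn : ∀ i j, i ≠ n → j ≠ n → F i j = 0) :
    ∑ i, ∑ j, F i j = F m n + F n m := by
  rw [← Finset.sum_subset (Finset.subset_univ {m, n}), Finset.sum_pair h]
  · congr 1
    · refine Finset.sum_eq_single _ (fun j _ hj => hn _ _ h hj) (by simp)
    · refine Finset.sum_eq_single _ (fun j _ hj => hm _ _ h.symm hj) (by simp)
  · intro i _ hi
    simp only [Finset.mem_insert, Finset.mem_singleton, not_or] at hi
    refine Finset.sum_eq_zero fun j _ => ?_
    by_cases hj : j = m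
    · exact hn _ _ hi.2 (by rw [hj]; exact h)
    · exact hm _ _ hi.1 hj

lemma altPair_coeff_add_single {k l : ℕ} (hk : 0 < k) (hl : 0 < l) (r : Fin N) :
    (altPair N k l).coeff (stair N + Pi.single r ((k : ℤ) + l)) = single₂ N k l r := by
  unfold single₂
  by_cases h : (r : ℕ) + k + l < N
  · rw [if_pos h]
    apply coeff_eq_zero_of_not_injective
    intro hi
    have hne : (⟨r + k + l, h⟩ : Fin N) ≠ r := by
      intro h'; have := congrArg Fin.val h'; simp at this; omega
    apply hne
    apply hi
    rw [Pi.add_apply, Pi.add_apply, Pi.single_eq_of_ne hne]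
    simp [stair, add_assoc]
  have hF : ∀ j i : Fin N, eps (stair N + Pi.single r ((k : ℤ) + l) - Pi.single j (l : ℤ)
      - Pi.single i (k : ℤ)) = (if j = r then if i = r then 1 else 0 else 0)
        - (if i = r then if (j : ℕ) = r + l then 1 else 0 else 0)
        - (if j = r then if (i : ℕ) = r + k then 1 else 0 else 0) := by
    intro j i
    by_cases hj : j = r
    · subst hj
      have e : stair N + Pi.single j ((k : ℤ) + l) - Pi.single j (l : ℤ) - Pi.single i (k : ℤ)
          = stair N + Pi.single j (k : ℤ) + Pi.single i (-(k : ℤ)) := by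
        rw [Pi.single_add, Pi.single_neg]; abel
      rw [e]
      by_cases hi : i = j
      · subst hi
        rw [add_assoc, ← Pi.single_add, add_neg_cancel, Pi.single_zero, add_zero,
          show eps (stair N) = 1 from eps_id]
        simp [hk.ne', hl.ne']
      · rw [eps_stair_add_pair (Ne.symm hi), if_neg (by omega)]
        simp only [if_true, if_neg hi, sub_zero, zero_sub]
        exact congrArg _ (if_congr (by omega) rfl rfl)
    · by_cases hi : i = r
      · subst hi
        have e : stair N + Pi.single i ((k : ℤ) + l) - Pi.single j (l : ℤ) - Pi.single i (k : ℤ)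
            = stair N + Pi.single i (l : ℤ) + Pi.single j (-(l : ℤ)) := by
          rw [Pi.single_add, Pi.single_neg]; abel
        rw [e, eps_stair_add_pair (Ne.symm hj), if_neg (by omega)]
        simp only [if_true, if_neg hj, sub_zero, zero_sub]
        exact congrArg _ (if_congr (by omega) rfl rfl)
      · simp only [if_neg hi, if_neg hj, sub_zero]
        apply eps_eq_zero_of_le r
        simp [stair, Ne.symm hi, Ne.symm hj]
        omega
  rw [if_neg h, altPair_coeff]
  simp only [hF, Finset.sum_sub_distrib, Finset.sum_ite_irrel, Finset.sum_const_zero,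
    Finset.sum_ite_eq', Finset.mem_univ, if_true, sum_val_eq]
  ring

lemma altPair_coeff_of_ge {k l : ℕ} {m n : Fin N} (h : m ≠ n) (hm : N ≤ m + k) (hn : N ≤ n + l) :
    (altPair N k l).coeff (stair N + Pi.single n (l : ℤ) + Pi.single m (k : ℤ))
      = 1 + (if k = l then 1 else 0) - if (m : ℕ) + k = n + l then 1 else 0 := by
  have hv : (m : ℕ) ≠ n := fun h' => h (Fin.ext h')
  rw [altPair_coeff, sum_sum_eq_pair h]
  · have e1 : stair N + Pi.single n (l : ℤ) + Pi.single m (k : ℤ) - Pi.single m (l : ℤ)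
        - Pi.single n (k : ℤ)
        = stair N + Pi.single m ((k : ℤ) - l) + Pi.single n ((l : ℤ) - k) := by
      simp only [Pi.single_sub]; abel
    have e2 : stair N + Pi.single n (l : ℤ) + Pi.single m (k : ℤ) - Pi.single n (l : ℤ)
        - Pi.single m (k : ℤ) = stair N := by abel
    rw [e1, e2, eps_stair_add_pair h, show eps (stair N) = 1 from eps_id]
    rw [if_congr (show ((k : ℤ) - l = 0 ∧ (l : ℤ) - k = 0) ↔ k = l by omega) rfl rfl,
      if_congr (show ((m : ℤ) + (k - l) = n ∧ (n : ℤ) + (l - k) = m) ↔ (m : ℕ) + k = n + l by omega)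
        rfl rfl]
    ring
  · intro i j hi hj
    apply eps_eq_zero_of_le m
    simp [stair, hi.symm, hj.symm, h]
    omega
  · intro i j hi hj
    apply eps_eq_zero_of_le n
    simp [stair, hi.symm, hj.symm, h.symm]
    omega

lemma altPair_coeff_of_eq {k l : ℕ} (hk : 0 < k) (hl : 0 < l) {m n : Fin N} (h : (m : ℕ) + k = n) :
    (altPair N k l).coeff (stair N + Pi.single n (l : ℤ) + Pi.single m (k : ℤ))
      = - single₂ N k l m := by
  have hne : m ≠ n := by
    intro h'; have := congrArg Fin.val h'; omega
  have e : stair N + Pi.single n (l : ℤ) + Pi.single m (k : ℤ)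
      = (stair N + Pi.single m ((k : ℤ) + l)) ∘ Equiv.swap m n := by
    ext t
    simp only [Function.comp_apply, Pi.add_apply, Pi.single_apply, Equiv.swap_apply_def]
    by_cases h1 : t = m
    · subst h1; simp [stair, hne, hne.symm]; omega
    · by_cases h2 : t = n
      · subst h2; simp [stair, h1]; omega
      · simp [h1, h2]
  rw [e, altPair, coeff_comp_perm, ← altPair, altPair_coeff_add_single hk hl,
    Equiv.Perm.sign_swap hne]
  simp

lemma altPair_coeff_of_lt {k l : ℕ} (hk : 0 < k) {m n : Fin N} (hmn : m ≠ n)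
    (h : (m : ℕ) + k < N) (h' : (m : ℕ) + k ≠ n) :
    (altPair N k l).coeff (stair N + Pi.single n (l : ℤ) + Pi.single m (k : ℤ)) = 0 := by
  apply coeff_eq_zero_of_not_injective
  intro hi
  have hne : (⟨m + k, h⟩ : Fin N) ≠ m := by
    intro h'; have := congrArg Fin.val h'; simp at this; omega
  have hne' : (⟨m + k, h⟩ : Fin N) ≠ n := by
    intro h'; have := congrArg Fin.val h'; simp at this; omega
  apply hne
  apply hi
  simp [stair, hne, hne', hmn]

lemma altPair_coeff_add_add {k l : ℕ} (hk : 0 < k) (hl : 0 < l) (m n : Fin N) :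
    (altPair N k l).coeff (stair N + Pi.single n (l : ℤ) + Pi.single m (k : ℤ))
      = (if n = m then single₂ N k l m else 0)
        - (if (n : ℕ) = m + k then single₂ N k l m else 0)
        - (if (m : ℕ) = n + l then single₂ N k l n else 0)
        + if m ≠ n ∧ N ≤ m + k ∧ N ≤ n + l then
            1 + (if k = l then 1 else 0) - (if (m : ℕ) + k = n + l then 1 else 0) else 0 := by
  by_cases hmn : m = n
  · subst hmn
    rw [add_assoc, ← Pi.single_add, add_comm (l : ℤ), altPair_coeff_add_single hk hl]
    simp [hk.ne', hl.ne']
  have hv : (m : ℕ) ≠ n := fun h' => hmn (Fin.ext h')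
  rw [if_neg (Ne.symm hmn)]
  have hm := m.2
  have hn := n.2
  by_cases h1 : (n : ℕ) = m + k
  · rw [altPair_coeff_of_eq hk hl h1.symm, if_pos h1, if_neg (by omega), if_neg (by omega)]
    ring
  by_cases h2 : (m : ℕ) = n + l
  · rw [altPair_comm, add_right_comm, altPair_coeff_of_eq hl hk h2.symm, if_neg h1, if_pos h2,
      if_neg (by omega)]
    have : single₂ N l k n = single₂ N k l n := by
      simp only [single₂, add_right_comm _ l k]
      split_ifs <;> ring
    rw [this]; ring
  rw [if_neg h1, if_neg h2]
  by_cases h3 : (m : ℕ) + k < N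
  · rw [altPair_coeff_of_lt hk hmn h3 (Ne.symm h1), if_neg (by omega)]; ring
  by_cases h4 : (n : ℕ) + l < N
  · rw [altPair_comm, add_right_comm, altPair_coeff_of_lt hl (Ne.symm hmn) h4 (Ne.symm h2),
      if_neg (by omega)]; ring
  have hc : m ≠ n ∧ N ≤ (m : ℕ) + k ∧ N ≤ (n : ℕ) + l := ⟨hmn, by omega, by omega⟩
  rw [altPair_coeff_of_ge hmn hc.2.1 hc.2.2, if_pos hc]
  ring

lemma coeff_four_point_eq_sum (k l : ℕ) :
    (vdm N * toLau N (MvPolynomial.X (k : ℤ) * MvPolynomial.X (-(k : ℤ))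
      * (MvPolynomial.X (l : ℤ) * MvPolynomial.X (-(l : ℤ))))).coeff (stair N)
      = ∑ n, ∑ m, (altPair N k l).coeff
        (stair N + Pi.single n (l : ℤ) + Pi.single m (k : ℤ)) := by
  have h : vdm N * toLau N (MvPolynomial.X (k : ℤ) * MvPolynomial.X (-(k : ℤ))
      * (MvPolynomial.X (l : ℤ) * MvPolynomial.X (-(l : ℤ))))
      = altPair N k l * pw (-(k : ℤ)) * pw (-(l : ℤ)) := by
    simp only [altPair, map_mul, toLau_X]; ring
  simp only [h, coeff_mul_pw, Pi.single_neg, sub_neg_eq_add]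

lemma sum_single₂ {k l : ℕ} (hk : 0 < k) (hl : 0 < l) :
    ∑ r : Fin N, single₂ N k l r
      * (1 - (if (r : ℕ) + k < N then 1 else 0) - (if (r : ℕ) + l < N then 1 else 0))
      = ((N - (N - min k l) + (N - max k l) : ℕ) : ℂ) - ((N - (k + l) : ℕ) : ℂ) := by
  have h : ∀ r : Fin N, single₂ N k l r
      * (1 - (if (r : ℕ) + k < N then 1 else 0) - (if (r : ℕ) + l < N then 1 else 0))
      = 1 - (if (r : ℕ) + min k l < N then 1 else 0) + (if (r : ℕ) + max k l < N then 1 else 0)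
        - (if (r : ℕ) + (k + l) < N then 1 else 0) := by
    intro r
    unfold single₂
    rcases le_total k l with hkl | hkl
    all_goals
      simp only [min_eq_left hkl, max_eq_right hkl, min_eq_right hkl, max_eq_left hkl, ← add_assoc]
      split_ifs
      all_goals first | (exfalso; omega) | norm_num
  rw [Finset.sum_congr rfl fun r _ => h r]
  simp only [Finset.sum_sub_distrib, Finset.sum_add_distrib, sum_val_add_lt, Finset.sum_const,
    Finset.card_univ, Fintype.card_fin, nsmul_one]
  rw [Nat.cast_add, Nat.cast_sub (Nat.sub_le _ _)]

lemma sum_le_val_add (k : ℕ) :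
    ∑ i : Fin N, (if N ≤ (i : ℕ) + k then (1 : ℂ) else 0) = ((min k N : ℕ) : ℂ) := by
  have h := sum_le_val_lt (N := N) (N - k) N
  rw [show min N N - (N - k) = min k N by omega] at h
  rw [← h]
  exact Finset.sum_congr rfl fun i _ => if_congr (by omega) rfl rfl

lemma sum_both_ge {k l : ℕ} :
    ∑ n : Fin N, ∑ m : Fin N, (if m ≠ n ∧ N ≤ (m : ℕ) + k ∧ N ≤ (n : ℕ) + l then
        1 + (if k = l then 1 else 0) - (if (m : ℕ) + k = n + l then 1 else 0) else (0 : ℂ))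
      = if k = l then 2 * (((min k N : ℕ) : ℂ) ^ 2 - ((min k N : ℕ) : ℂ)) else
        ((min k N : ℕ) : ℂ) * ((min l N : ℕ) : ℂ) - ((min (min k l) N : ℕ) : ℂ)
          - ((min N (N + l - k) - (max N l - k) : ℕ) : ℂ) := by
  split_ifs with hkl
  · subst hkl
    have h : ∀ n m : Fin N, (if m ≠ n ∧ N ≤ (m : ℕ) + k ∧ N ≤ (n : ℕ) + k then
        1 + 1 - (if (m : ℕ) + k = n + k then 1 else 0) else (0 : ℂ))
        = 2 * ((if N ≤ (m : ℕ) + k then 1 else 0) * (if N ≤ (n : ℕ) + k then 1 else 0)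
          - if m = n then (if N ≤ (m : ℕ) + k then 1 else 0) else 0) := by
      intro n m
      by_cases hmn : m = n
      · subst hmn
        by_cases hc : N ≤ (m : ℕ) + k <;> simp [hc]
      · have hv : (m : ℕ) ≠ n := fun h' => hmn (Fin.ext h')
        simp only [hmn, hv, add_left_inj, if_false, ne_eq, not_false_eq_true, true_and]
        split_ifs <;> first | (exfalso; omega) | norm_num
    simp only [h, ← Finset.mul_sum, Finset.sum_sub_distrib, ← Finset.sum_mul, sum_le_val_add,
      Finset.sum_ite_eq', Finset.mem_univ, if_true, sq]
  · have h : ∀ n m : Fin N, (if m ≠ n ∧ N ≤ (m : ℕ) + k ∧ N ≤ (n : ℕ) + l then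
        1 + 0 - (if (m : ℕ) + k = n + l then 1 else 0) else (0 : ℂ))
        = (if N ≤ (m : ℕ) + k then 1 else 0) * (if N ≤ (n : ℕ) + l then 1 else 0)
          - (if m = n then (if N ≤ (m : ℕ) + min k l then 1 else 0) else 0)
          - if (n : ℕ) = m + k - l then (if N ≤ (m : ℕ) + k ∧ l ≤ m + k then 1 else 0) else 0 := by
      intro n m
      by_cases hmn : m = n
      · subst hmn
        simp only [if_true, ne_eq, not_true_eq_false, false_and, if_false]
        rcases le_total k l with hkl' | hkl'
        all_goals
          simp only [min_eq_left hkl', min_eq_right hkl', mul_ite, mul_one, mul_zero]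
          split_ifs <;> first | (exfalso; omega) | norm_num
      · simp only [hmn, if_false, ne_eq, not_false_eq_true, true_and]
        split_ifs <;> first | (exfalso; omega) | norm_num
    have h' : ∀ m : Fin N, (∑ n : Fin N, if (n : ℕ) = m + k - l then
        (if N ≤ (m : ℕ) + k ∧ l ≤ m + k then (1 : ℂ) else 0) else 0)
        = if max N l - k ≤ (m : ℕ) ∧ (m : ℕ) < N + l - k then 1 else 0 := by
      intro m
      have := sum_val_eq (N := N) (m + k - l)
      have hm := m.2
      by_cases hc : N ≤ (m : ℕ) + k ∧ l ≤ m + k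
      · simp only [if_pos hc, this]
        exact if_congr (by omega) rfl rfl
      · rw [if_neg (by omega)]
        simp [hc]
    simp only [h, Finset.sum_sub_distrib]
    rw [Finset.sum_comm (f := fun n m : Fin N => if (n : ℕ) = m + k - l then _ else _)]
    simp only [h', ← Finset.mul_sum, ← Finset.sum_mul, sum_le_val_add,
      Finset.sum_ite_eq', Finset.mem_univ, if_true, sum_le_val_lt]

lemma T_eq (k : ℕ) : T N k = ((min k N : ℕ) : ℝ) ^ 2 + ((min (2 * k) N : ℕ) : ℝ)
    - 2 * ((min k N : ℕ) : ℝ) := by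
  have h : min ((k : ℝ) ^ 2) ((N : ℝ) ^ 2) = ((min k N : ℕ) : ℝ) ^ 2 := by
    rcases le_total k N with hk | hk
    · rw [min_eq_left hk, min_eq_left]; gcongr
    · rw [min_eq_right hk, min_eq_right]; gcongr
  rw [T, h]
  push_cast
  rfl

lemma max_natCast_sub (a b : ℕ) : max ((a : ℝ) - b) 0 = ((a - b : ℕ) : ℝ) := by
  rcases le_total a b with h | h
  · rw [Nat.sub_eq_zero_of_le h, Nat.cast_zero, max_eq_right]
    simpa using h
  · rw [Nat.cast_sub h, max_eq_left]
    simpa using h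

lemma V_eq (k l : ℕ) : V N k l = 2 * ((N - max k l : ℕ) : ℝ) - ((N - (k + l) : ℕ) : ℝ)
    - ((N - (max k l - min k l) : ℕ) : ℝ) := by
  have h : |(k : ℝ) - l| = ((max k l - min k l : ℕ) : ℝ) := by
    rcases le_total k l with h | h
    · rw [max_eq_right h, min_eq_left h, Nat.cast_sub h, abs_sub_comm, abs_of_nonneg]
      simpa using h
    · rw [max_eq_left h, min_eq_right h, Nat.cast_sub h, abs_of_nonneg]
      simpa using h
  rw [V, h, sub_sub (N : ℝ), ← Nat.cast_add, ← Nat.cast_max, max_natCast_sub, max_natCast_sub,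
    max_natCast_sub]

lemma coeff_four_point {k l : ℕ} (hk : 0 < k) (hl : 0 < l) :
    (vdm N * toLau N (MvPolynomial.X (k : ℤ) * MvPolynomial.X (-(k : ℤ))
      * (MvPolynomial.X (l : ℤ) * MvPolynomial.X (-(l : ℤ))))).coeff (stair N)
      = ((((min k N : ℕ) : ℝ) * ((min l N : ℕ) : ℝ)
        + if k = l then T N k else V N k l : ℝ) : ℂ) := by
  have h : ∀ g : Fin N → ℂ, (∑ n : Fin N, ∑ m : Fin N, if (n : ℕ) = m + k then g m else 0)
      = ∑ m : Fin N, g m * if (m : ℕ) + k < N then 1 else 0 := by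
    intro g
    rw [Finset.sum_comm]
    refine Finset.sum_congr rfl fun m _ => ?_
    rw [← sum_val_eq, Finset.mul_sum]
    simp
  have h' : ∀ g : Fin N → ℂ, (∑ n : Fin N, ∑ m : Fin N, if (m : ℕ) = n + l then g n else 0)
      = ∑ m : Fin N, g m * if (m : ℕ) + l < N then 1 else 0 := by
    intro g
    refine Finset.sum_congr rfl fun m _ => ?_
    rw [← sum_val_eq, Finset.mul_sum]
    simp
  have hA := sum_single₂ (N := N) hk hl
  simp only [mul_sub, mul_one, Finset.sum_sub_distrib] at hA
  rw [coeff_four_point_eq_sum]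
  simp only [altPair_coeff_add_add hk hl, Finset.sum_add_distrib, Finset.sum_sub_distrib]
  rw [sum_both_ge, h, h']
  simp only [Finset.sum_ite_eq, Finset.mem_univ, if_true, hA]
  have hr : (((N - (N - min k l) + (N - max k l) : ℕ) : ℝ) - ((N - (k + l) : ℕ) : ℝ)
      + if k = l then 2 * (((min k N : ℕ) : ℝ) ^ 2 - ((min k N : ℕ) : ℝ)) else
        ((min k N : ℕ) : ℝ) * ((min l N : ℕ) : ℝ) - ((min (min k l) N : ℕ) : ℝ)
          - ((min N (N + l - k) - (max N l - k) : ℕ) : ℝ))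
      = ((min k N : ℕ) : ℝ) * ((min l N : ℕ) : ℝ) + if k = l then T N k else V N k l := by
    split_ifs with hkl
    · subst hkl
      have hn : ((N - (N - min k k) + (N - max k k) : ℕ) : ℝ)
          = ((min (2 * k) N : ℕ) : ℝ) + ((N - (k + k) : ℕ) : ℝ) := by
        rw [← Nat.cast_add]; congr 1; omega
      rw [hn, T_eq]; ring
    · have hn : ((N - (N - min k l) + (N - max k l) : ℕ) : ℝ)
            + ((N - (max k l - min k l) : ℕ) : ℝ)
          = ((min (min k l) N : ℕ) : ℝ) + ((min N (N + l - k) - (max N l - k) : ℕ) : ℝ)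
            + 2 * ((N - max k l : ℕ) : ℝ) := by
        norm_cast; omega
      rw [V_eq]; linarith
  rw [← hr]
  split_ifs <;> simp only [Complex.ofReal_add, Complex.ofReal_sub, Complex.ofReal_mul,
    Complex.ofReal_pow, Complex.ofReal_natCast, Complex.ofReal_ofNat]

end fourPoint

section haar

lemma measurableEmbedding_coe : MeasurableEmbedding ((↑) : UGroup N → Matrix (Fin N) (Fin N) ℂ) :=
  MeasurableEmbedding.subtype_coe isClosed_unitary.measurableSet

lemma exists_measure_unitary (μ : Measure (Matrix (Fin N) (Fin N) ℂ)) [IsProbabilityMeasure μ]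
    (hsupp : μ {A | A ∈ Matrix.unitaryGroup (Fin N) ℂ} = 1)
    (hinv : ∀ g ∈ Matrix.unitaryGroup (Fin N) ℂ, μ.map (fun A => g * A) = μ) :
    ∃ ν : Measure (UGroup N), IsProbabilityMeasure ν ∧ (∀ g : UGroup N, ν.map (g * ·) = ν) ∧
      ν.map (↑) = μ := by
  have he := measurableEmbedding_coe (N := N)
  have hrange : Set.range ((↑) : UGroup N → Matrix (Fin N) (Fin N) ℂ)
      = {A | A ∈ Matrix.unitaryGroup (Fin N) ℂ} := Subtype.range_coe
  have hmap : (μ.comap ((↑) : UGroup N → Matrix (Fin N) (Fin N) ℂ)).map (↑) = μ := by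
    rw [he.map_comap, Measure.restrict_eq_self_of_ae_mem]
    rw [hrange]
    exact (prob_compl_eq_zero_iff (hrange ▸ he.measurableSet_range)).2 hsupp
  refine ⟨μ.comap (↑), ⟨?_⟩, fun g => ?_, hmap⟩
  · rw [he.comap_apply, Set.image_univ, hrange, hsupp]
  · have hg : Measurable fun A : UGroup N => g * A := (continuous_const_mul g).measurable
    have hg' : Measurable fun A : Matrix (Fin N) (Fin N) ℂ => (g : Matrix _ _ ℂ) * A :=
      (continuous_const.mul continuous_id).measurable
    rw [← he.comap_map ((μ.comap _).map _), Measure.map_map he.measurable hg]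
    conv_rhs => rw [← hinv g g.2]
    nth_rewrite 2 [← hmap]
    rw [Measure.map_map hg' he.measurable]
    rfl

lemma variance_map_coe {Ω Ω' : Type*} [MeasurableSpace Ω] [MeasurableSpace Ω'] {f : Ω → Ω'}
    (hf : MeasurableEmbedding f) (ν : Measure Ω) (X : Ω' → ℝ) :
    variance X (ν.map f) = variance (X ∘ f) ν := by
  simp only [variance, evariance, hf.lintegral_map, hf.integral_map, Function.comp_apply]

end haar

section variance

lemma variance_tsum {Ω : Type*} [MeasurableSpace Ω] {ν : Measure Ω} [IsProbabilityMeasure ν]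
    {X : ℕ → Ω → ℝ} {C : ℝ} (hX : ∀ k, Measurable (X k)) (hC : ∀ k ω, |X k ω| ≤ C)
    {a : ℕ → ℝ} (ha : Summable a) (ha0 : ∀ k, 0 ≤ a k) :
    HasSum (fun p : ℕ × ℕ => a p.1 * a p.2 *
      (∫ ω, X p.1 ω * X p.2 ω ∂ν - (∫ ω, X p.1 ω ∂ν) * ∫ ω, X p.2 ω ∂ν))
      (variance (fun ω => ∑' k, a k * X k ω) ν) := by
  have hC0 : ∀ ω : Ω, 0 ≤ C := fun ω => (abs_nonneg _).trans (hC 0 ω)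
  have hb : ∀ k ω, ‖a k * X k ω‖ ≤ a k * C := fun k ω => by
    rw [norm_mul, Real.norm_of_nonneg (ha0 k)]
    exact mul_le_mul_of_nonneg_left (hC k ω) (ha0 k)
  have hs : ∀ ω, Summable fun k => ‖a k * X k ω‖ := fun ω =>
    (ha.mul_right C).of_nonneg_of_le (fun _ => norm_nonneg _) fun k => hb k ω
  have hb₂ : ∀ (p : ℕ × ℕ) ω, ‖a p.1 * X p.1 ω * (a p.2 * X p.2 ω)‖
      ≤ a p.1 * C * (a p.2 * C) := fun p ω => by
    rw [norm_mul]
    exact mul_le_mul (hb _ _) (hb _ _) (norm_nonneg _) (mul_nonneg (ha0 _) (hC0 ω))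
  have hi : ∀ k, Integrable (fun ω => a k * X k ω) ν := fun k =>
    Integrable.of_bound ((hX k).const_mul _).aestronglyMeasurable _ (.of_forall (hb k))
  have hi₂ : ∀ p : ℕ × ℕ, Integrable (fun ω => a p.1 * X p.1 ω * (a p.2 * X p.2 ω)) ν := fun p =>
    Integrable.of_bound (((hX _).const_mul _).mul ((hX _).const_mul _)).aestronglyMeasurable _
      (.of_forall (hb₂ p))
  have haC : Summable fun k => a k * C := ha.mul_right C
  have hsi : Summable fun k => ∫ ω, ‖a k * X k ω‖ ∂ν :=
    haC.of_nonneg_of_le (fun _ => integral_nonneg fun _ => norm_nonneg _) fun k =>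
      (integral_mono (hi k).norm (integrable_const _) (hb k)).trans (by simp)
  have haC₂ : Summable fun p : ℕ × ℕ => a p.1 * C * (a p.2 * C) := by
    have hn : Summable fun k => ‖a k * C‖ := haC.norm
    exact summable_mul_of_summable_norm hn hn
  have hsi₂ : Summable fun p : ℕ × ℕ => ∫ ω, ‖a p.1 * X p.1 ω * (a p.2 * X p.2 ω)‖ ∂ν :=
    haC₂.of_nonneg_of_le (fun _ => integral_nonneg fun _ => norm_nonneg _) fun p =>
      (integral_mono (hi₂ p).norm (integrable_const _) (hb₂ p)).trans (by simp)
  have h₁ := hasSum_integral_of_summable_integral_norm hi hsi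
  have h₂ := hasSum_integral_of_summable_integral_norm hi₂ hsi₂
  have hsq : ∀ ω, (∑' p : ℕ × ℕ, a p.1 * X p.1 ω * (a p.2 * X p.2 ω))
      = (∑' k, a k * X k ω) ^ 2 := fun ω => by
    rw [sq, tsum_mul_tsum_of_summable_norm (hs ω) (hs ω)]
  have hn₁ : Summable fun k => ‖∫ ω, a k * X k ω ∂ν‖ :=
    hsi.of_nonneg_of_le (fun _ => norm_nonneg _) fun _ => norm_integral_le_integral_norm _
  have h₃ : HasSum (fun p : ℕ × ℕ => (∫ ω, a p.1 * X p.1 ω ∂ν) * ∫ ω, a p.2 * X p.2 ω ∂ν)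
      ((∫ ω, ∑' k, a k * X k ω ∂ν) ^ 2) := by
    have := (summable_mul_of_summable_norm hn₁ hn₁).hasSum
    rwa [← tsum_mul_tsum_of_summable_norm hn₁ hn₁, h₁.tsum_eq, ← sq] at this
  simp only [hsq] at h₂
  have hm : AEStronglyMeasurable (fun ω => ∑' k, a k * X k ω) ν :=
    aestronglyMeasurable_of_tendsto_ae Filter.atTop
      (fun n => Finset.aestronglyMeasurable_fun_sum (Finset.range n)
        fun k _ => (hi k).aestronglyMeasurable)
      (.of_forall fun ω => (hs ω).of_norm.hasSum.tendsto_sum_nat)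
  have hL : MemLp (fun ω => ∑' k, a k * X k ω) 2 ν :=
    MemLp.of_bound hm (∑' k, a k * C) (.of_forall fun ω => tsum_of_norm_bounded haC.hasSum (hb · ω))
  rw [variance_eq_sub hL]
  have hprod : ∀ p : ℕ × ℕ, ∫ ω, a p.1 * X p.1 ω * (a p.2 * X p.2 ω) ∂ν
      = a p.1 * a p.2 * ∫ ω, X p.1 ω * X p.2 ω ∂ν := fun p => by
    simp only [← integral_const_mul, mul_mul_mul_comm]
  have h := h₂.sub h₃
  simp only [hprod, integral_const_mul, mul_mul_mul_comm (a _) (∫ _, _ ∂ν), ← mul_sub] at h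
  exact h

lemma tsum_eq_diag_add {f : ℕ × ℕ → ℝ} (hf : Summable f) :
    ∑' p, f p = (∑' k, f (k, k)) + ∑' p : ℕ × ℕ, if p.1 ≠ p.2 then f p else 0 := by
  have h₁ : Summable ({p : ℕ × ℕ | p.1 = p.2}.indicator f) := hf.indicator _
  have h₂ : Summable ({p : ℕ × ℕ | p.1 ≠ p.2}.indicator f) := hf.indicator _
  have hd : ∑' k, f (k, k) = ∑' p, {p : ℕ × ℕ | p.1 = p.2}.indicator f p := by
    rw [← Function.Injective.tsum_eq (g := fun k : ℕ => (k, k)) (fun _ _ h => congrArg Prod.fst h)]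
    · simp
    · rintro ⟨k, l⟩ h
      have : k = l := by by_contra hkl; simp [hkl] at h
      exact ⟨k, by rw [this]⟩
  have ho : (∑' p : ℕ × ℕ, if p.1 ≠ p.2 then f p else 0)
      = ∑' p, {p : ℕ × ℕ | p.1 ≠ p.2}.indicator f p :=
    tsum_congr fun p => by simp [Set.indicator_apply]
  rw [hd, ho, ← h₁.tsum_add h₂]
  refine tsum_congr fun p => ?_
  by_cases h : p.1 = p.2 <;> simp [h]

end variance

section moments

variable {ν : Measure (UGroup N)} [IsProbabilityMeasure ν]

lemma ofReal_norm_trace_sq (A : UGroup N) (k : ℕ) : ((‖(zp A k).trace‖ ^ 2 : ℝ) : ℂ)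
    = evalTr A (MvPolynomial.X (k : ℤ) * MvPolynomial.X (-(k : ℤ))) := by
  rw [map_mul, evalTr_X, evalTr_X, trace_zp_neg]
  simp [Complex.mul_conj, Complex.normSq_eq_norm_sq]

lemma integral_norm_trace_sq (hν : ∀ g : UGroup N, ν.map (g * ·) = ν) {k : ℕ} (hk : 0 < k) :
    ∫ A, ‖(zp A k).trace‖ ^ 2 ∂ν = ((min k N : ℕ) : ℝ) := by
  have h := coeff_two_point (N := N) k hk
  rw [← integral_evalTr hν] at h
  simp only [← ofReal_norm_trace_sq, integral_complex_ofReal, ← Complex.ofReal_natCast] at h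
  exact Complex.ofReal_injective h

lemma integral_norm_trace_sq_mul (hν : ∀ g : UGroup N, ν.map (g * ·) = ν) {k l : ℕ} (hk : 0 < k)
    (hl : 0 < l) : ∫ A, ‖(zp A k).trace‖ ^ 2 * ‖(zp A l).trace‖ ^ 2 ∂ν
      = ((min k N : ℕ) : ℝ) * ((min l N : ℕ) : ℝ) + if k = l then T N k else V N k l := by
  have h := coeff_four_point (N := N) hk hl
  rw [← integral_evalTr hν] at h
  simp only [map_mul _ (MvPolynomial.X (k : ℤ) * _), ← ofReal_norm_trace_sq, ← Complex.ofReal_mul,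
    integral_complex_ofReal] at h
  exact Complex.ofReal_injective h

end moments

end CUE

/-- For `A` Haar-distributed on `U(N)`,
`Var( Σ_{k≥1} |Tr(A^k)|²/k² ) = Σ_{k≥1} T(k)/k⁴ + Σ_{k≠ℓ} V(k,ℓ)/(k²ℓ²)`. -/
theorem variance_traceSum_unitary
    (N : ℕ) (hN : 1 ≤ N)
    (μ : Measure (Matrix (Fin N) (Fin N) ℂ)) [IsProbabilityMeasure μ]
    (hsupp : μ {A | A ∈ Matrix.unitaryGroup (Fin N) ℂ} = 1)
    (hinv : ∀ g ∈ Matrix.unitaryGroup (Fin N) ℂ, μ.map (fun A => g * A) = μ) :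
    variance (fun A => ∑' k : ℕ, ‖(A ^ (k + 1)).trace‖ ^ 2 / ((k : ℝ) + 1) ^ 2) μ
      = (∑' k : ℕ, T N (k + 1) / ((k : ℝ) + 1) ^ 4)
        + ∑' p : ℕ × ℕ, if p.1 ≠ p.2 then
            V N (p.1 + 1) (p.2 + 1) / (((p.1 : ℝ) + 1) ^ 2 * ((p.2 : ℝ) + 1) ^ 2)
          else 0 := by
  obtain ⟨ν, hprob, hν, rfl⟩ := CUE.exists_measure_unitary μ hsupp hinv
  have ha : Summable fun k : ℕ => (((k : ℝ) + 1) ^ 2)⁻¹ := by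
    have := (summable_nat_add_iff 1).2 (Real.summable_nat_pow_inv.2 one_lt_two)
    exact_mod_cast this
  have hX : ∀ k : ℕ, Measurable fun A : CUE.UGroup N => ‖(CUE.zp A ((k + 1 : ℕ) : ℤ)).trace‖ ^ 2 :=
    fun k => ((CUE.continuous_zp _).matrix_trace.norm.pow 2).measurable
  have hC : ∀ (k : ℕ) (A : CUE.UGroup N),
      |‖(CUE.zp A ((k + 1 : ℕ) : ℤ)).trace‖ ^ 2| ≤ (N : ℝ) ^ 2 :=
    fun k A => by
      rw [abs_of_nonneg (sq_nonneg _)]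
      exact pow_le_pow_left₀ (norm_nonneg _) (CUE.norm_trace_zp_le A _) 2
  have h := CUE.variance_tsum (ν := ν) hX hC ha fun k => by positivity
  have hcov : ∀ p : ℕ × ℕ, (((p.1 : ℝ) + 1) ^ 2)⁻¹ * (((p.2 : ℝ) + 1) ^ 2)⁻¹
      * (∫ A, ‖(CUE.zp A ((p.1 + 1 : ℕ) : ℤ)).trace‖ ^ 2
          * ‖(CUE.zp A ((p.2 + 1 : ℕ) : ℤ)).trace‖ ^ 2 ∂ν
        - (∫ A, ‖(CUE.zp A ((p.1 + 1 : ℕ) : ℤ)).trace‖ ^ 2 ∂ν)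
          * ∫ A, ‖(CUE.zp A ((p.2 + 1 : ℕ) : ℤ)).trace‖ ^ 2 ∂ν)
      = (if p.1 = p.2 then T N (p.1 + 1) else V N (p.1 + 1) (p.2 + 1))
        / (((p.1 : ℝ) + 1) ^ 2 * ((p.2 : ℝ) + 1) ^ 2) := by
    intro p
    rw [CUE.integral_norm_trace_sq hν (Nat.succ_pos _), CUE.integral_norm_trace_sq hν (Nat.succ_pos _),
      CUE.integral_norm_trace_sq_mul hν (Nat.succ_pos _) (Nat.succ_pos _), add_sub_cancel_left, ← mul_inv,
      mul_comm, ← div_eq_mul_inv]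
    simp only [Nat.succ_eq_add_one, add_left_inj]
  simp only [hcov] at h
  have hvar : ((fun A : Matrix (Fin N) (Fin N) ℂ => ∑' k : ℕ, ‖(A ^ (k + 1)).trace‖ ^ 2
        / ((k : ℝ) + 1) ^ 2) ∘ ((↑) : CUE.UGroup N → Matrix (Fin N) (Fin N) ℂ))
      = fun A => ∑' k : ℕ, (((k : ℝ) + 1) ^ 2)⁻¹ * ‖(CUE.zp A ((k + 1 : ℕ) : ℤ)).trace‖ ^ 2 := by
    ext A
    refine tsum_congr fun k => ?_
    rw [CUE.zp, zpow_natCast, SubmonoidClass.coe_pow, mul_comm, ← div_eq_mul_inv]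
  rw [CUE.variance_map_coe CUE.measurableEmbedding_coe, hvar, ← h.tsum_eq,
    CUE.tsum_eq_diag_add h.summable]
  congr 1
  · refine tsum_congr fun k => ?_
    simp only [if_true, ← pow_add]
  · refine tsum_congr fun p => ?_
    split_ifs <;> simp_all
end
end

section
/- Let N ≥ 1 and let A be Haar-distributed on SO(2N+1). Then E[ Σ_{k≥1} (Tr(A^k) − 1)²/k² ] = Σ_{k≥1} (min{k, 2N} + ε(k))/k², where ε(k) = 1 if k is odd and 1 ≤ k ≤ 2N−1, and ε(k) = 0 otherwise. -/
open MeasureTheory ProbabilityTheory Matrix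

noncomputable section

/-- `ε(k) = 1` if `k` is odd and `1 ≤ k ≤ 2N−1`, and `ε(k) = 0` otherwise. -/
def eps (N k : ℕ) : ℝ :=
  if Odd k ∧ 1 ≤ k ∧ k ≤ 2 * N - 1 then 1 else 0

theorem card_roots_charpoly {n : Type*} [Fintype n] [DecidableEq n] (A : Matrix n n ℂ) :
    A.charpoly.roots.card = Fintype.card n := by
  rw [← (IsAlgClosed.splits A.charpoly).natDegree_eq_card_roots, A.charpoly_natDegree_eq_dim]

theorem eval_charpoly_eq_prod_roots {n : Type*} [Fintype n] [DecidableEq n] (A : Matrix n n ℂ)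
    (a : ℂ) : A.charpoly.eval a = (A.charpoly.roots.map (fun r => a - r)).prod := by
  conv_lhs => rw [(IsAlgClosed.splits A.charpoly).eq_prod_roots_of_monic A.charpoly_monic]
  rw [Polynomial.eval_multiset_prod, Multiset.map_map]
  simp

theorem det_aeval_eq_prod_roots {n : Type*} [Fintype n] [DecidableEq n] (A : Matrix n n ℂ)
    (p : Polynomial ℂ) :
    (Polynomial.aeval A p).det = (A.charpoly.roots.map (fun r => p.eval r)).prod := by
  have hlin (a : ℂ) : (A - algebraMap ℂ (Matrix n n ℂ) a).det
      = (A.charpoly.roots.map (fun r => r - a)).prod := by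
    have h1 : (A - algebraMap ℂ (Matrix n n ℂ) a) = -(scalar n a - A) := by
      simp [Matrix.algebraMap_eq_diagonal, Pi.algebraMap_def]
    rw [h1, det_neg, ← eval_charpoly, eval_charpoly_eq_prod_roots, ← card_roots_charpoly A]
    have h2 : ∀ r ∈ A.charpoly.roots, r - a = -1 * (a - r) := fun r _ => by ring
    rw [Multiset.map_congr rfl h2, Multiset.prod_map_mul]
    simp
  have hprod (s : Multiset ℂ) (c : ℂ) :
      (Polynomial.aeval A (Polynomial.C c *
        (s.map (fun a => Polynomial.X - Polynomial.C a)).prod)).det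
      = (A.charpoly.roots.map (fun r => (Polynomial.C c *
        (s.map (fun a => Polynomial.X - Polynomial.C a)).prod).eval r)).prod := by
    induction s using Multiset.induction_on with
    | empty =>
      simp [Algebra.algebraMap_eq_smul_one, card_roots_charpoly]
    | cons a s ih =>
      have h2 : Polynomial.C c * ((a ::ₘ s).map (fun a => Polynomial.X - Polynomial.C a)).prod
          = (Polynomial.X - Polynomial.C a) * (Polynomial.C c *
            (s.map (fun a => Polynomial.X - Polynomial.C a)).prod) := by
        simp; ring
      rw [h2, map_mul, det_mul, ih]
      simp only [Polynomial.eval_mul (p := Polynomial.X - Polynomial.C a), Multiset.prod_map_mul]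
      congr 1
      simpa using hlin a
  rw [(IsAlgClosed.splits p).eq_prod_roots]
  exact hprod _ _

theorem roots_charpoly_pow {n : Type*} [Fintype n] [DecidableEq n] (A : Matrix n n ℂ) (k : ℕ) :
    (A ^ k).charpoly.roots = A.charpoly.roots.map (· ^ k) := by
  have h : (A ^ k).charpoly
      = ((A.charpoly.roots.map (· ^ k)).map (fun a => Polynomial.X - Polynomial.C a)).prod := by
    apply Polynomial.funext
    intro y
    have := det_aeval_eq_prod_roots A (Polynomial.C y - Polynomial.X ^ k)
    rw [eval_charpoly, Polynomial.eval_multiset_prod, Multiset.map_map, Multiset.map_map]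
    simpa [Matrix.algebraMap_eq_diagonal, Pi.algebraMap_def] using this
  rw [h, Polynomial.roots_multiset_prod_X_sub_C]

theorem trace_pow_eq_sum_roots {n : Type*} [Fintype n] [DecidableEq n] (A : Matrix n n ℂ) (k : ℕ) :
    (A ^ k).trace = (A.charpoly.roots.map (· ^ k)).sum := by
  rw [trace_eq_sum_roots_charpoly, roots_charpoly_pow]

theorem roots_charpoly_map_inv {n : Type*} [Fintype n] [DecidableEq n] (A : Matrix n n ℂ)
    (h : A * Aᵀ = 1) (hd : A.det = 1) :
    A.charpoly.roots.map (·⁻¹) = A.charpoly.roots := by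
  have h0 : (0 : ℂ) ∉ A.charpoly.roots := by
    intro h0
    have := det_eq_prod_roots_charpoly A
    rw [hd, Multiset.prod_eq_zero h0] at this
    exact one_ne_zero this
  have key : A.charpoly
      = ((A.charpoly.roots.map (·⁻¹)).map (fun a => Polynomial.X - Polynomial.C a)).prod := by
    apply Polynomial.funext
    intro y
    have h1 := det_aeval_eq_prod_roots A (Polynomial.C y * Polynomial.X - 1)
    have h2 : Polynomial.aeval A (Polynomial.C y * Polynomial.X - 1 : Polynomial ℂ)
        = A * (scalar n y - Aᵀ) := by
      rw [mul_sub, h, ← (scalar_commute y (fun _ => mul_comm _ _) A).eq]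
      simp [Matrix.algebraMap_eq_diagonal, Pi.algebraMap_def]
    rw [h2, det_mul, hd, one_mul, ← eval_charpoly, charpoly_transpose] at h1
    rw [h1, Polynomial.eval_multiset_prod, Multiset.map_map, Multiset.map_map]
    have h3 : ∀ r ∈ A.charpoly.roots, (Polynomial.C y * Polynomial.X - 1 : Polynomial ℂ).eval r
        = r * (y - r⁻¹) := by
      intro r hr
      have : r ≠ 0 := fun h => h0 (h ▸ hr)
      simp; field_simp
    rw [Multiset.map_congr rfl h3, Multiset.prod_map_mul, Multiset.map_id',
      ← det_eq_prod_roots_charpoly, hd, one_mul]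
    simp
  conv_rhs => rw [key]
  rw [Polynomial.roots_multiset_prod_X_sub_C]

theorem exists_inverse_pairing (N : ℕ) (s : Multiset ℂ) (hc : s.card = 2 * N + 1)
    (h0 : (0 : ℂ) ∉ s) (hp : s.prod = 1) (hinv : s.map (·⁻¹) = s) :
    ∃ z : Fin N → ℂ, (∀ i, z i ≠ 0) ∧
      ∀ f : ℂ → ℂ, (s.map f).sum = f 1 + ∑ i, (f (z i) + f (z i)⁻¹) := by
  induction N generalizing s with
  | zero =>
    obtain ⟨r, rfl⟩ := Multiset.card_eq_one.1 (by simpa using hc)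
    have : r = 1 := by simpa using hp
    exact ⟨fun _ => 1, by simp, by simp [this]⟩
  | succ N ih =>
    have key : ∃ r t, s = r ::ₘ r⁻¹ ::ₘ t := by
      by_cases hr : ∃ r ∈ s, r ≠ r⁻¹
      · obtain ⟨r, hr, hne⟩ := hr
        obtain ⟨u, rfl⟩ := Multiset.exists_cons_of_mem hr
        have : r⁻¹ ∈ r ::ₘ u := by
          rw [← hinv]; exact Multiset.mem_map_of_mem _ hr
        have : r⁻¹ ∈ u := by
          rcases Multiset.mem_cons.1 this with h | h
          · exact absurd h.symm hne
          · exact h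
        obtain ⟨t, rfl⟩ := Multiset.exists_cons_of_mem this
        exact ⟨r, t, rfl⟩
      · push Not at hr
        have hnd : ¬ s.Nodup := by
          intro hnd
          have hsub : s.toFinset ⊆ {1, -1} := by
            intro r hr'
            have hr' := Multiset.mem_toFinset.1 hr'
            have h1 := hr r hr'
            have h2 : r ≠ 0 := fun h => h0 (h ▸ hr')
            have h3 : r * r = 1 := by
              nth_rewrite 2 [h1]; exact mul_inv_cancel₀ h2
            simpa using mul_self_eq_one_iff.1 h3
          have h4 := Finset.card_le_card hsub
          rw [Multiset.toFinset_card_of_nodup hnd, hc] at h4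
          have := Finset.card_le_two (a := (1 : ℂ)) (b := -1)
          omega
        obtain ⟨r, hr'⟩ : ∃ r, 1 < s.count r := by
          by_contra! hcon
          exact hnd (Multiset.nodup_iff_count_le_one.2 hcon)
        have hrs : r ∈ s := Multiset.count_pos.1 (by omega)
        obtain ⟨u, rfl⟩ := Multiset.exists_cons_of_mem hrs
        have hru : r ∈ u := Multiset.count_pos.1 (by simpa using hr')
        obtain ⟨t, rfl⟩ := Multiset.exists_cons_of_mem hru
        exact ⟨r, t, by rw [← hr r hrs]⟩
    obtain ⟨r, t, rfl⟩ := key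
    have hr0 : r ≠ 0 := fun h => h0 (by simp [h])
    obtain ⟨z, hz, hf⟩ := ih t (by simp at hc; omega) (fun h => h0 (by simp [h]))
      (by simpa [hr0] using hp)
      (by
        simp only [Multiset.map_cons, inv_inv] at hinv
        rw [Multiset.cons_swap] at hinv
        simpa using hinv)
    refine ⟨Fin.cons r z, fun i => Fin.cases hr0 hz i, fun f => ?_⟩
    simp only [Multiset.map_cons, Multiset.sum_cons, hf, Fin.sum_univ_succ, Fin.cons_zero,
      Fin.cons_succ]
    ring

/-- The eigenvalues of a matrix in `SO(2N+1)` are `1` and `N` pairs of mutually inverse numbers. -/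
theorem exists_eigenvalues_specialOrthogonal (N : ℕ)
    (A : Matrix (Fin (2 * N + 1)) (Fin (2 * N + 1)) ℝ)
    (hA : A ∈ Matrix.specialOrthogonalGroup (Fin (2 * N + 1)) ℝ) :
    ∃ z : Fin N → ℂ, (∀ i, z i ≠ 0) ∧
      ∀ k : ℕ, ((A ^ k).trace : ℂ) = 1 + ∑ i, (z i ^ k + (z i)⁻¹ ^ k) := by
  obtain ⟨h1, h2⟩ := Matrix.mem_specialOrthogonalGroup_iff.1 hA
  have h1 := (Matrix.mem_orthogonalGroup_iff _ _).1 h1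
  set B : Matrix (Fin (2 * N + 1)) (Fin (2 * N + 1)) ℂ := A.map (algebraMap ℝ ℂ) with hB
  have hBdet : B.det = 1 := by
    rw [hB, ← RingHom.mapMatrix_apply, ← RingHom.map_det, h2, map_one]
  have hBB : B * Bᵀ = 1 := by
    rw [hB, ← Matrix.transpose_map, ← Matrix.map_mul, h1]
    simp
  obtain ⟨z, hz, hf⟩ := exists_inverse_pairing N B.charpoly.roots
    (by rw [card_roots_charpoly]; simp)
    (fun h0 => by
      have := det_eq_prod_roots_charpoly B
      rw [hBdet, Multiset.prod_eq_zero h0] at this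
      exact one_ne_zero this)
    (by rw [← det_eq_prod_roots_charpoly, hBdet]) (roots_charpoly_map_inv B hBB hBdet)
  refine ⟨z, hz, fun k => ?_⟩
  have := hf (· ^ k)
  rw [← trace_pow_eq_sum_roots] at this
  rw [one_pow] at this
  rw [← this, hB, ← RingHom.mapMatrix_apply, ← map_pow]
  exact AddMonoidHom.map_trace (Complex.ofRealHom : ℝ →+ ℂ) (A ^ k)

theorem derivation_aeval_eq_sum {σ B : Type*} [CommRing B] [Algebra ℝ B] (D : Derivation ℝ B B)
    (x : σ → B) (g : MvPolynomial σ ℝ) :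
    D (MvPolynomial.aeval x g)
      = ∑ k ∈ g.vars, MvPolynomial.aeval x (MvPolynomial.pderiv k g) * D (x k) := by
  classical
  have key : ∃ K₀ : Finset σ, ∀ K, K₀ ⊆ K → D (MvPolynomial.aeval x g)
      = ∑ k ∈ K, MvPolynomial.aeval x (MvPolynomial.pderiv k g) * D (x k) := by
    induction g using MvPolynomial.induction_on with
    | C a => exact ⟨∅, fun K _ => by simp⟩
    | add p q hp hq =>
      obtain ⟨K₁, h₁⟩ := hp
      obtain ⟨K₂, h₂⟩ := hq
      refine ⟨K₁ ∪ K₂, fun K hK => ?_⟩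
      simp only [map_add, add_mul, Finset.sum_add_distrib]
      rw [h₁ K (Finset.union_subset_left hK), h₂ K (Finset.union_subset_right hK)]
    | mul_X p i hp =>
      obtain ⟨K₁, h₁⟩ := hp
      refine ⟨K₁ ∪ {i}, fun K hK => ?_⟩
      have hi : i ∈ K := hK (by simp)
      have h2 (k : σ) : MvPolynomial.aeval x
          (MvPolynomial.pderiv k (p * MvPolynomial.X i)) * D (x k)
          = x i * (MvPolynomial.aeval x (MvPolynomial.pderiv k p) * D (x k))
            + if k = i then MvPolynomial.aeval x p * D (x i) else 0 := by
        by_cases hk : k = i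
        · subst hk; simp [Derivation.leibniz]; ring
        · simp [Derivation.leibniz, MvPolynomial.pderiv_X_of_ne (Ne.symm hk), hk]; ring
      simp only [h2, Finset.sum_add_distrib, ← Finset.mul_sum, Finset.sum_ite_eq', hi, if_true]
      rw [← h₁ K (Finset.union_subset_left hK)]
      simp [Derivation.leibniz]; ring
  obtain ⟨K₀, h⟩ := key
  rw [h _ (Finset.subset_union_left (s₂ := g.vars))]
  refine (Finset.sum_subset Finset.subset_union_right fun k _ hk => ?_).symm
  rw [MvPolynomial.pderiv_eq_zero_of_notMem_vars hk]; simp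

/-- Evaluation of a polynomial in the matrix entries. -/
def evalEntries {n : Type*} (A : Matrix n n ℝ) : MvPolynomial (n × n) ℝ →ₐ[ℝ] ℝ :=
  MvPolynomial.aeval fun p => A p.1 p.2

theorem measurable_apply_entry {n : Type*} (i j : n) : Measurable fun A : Matrix n n ℝ => A i j :=
  (measurable_pi_apply j).comp (measurable_pi_apply i)

theorem measurable_evalEntries {n : Type*} (F : MvPolynomial (n × n) ℝ) :
    Measurable fun A : Matrix n n ℝ => evalEntries A F := by
  induction F using MvPolynomial.induction_on with
  | C a => simp [evalEntries]
  | add p q hp hq => simp only [map_add]; exact hp.add hq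
  | mul_X p i hp =>
    have h : ∀ A : Matrix n n ℝ, evalEntries A (p * MvPolynomial.X i)
        = evalEntries A p * A i.1 i.2 := fun A => by simp [evalEntries]
    simp only [h]
    exact hp.mul (measurable_apply_entry i.1 i.2)

theorem measurable_mul_left_matrix {n : Type*} [Fintype n] (g : Matrix n n ℝ) :
    Measurable fun A : Matrix n n ℝ => g * A := by
  refine measurable_pi_lambda _ fun i => measurable_pi_lambda _ fun j => ?_
  simp only [Matrix.mul_apply]
  exact Finset.measurable_sum _ fun k _ => (measurable_apply_entry k j).const_mul _

section Group

variable {n : Type*} [Fintype n] [DecidableEq n]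

/-- The derivation on polynomials in the matrix entries induced by the vector field
`A ↦ X * A`. -/
def entryDerivation (X : Matrix n n ℝ) :
    Derivation ℝ (MvPolynomial (n × n) ℝ) (MvPolynomial (n × n) ℝ) :=
  MvPolynomial.mkDerivation ℝ fun p =>
    (X.map (MvPolynomial.C (σ := n × n)) * mvPolynomialX n n ℝ : Matrix n n _) p.1 p.2

theorem exp_smul_mem_specialOrthogonalGroup {X : Matrix n n ℝ} (hX : Xᵀ = -X) (t : ℝ) :
    NormedSpace.exp (t • X) ∈ specialOrthogonalGroup n ℝ := by
  have horth (s : ℝ) : NormedSpace.exp (s • X) * (NormedSpace.exp (s • X))ᵀ = 1 := by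
    rw [← Matrix.exp_transpose, Matrix.transpose_smul, hX, smul_neg, Matrix.exp_neg]
    exact Matrix.mul_nonsing_inv _ ((Matrix.isUnit_iff_isUnit_det _).1 (Matrix.isUnit_exp _))
  refine Matrix.mem_specialOrthogonalGroup_iff.2
    ⟨(Matrix.mem_orthogonalGroup_iff _ _).2 (horth t), ?_⟩
  have h2 : t • X = (t / 2) • X + (t / 2) • X := by rw [← add_smul]; ring_nf
  have h3 := congrArg Matrix.det (horth (t / 2))
  rw [det_mul, det_transpose, det_one] at h3
  rw [h2, Matrix.exp_add_of_commute _ _ (Commute.refl _), det_mul, h3]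

open scoped Matrix.Norms.Operator in
theorem hasDerivAt_exp_smul_mul_apply (X A : Matrix n n ℝ) (t : ℝ) (i j : n) :
    HasDerivAt (fun s : ℝ => (NormedSpace.exp (s • X) * A) i j)
      ((X * (NormedSpace.exp (t • X) * A)) i j) t := by
  have h := (hasDerivAt_exp_smul_const' (𝕂 := ℝ) X t).mul_const A
  rw [mul_assoc] at h
  exact (hasDerivAt_pi.1 ((hasDerivAt_pi.1 h) i)) j

theorem evalEntries_hasDerivAt (X A : Matrix n n ℝ) (F : MvPolynomial (n × n) ℝ) (t : ℝ) :
    HasDerivAt (fun s : ℝ => evalEntries (NormedSpace.exp (s • X) * A) F)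
      (evalEntries (NormedSpace.exp (t • X) * A) (entryDerivation X F)) t := by
  induction F using MvPolynomial.induction_on with
  | C a => simpa [evalEntries] using hasDerivAt_const t a
  | add p q hp hq => simp only [map_add]; exact hp.add hq
  | mul_X p i hp =>
    have h1 := hasDerivAt_exp_smul_mul_apply X A t i.1 i.2
    have h2 := hp.mul h1
    convert! h2 using 1
    · ext s; simp [evalEntries]
    · simp only [Derivation.leibniz, smul_eq_mul, map_add, map_mul]
      have : evalEntries (NormedSpace.exp (t • X) * A) (entryDerivation X (MvPolynomial.X i))
          = (X * (NormedSpace.exp (t • X) * A)) i.1 i.2 := by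
        simp [entryDerivation, evalEntries, Matrix.mul_apply (M := X), Matrix.mul_apply (M := X.map _)]
      rw [this]
      simp [evalEntries]; ring

theorem abs_apply_le_one_of_mem_specialOrthogonalGroup {A : Matrix n n ℝ}
    (hA : A ∈ specialOrthogonalGroup n ℝ) (i j : n) : |A i j| ≤ 1 :=
  entry_norm_bound_of_unitary (𝕜 := ℝ) (Matrix.mem_specialOrthogonalGroup_iff.1 hA).1 i j

theorem exists_bound_evalEntries (F : MvPolynomial (n × n) ℝ) :
    ∃ C : ℝ, ∀ A ∈ specialOrthogonalGroup n ℝ, |evalEntries A F| ≤ C := by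
  induction F using MvPolynomial.induction_on with
  | C a => exact ⟨|a|, fun A _ => by simp [evalEntries]⟩
  | add p q hp hq =>
    obtain ⟨C₁, h₁⟩ := hp
    obtain ⟨C₂, h₂⟩ := hq
    exact ⟨C₁ + C₂, fun A hA => by
      rw [map_add]; exact (abs_add_le _ _).trans (add_le_add (h₁ A hA) (h₂ A hA))⟩
  | mul_X p i hp =>
    obtain ⟨C₁, h₁⟩ := hp
    refine ⟨C₁, fun A hA => ?_⟩
    have h2 := abs_apply_le_one_of_mem_specialOrthogonalGroup hA i.1 i.2
    have h3 : evalEntries A (p * MvPolynomial.X i) = evalEntries A p * A i.1 i.2 := by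
      simp [evalEntries]
    rw [h3, abs_mul]
    exact (mul_le_of_le_one_right (abs_nonneg _) h2).trans (h₁ A hA)

theorem ae_mem_specialOrthogonalGroup (μ : Measure (Matrix n n ℝ)) [IsProbabilityMeasure μ]
    (hsupp : μ {A | A ∈ specialOrthogonalGroup n ℝ} = 1) :
    ∀ᵐ A ∂μ, A ∈ specialOrthogonalGroup n ℝ := by
  have hmeas : MeasurableSet {A : Matrix n n ℝ | A ∈ specialOrthogonalGroup n ℝ} := by
    have : {A : Matrix n n ℝ | A ∈ specialOrthogonalGroup n ℝ}
        = (⋂ i, ⋂ j, {A | ∑ k, A i k * A j k = (1 : Matrix n n ℝ) i j}) ∩ {A | A.det = 1} := by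
      ext A
      simp only [Set.mem_ofPred_eq, Matrix.mem_specialOrthogonalGroup_iff,
        Matrix.mem_orthogonalGroup_iff, Set.mem_inter_iff, Set.mem_iInter, ← Matrix.ext_iff]
      rfl
    rw [this]
    refine MeasurableSet.inter (MeasurableSet.iInter fun i => MeasurableSet.iInter fun j => ?_) ?_
    · exact measurableSet_eq_fun (Finset.measurable_sum _ fun k _ =>
        (measurable_apply_entry i k).mul (measurable_apply_entry j k)) measurable_const
    · refine measurableSet_eq_fun (f := Matrix.det) ?_ measurable_const
      rw [show (Matrix.det : Matrix n n ℝ → ℝ) = fun A => _ from funext Matrix.det_apply]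
      exact Finset.measurable_sum _ fun σ _ => (Finset.measurable_prod _ fun i _ =>
        measurable_apply_entry _ _).const_smul _
  exact (mem_ae_iff_prob_eq_one hmeas).2 hsupp

theorem integrable_evalEntries (μ : Measure (Matrix n n ℝ)) [IsProbabilityMeasure μ]
    (hsupp : μ {A | A ∈ specialOrthogonalGroup n ℝ} = 1) (F : MvPolynomial (n × n) ℝ) :
    Integrable (fun A => evalEntries A F) μ := by
  obtain ⟨C, hC⟩ := exists_bound_evalEntries F
  refine Integrable.of_bound (measurable_evalEntries F).aestronglyMeasurable C ?_
  filter_upwards [ae_mem_specialOrthogonalGroup μ hsupp] with A hA using hC A hA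

theorem integral_entryDerivation_eq_zero (μ : Measure (Matrix n n ℝ)) [IsProbabilityMeasure μ]
    (hsupp : μ {A | A ∈ specialOrthogonalGroup n ℝ} = 1)
    (hinv : ∀ g ∈ specialOrthogonalGroup n ℝ, μ.map (fun A => g * A) = μ)
    {X : Matrix n n ℝ} (hX : Xᵀ = -X) (F : MvPolynomial (n × n) ℝ) :
    ∫ A, evalEntries A (entryDerivation X F) ∂μ = 0 := by
  obtain ⟨C, hC⟩ := exists_bound_evalEntries (entryDerivation X F)
  have hmeas (G : MvPolynomial (n × n) ℝ) (t : ℝ) :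
      Measurable fun A => evalEntries (NormedSpace.exp (t • X) * A) G :=
    (measurable_evalEntries G).comp (measurable_mul_left_matrix _)
  have hconst (t : ℝ) : ∫ A, evalEntries (NormedSpace.exp (t • X) * A) F ∂μ
      = ∫ A, evalEntries A F ∂μ := by
    conv_rhs => rw [← hinv _ (exp_smul_mem_specialOrthogonalGroup hX t)]
    rw [integral_map (measurable_mul_left_matrix _).aemeasurable
      (measurable_evalEntries F).aestronglyMeasurable]
  have h := (hasDerivAt_integral_of_dominated_loc_of_deriv_le (μ := μ) (𝕜 := ℝ) (x₀ := 0)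
    (s := Set.univ) (bound := fun _ => C)
    (F := fun t A => evalEntries (NormedSpace.exp (t • X) * A) F)
    (F' := fun t A => evalEntries (NormedSpace.exp (t • X) * A) (entryDerivation X F))
    Filter.univ_mem (Filter.Eventually.of_forall fun t => (hmeas F t).aestronglyMeasurable)
    (by simpa using integrable_evalEntries μ hsupp F) (hmeas _ 0).aestronglyMeasurable
    (by
      filter_upwards [ae_mem_specialOrthogonalGroup μ hsupp] with A hA t _
      exact hC _ (mul_mem (exp_smul_mem_specialOrthogonalGroup hX t) hA))
    (integrable_const C)
    (Filter.Eventually.of_forall fun A t _ => evalEntries_hasDerivAt X A F t)).2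
  simp only [hconst] at h
  have h0 := h.unique (hasDerivAt_const 0 _)
  simpa using h0

end Group

theorem map_derivation_mul {n B : Type*} [Fintype n] [CommRing B] [Algebra ℝ B]
    (D : Derivation ℝ B B) (M N : Matrix n n B) :
    (M * N).map D = M.map D * N + M * N.map D := by
  ext i j
  simp only [Matrix.map_apply, Matrix.add_apply, Matrix.mul_apply, map_sum, Derivation.leibniz,
    smul_eq_mul, ← Finset.sum_add_distrib]
  exact Finset.sum_congr rfl fun k _ => by ring

theorem map_derivation_pow {n B : Type*} [Fintype n] [DecidableEq n] [CommRing B] [Algebra ℝ B]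
    (D : Derivation ℝ B B) {G Y : Matrix n n B} (h : G.map D = Y * G) (l : ℕ) :
    (G ^ l).map D = ∑ j ∈ Finset.range l, G ^ j * Y * G ^ (l - j) := by
  induction l with
  | zero =>
    ext i j
    by_cases hij : i = j
    · subst hij; simp
    · simp [hij]
  | succ l ih =>
    rw [pow_succ, map_derivation_mul, ih, h, Finset.sum_range_succ, Finset.sum_mul]
    congr 1
    · refine Finset.sum_congr rfl fun j hj => ?_
      rw [Nat.succ_sub (Finset.mem_range.1 hj).le, pow_succ, mul_assoc _ (G ^ _)]
    · simp [mul_assoc]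

theorem trace_map_derivation {n B : Type*} [Fintype n] [CommRing B] [Algebra ℝ B]
    (D : Derivation ℝ B B) (M : Matrix n n B) : (M.map D).trace = D M.trace := by
  simp [Matrix.trace]

/-- The elementary skew-symmetric matrix with entries `1` at `(a, b)` and `-1` at `(b, a)`. -/
def skewSingle {n : Type*} [DecidableEq n] (a b : n) : Matrix n n ℝ :=
  Matrix.single a b 1 - Matrix.single b a 1

theorem transpose_skewSingle {n : Type*} [DecidableEq n] (a b : n) :
    (skewSingle a b)ᵀ = -skewSingle a b := by
  simp [skewSingle]

theorem trace_single_mul_mul_single_mul {n : Type*} [Fintype n] [DecidableEq n] (a b c d : n)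
    (P Q : Matrix n n ℝ) :
    (Matrix.single a b 1 * P * (Matrix.single c d 1 * Q)).trace = P b c * Q d a := by
  rw [mul_assoc, Matrix.trace_mul_comm]
  simp [Matrix.trace, Matrix.mul_apply, Matrix.single_apply, ite_and]

theorem sum_trace_skewSingle_mul_mul {n : Type*} [Fintype n] [DecidableEq n]
    (P Q : Matrix n n ℝ) :
    ∑ a, ∑ b, (skewSingle a b * P * (skewSingle a b * Q)).trace
      = 2 * ((P * Qᵀ).trace - P.trace * Q.trace) := by
  have h (a b : n) : (skewSingle a b * P * (skewSingle a b * Q)).trace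
      = P b a * Q b a - P b b * Q a a - P a a * Q b b + P a b * Q a b := by
    simp only [skewSingle, sub_mul, mul_sub, Matrix.trace_sub, trace_single_mul_mul_single_mul]
    ring
  have h1 : (P * Qᵀ).trace = ∑ a, ∑ b, P a b * Q a b := by
    simp [Matrix.trace, Matrix.mul_apply]
  have h2 : P.trace * Q.trace = ∑ a, ∑ b, P a a * Q b b := by
    simp [Matrix.trace, Finset.sum_mul_sum]
  simp only [h, Finset.sum_add_distrib, Finset.sum_sub_distrib]
  rw [h1, h2, Finset.sum_comm (f := fun a b => P b a * Q b a),
    Finset.sum_comm (f := fun a b => P b b * Q a a)]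
  ring

theorem sum_trace_skewSingle_mul_trace {n : Type*} [Fintype n] [DecidableEq n]
    (P Q : Matrix n n ℝ) :
    ∑ a, ∑ b, (skewSingle a b * P).trace * (skewSingle a b * Q).trace
      = 2 * ((P * Qᵀ).trace - (P * Q).trace) := by
  have h0 (a b : n) (P : Matrix n n ℝ) : (skewSingle a b * P).trace = P b a - P a b := by
    simp [skewSingle, sub_mul, Matrix.trace, Matrix.mul_apply, Matrix.single_apply, ite_and]
  have h (a b : n) : (skewSingle a b * P).trace * (skewSingle a b * Q).trace
      = P b a * Q b a - P b a * Q a b - P a b * Q b a + P a b * Q a b := by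
    rw [h0, h0]; ring
  have h1 : (P * Qᵀ).trace = ∑ a, ∑ b, P a b * Q a b := by
    simp [Matrix.trace, Matrix.mul_apply]
  have h2 : (P * Q).trace = ∑ a, ∑ b, P a b * Q b a := by
    simp [Matrix.trace, Matrix.mul_apply]
  simp only [h, Finset.sum_add_distrib, Finset.sum_sub_distrib]
  rw [h1, h2, Finset.sum_comm (f := fun a b => P b a * Q b a),
    Finset.sum_comm (f := fun a b => P b a * Q a b)]
  ring

theorem trace_pow_mul_transpose_pow {n : Type*} [Fintype n] [DecidableEq n]
    {A : Matrix n n ℝ} (hA : A ∈ specialOrthogonalGroup n ℝ) (j m : ℕ) :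
    (A ^ j * (A ^ m)ᵀ).trace = (A ^ ((j : ℤ) - m).natAbs).trace := by
  have h1 : A * Aᵀ = 1 :=
    (Matrix.mem_orthogonalGroup_iff _ _).1 (Matrix.mem_specialOrthogonalGroup_iff.1 hA).1
  have hp (m : ℕ) : A ^ m * (A ^ m)ᵀ = 1 := by
    have hc : Commute A Aᵀ := h1.trans (mul_eq_one_comm.1 h1).symm
    rw [Matrix.transpose_pow, ← hc.mul_pow, h1, one_pow]
  have key (m d : ℕ) : A ^ (d + m) * (A ^ m)ᵀ = A ^ d := by
    rw [pow_add, mul_assoc, hp, mul_one]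
  rcases le_total m j with h | h
  · obtain ⟨d, rfl⟩ := Nat.exists_eq_add_of_le' h
    rw [key]; congr; omega
  · obtain ⟨d, rfl⟩ := Nat.exists_eq_add_of_le' h
    rw [← Matrix.trace_transpose, Matrix.transpose_mul, Matrix.transpose_transpose, key]
    congr; omega

/-- The Laplacian of the `k`-th power sum, divided by `k`, as a polynomial in the power sums. -/
def laplacePower (k : ℕ) : MvPolynomial ℕ ℝ :=
  ∑ j ∈ Finset.range k, (MvPolynomial.X ((j : ℤ) - (k - j : ℕ)).natAbs
    - MvPolynomial.X j * MvPolynomial.X (k - j))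

/-- The gradient vector field of the `k`-th power sum, divided by `k`, acting on polynomials in the
power sums. -/
def gradPower (k : ℕ) : Derivation ℝ (MvPolynomial ℕ ℝ) (MvPolynomial ℕ ℝ) :=
  MvPolynomial.mkDerivation ℝ fun l =>
    (l : ℝ) • (MvPolynomial.X ((k : ℤ) - l).natAbs - MvPolynomial.X (k + l))

/-- Evaluation of a polynomial in the power sums at the power sums of the eigenvalues of `A`. -/
def evalTraces {n : Type*} [Fintype n] [DecidableEq n] (A : Matrix n n ℝ) :
    MvPolynomial ℕ ℝ →ₐ[ℝ] ℝ :=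
  MvPolynomial.aeval fun k => (A ^ k).trace

section Loop

variable {n : Type*} [Fintype n] [DecidableEq n]

theorem gradPower_eq_sum (k : ℕ) (g : MvPolynomial ℕ ℝ) :
    gradPower k g = ∑ l ∈ g.vars, MvPolynomial.pderiv l g *
      ((l : ℝ) • (MvPolynomial.X ((k : ℤ) - l).natAbs - MvPolynomial.X (k + l))) := by
  have := derivation_aeval_eq_sum (gradPower k) MvPolynomial.X g
  simpa [MvPolynomial.aeval_X_left, gradPower] using this

theorem mapMatrix_evalEntries_generic (A : Matrix n n ℝ) :
    (evalEntries A).mapMatrix (mvPolynomialX n n ℝ) = A := by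
  ext i j; simp [evalEntries]

theorem evalEntries_trace (A : Matrix n n ℝ) (M : Matrix n n (MvPolynomial (n × n) ℝ)) :
    evalEntries A M.trace = ((evalEntries A).mapMatrix M).trace := by
  simp [Matrix.trace]

theorem mapMatrix_evalEntries_C (A X : Matrix n n ℝ) :
    (evalEntries A).mapMatrix (X.map (MvPolynomial.C (σ := n × n))) = X := by
  ext i j; simp [evalEntries]

theorem evalEntries_aeval_traces (A : Matrix n n ℝ) (g : MvPolynomial ℕ ℝ) :
    evalEntries A (MvPolynomial.aeval (fun l => ((mvPolynomialX n n ℝ) ^ l).trace) g)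
      = evalTraces A g := by
  rw [evalTraces, ← AlgHom.comp_apply, MvPolynomial.comp_aeval]
  congr 2
  funext l
  rw [evalEntries_trace, map_pow, mapMatrix_evalEntries_generic]

theorem map_entryDerivation_generic {n : Type*} [Fintype n] (X : Matrix n n ℝ) :
    (mvPolynomialX n n ℝ).map (entryDerivation X)
      = X.map (MvPolynomial.C (σ := n × n)) * mvPolynomialX n n ℝ := by
  ext1 i j; simp [entryDerivation]

theorem evalEntries_entryDerivation_trace_mul (X A : Matrix n n ℝ) (k : ℕ)
    (g : MvPolynomial ℕ ℝ) :
    evalEntries A (entryDerivation X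
      ((X.map (MvPolynomial.C (σ := n × n)) * (mvPolynomialX n n ℝ) ^ k).trace *
        MvPolynomial.aeval (fun l => ((mvPolynomialX n n ℝ) ^ l).trace) g))
      = (∑ j ∈ Finset.range k, (X * A ^ j * (X * A ^ (k - j))).trace) * evalTraces A g
        + ∑ l ∈ g.vars, evalTraces A (MvPolynomial.pderiv l g) * (l : ℝ)
          * ((X * A ^ k).trace * (X * A ^ l).trace) := by
  set G := mvPolynomialX n n ℝ with hG
  set Y := X.map (MvPolynomial.C (σ := n × n)) with hY
  have hXC : Y.map (entryDerivation X) = 0 := by ext1 i j; simp [hY]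
  have h1 : entryDerivation X (Y * G ^ k).trace
      = (∑ j ∈ Finset.range k, Y * G ^ j * (Y * G ^ (k - j))).trace := by
    rw [← trace_map_derivation, map_derivation_mul, hXC, zero_mul, zero_add,
      map_derivation_pow _ (map_entryDerivation_generic X), Finset.mul_sum]
    simp only [mul_assoc]; rfl
  have h2 (l : ℕ) : entryDerivation X (G ^ l).trace = l * (Y * G ^ l).trace := by
    rw [← trace_map_derivation, map_derivation_pow _ (map_entryDerivation_generic X),
      Matrix.trace_sum]
    have : ∀ j ∈ Finset.range l, (G ^ j * Y * G ^ (l - j)).trace = (Y * G ^ l).trace := by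
      intro j hj
      rw [mul_assoc, Matrix.trace_mul_comm, mul_assoc, ← pow_add,
        Nat.sub_add_cancel (Finset.mem_range.1 hj).le]
    rw [Finset.sum_congr rfl this]; simp
  rw [Derivation.leibniz, h1, derivation_aeval_eq_sum]
  simp only [smul_eq_mul, map_add, map_mul, map_sum, h2, evalEntries_trace, Matrix.trace_sum]
  simp only [hY, hG, evalEntries_aeval_traces, map_pow, mapMatrix_evalEntries_C,
    mapMatrix_evalEntries_generic, map_natCast]
  rw [add_comm, mul_comm (evalTraces A g), Finset.mul_sum]
  congr 1
  exact Finset.sum_congr rfl fun l _ => by ring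

theorem sum_evalEntries_entryDerivation {A : Matrix n n ℝ} (hA : A ∈ specialOrthogonalGroup n ℝ)
    (k : ℕ) (g : MvPolynomial ℕ ℝ) :
    ∑ a : n, ∑ b : n, evalEntries A (entryDerivation (skewSingle a b)
      (((skewSingle a b).map (MvPolynomial.C (σ := n × n)) * (mvPolynomialX n n ℝ) ^ k).trace *
        MvPolynomial.aeval (fun l => ((mvPolynomialX n n ℝ) ^ l).trace) g))
      = 2 * evalTraces A (laplacePower k * g + gradPower k g) := by
  have hX (m : ℕ) : evalTraces A (MvPolynomial.X m) = (A ^ m).trace := by simp [evalTraces]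
  simp only [evalEntries_entryDerivation_trace_mul, Finset.sum_add_distrib, ← Finset.sum_mul]
  have h1 : ∑ a, ∑ b, ∑ j ∈ Finset.range k,
      (skewSingle a b * A ^ j * (skewSingle a b * A ^ (k - j))).trace
      = 2 * evalTraces A (laplacePower k) := by
    simp only [Finset.sum_comm (t := Finset.range k), sum_trace_skewSingle_mul_mul,
      trace_pow_mul_transpose_pow hA, laplacePower, map_sum, map_sub, map_mul, hX, Finset.mul_sum]
  have h2 : ∑ a, ∑ b, ∑ l ∈ g.vars, evalTraces A (MvPolynomial.pderiv l g) * (l : ℝ)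
          * ((skewSingle a b * A ^ k).trace * (skewSingle a b * A ^ l).trace)
      = 2 * evalTraces A (gradPower k g) := by
    simp only [Finset.sum_comm (t := g.vars), ← Finset.mul_sum, sum_trace_skewSingle_mul_trace,
      trace_pow_mul_transpose_pow hA, gradPower_eq_sum, map_sum, map_mul, map_smul, map_sub, hX,
      ← pow_add, smul_eq_mul]
    rw [Finset.mul_sum]
    exact Finset.sum_congr rfl fun l _ => by ring
  rw [h1, h2, map_add, map_mul]; ring

theorem integrable_evalTraces (μ : Measure (Matrix n n ℝ)) [IsProbabilityMeasure μ]
    (hsupp : μ {A | A ∈ specialOrthogonalGroup n ℝ} = 1) (g : MvPolynomial ℕ ℝ) :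
    Integrable (fun A => evalTraces A g) μ := by
  simp only [← evalEntries_aeval_traces]
  exact integrable_evalEntries μ hsupp _

/-- The integration by parts (loop) equations for the traces of powers of a random matrix in
`SO(n)`. -/
theorem integral_laplacePower_mul_add_gradPower (μ : Measure (Matrix n n ℝ))
    [IsProbabilityMeasure μ] (hsupp : μ {A | A ∈ specialOrthogonalGroup n ℝ} = 1)
    (hinv : ∀ g ∈ specialOrthogonalGroup n ℝ, μ.map (fun A => g * A) = μ)
    (k : ℕ) (g : MvPolynomial ℕ ℝ) :
    ∫ A, evalTraces A (laplacePower k * g + gradPower k g) ∂μ = 0 := by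
  have h1 : ∫ A, 2 * evalTraces A (laplacePower k * g + gradPower k g) ∂μ = 0 := by
    rw [← integral_congr_ae (f := fun A => ∑ a : n, ∑ b : n,
      evalEntries A (entryDerivation (skewSingle a b)
      (((skewSingle a b).map (MvPolynomial.C (σ := n × n)) * (mvPolynomialX n n ℝ) ^ k).trace *
        MvPolynomial.aeval (fun l => ((mvPolynomialX n n ℝ) ^ l).trace) g)))]
    · rw [integral_finsetSum _ fun a _ => integrable_finsetSum _ fun b _ =>
        integrable_evalEntries μ hsupp _]
      refine Finset.sum_eq_zero fun a _ => ?_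
      rw [integral_finsetSum _ fun b _ => integrable_evalEntries μ hsupp _]
      exact Finset.sum_eq_zero fun b _ =>
        integral_entryDerivation_eq_zero μ hsupp hinv (transpose_skewSingle a b) _
    · filter_upwards [ae_mem_specialOrthogonalGroup μ hsupp] with A hA
      exact sum_evalEntries_entryDerivation hA k g
  rw [integral_const_mul] at h1
  linarith

end Loop

/-- Laurent polynomials with real coefficients in `N` variables. -/
abbrev TorusRing (N : ℕ) : Type := AddMonoidAlgebra ℝ (Fin N → ℤ)

section Torus

variable {N : ℕ}

/-- The operator multiplying the coefficient of the monomial with exponent `m` by `w m`. -/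
def weightMap (w : (Fin N → ℤ) → ℝ) : TorusRing N →ₗ[ℝ] TorusRing N where
  toFun f := .ofCoeff (Finsupp.onFinset f.coeff.support (fun m => w m * f.coeff m)
    fun m hm => Finsupp.mem_support_iff.2 (right_ne_zero_of_mul hm))
  map_add' f g := by ext m; simp [mul_add]
  map_smul' a f := by ext m; simp; ring

@[simp] theorem coeff_weightMap (w : (Fin N → ℤ) → ℝ) (f : TorusRing N) (m : Fin N → ℤ) :
    (weightMap w f).coeff m = w m * f.coeff m := rfl

theorem weightMap_single (w : (Fin N → ℤ) → ℝ) (m : Fin N → ℤ) (a : ℝ) :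
    weightMap w (.single m a) = .single m (w m * a) := by
  ext m'
  by_cases h : m = m'
  · subst h; simp
  · simp [h]

/-- The Euler derivation `xᵢ ∂/∂xᵢ`. -/
def eulerDerivation (i : Fin N) : Derivation ℝ (TorusRing N) (TorusRing N) :=
  Derivation.mk' (weightMap fun m => (m i : ℝ)) fun f g => by
    induction f using AddMonoidAlgebra.induction_linear with
    | zero => simp
    | add f₁ f₂ h₁ h₂ =>
      simp only [smul_eq_mul] at h₁ h₂ ⊢
      rw [add_mul, map_add, h₁, h₂, map_add]; ring
    | single m a =>
      induction g using AddMonoidAlgebra.induction_linear with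
      | zero => simp
      | add g₁ g₂ h₁ h₂ =>
        simp only [smul_eq_mul] at h₁ h₂ ⊢
        rw [mul_add, map_add, h₁, h₂, map_add]; ring
      | single m' a' =>
        simp only [smul_eq_mul, AddMonoidAlgebra.single_mul_single, weightMap_single]
        rw [add_comm m' m, ← AddMonoidAlgebra.single_add]
        congr 1
        simp; ring

@[simp] theorem coeff_eulerDerivation (i : Fin N) (f : TorusRing N) (m : Fin N → ℤ) :
    (eulerDerivation i f).coeff m = m i * f.coeff m := rfl

/-- The monomial `xᵢⁿ`. -/
def varPow (i : Fin N) (n : ℤ) : TorusRing N := .single (Pi.single i n) 1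

theorem varPow_mul (i : Fin N) (a b : ℤ) : varPow i a * varPow i b = varPow i (a + b) := by
  simp [varPow, AddMonoidAlgebra.single_mul_single, Pi.single_add]

theorem varPow_zero (i : Fin N) : varPow i 0 = 1 := by
  simp [varPow, AddMonoidAlgebra.one_def]

theorem eulerDerivation_varPow (i j : Fin N) (n : ℤ) :
    eulerDerivation i (varPow j n) = if i = j then (n : ℝ) • varPow j n else 0 := by
  have : eulerDerivation i (varPow j n)
      = .single (Pi.single j n) (((Pi.single j n : Fin N → ℤ) i : ℝ) * 1) :=
    weightMap_single _ _ _
  rw [this]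
  split_ifs with h
  · subst h; simp [varPow]
  · simp [h]

/-- `cosPow i k = zᵢᵏ + zᵢ⁻ᵏ` where `zᵢ = xᵢ²`. -/
def cosPow (i : Fin N) (k : ℤ) : TorusRing N := varPow i (2 * k) + varPow i (-(2 * k))

/-- `sinPow i k = zᵢᵏ - zᵢ⁻ᵏ` where `zᵢ = xᵢ²`. -/
def sinPow (i : Fin N) (k : ℤ) : TorusRing N := varPow i (2 * k) - varPow i (-(2 * k))

theorem cosPow_neg (i : Fin N) (k : ℤ) : cosPow i (-k) = cosPow i k := by
  simp [cosPow, add_comm]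

theorem cosPow_zero (i : Fin N) : cosPow i 0 = 2 := by
  simp [cosPow, varPow_zero]; norm_num

theorem sinPow_zero (i : Fin N) : sinPow i 0 = 0 := by
  simp [sinPow]

theorem cosPow_natAbs (i : Fin N) (k : ℤ) : cosPow i (k.natAbs : ℤ) = cosPow i k := by
  rcases Int.natAbs_eq k with h | h
  · rw [← h]
  · conv_rhs => rw [h, cosPow_neg]

theorem cosPow_mul_cosPow (i : Fin N) (a b : ℤ) :
    cosPow i a * cosPow i b = cosPow i (a + b) + cosPow i (a - b) := by
  simp only [cosPow, mul_add, add_mul, varPow_mul]; ring_nf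

theorem sinPow_mul_sinPow (i : Fin N) (a b : ℤ) :
    sinPow i a * sinPow i b = cosPow i (a + b) - cosPow i (a - b) := by
  simp only [cosPow, sinPow, mul_sub, sub_mul, varPow_mul]; ring_nf

theorem eulerDerivation_cosPow (i j : Fin N) (k : ℤ) :
    eulerDerivation i (cosPow j k) = if i = j then (2 * k : ℝ) • sinPow j k else 0 := by
  simp only [cosPow, sinPow, map_add, eulerDerivation_varPow]
  split_ifs
  · push_cast; module
  · simp

theorem eulerDerivation_sinPow (i j : Fin N) (k : ℤ) :
    eulerDerivation i (sinPow j k) = if i = j then (2 * k : ℝ) • cosPow j k else 0 := by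
  simp only [cosPow, sinPow, map_sub, eulerDerivation_varPow]
  split_ifs
  · push_cast; module
  · simp

/-- `halfSin i = xᵢ - xᵢ⁻¹`. -/
def halfSin (i : Fin N) : TorusRing N := varPow i 1 - varPow i (-1)

theorem eulerDerivation_halfSin (i j : Fin N) :
    eulerDerivation i (halfSin j) = if i = j then varPow j 1 + varPow j (-1) else 0 := by
  simp only [halfSin, map_sub, eulerDerivation_varPow]
  split_ifs
  · push_cast; module
  · simp

theorem sinPow_mul_halfCos (i : Fin N) (k : ℕ) :
    sinPow i k * (varPow i 1 + varPow i (-1))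
      = (cosPow i k - 2 + 2 * ∑ l ∈ Finset.range k, cosPow i l) * halfSin i := by
  induction k with
  | zero => simp [cosPow_zero, sinPow_zero]
  | succ k ih =>
    have h : sinPow i (k + 1 : ℕ) * (varPow i 1 + varPow i (-1))
        = sinPow i k * (varPow i 1 + varPow i (-1))
          + (cosPow i (k + 1 : ℕ) + cosPow i k) * halfSin i := by
      simp only [sinPow, cosPow, halfSin, mul_add, add_mul, mul_sub, sub_mul, varPow_mul]
      push_cast
      ring_nf
    rw [h, ih, Finset.sum_range_succ]; ring

/-- The quotient of `(zᵢᵏ - zᵢ⁻ᵏ)(zᵢ - zᵢ⁻¹) - (zⱼᵏ - zⱼ⁻ᵏ)(zⱼ - zⱼ⁻¹)` by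
`(zᵢ + zᵢ⁻¹) - (zⱼ + zⱼ⁻¹)`. -/
def pairQuot (i j : Fin N) (k : ℕ) : TorusRing N :=
  ∑ l ∈ Finset.range (k + 1), cosPow i l * cosPow j (k - l : ℤ) - cosPow i k - cosPow j k

theorem pairQuot_comm (i j : Fin N) (k : ℕ) : pairQuot i j k = pairQuot j i k := by
  rw [pairQuot, ← Finset.sum_range_reflect, pairQuot]
  rw [Finset.sum_congr rfl (g := fun l : ℕ => cosPow j l * cosPow i (k - l : ℤ))]
  · ring
  · intro l hl
    have : ((k + 1 - 1 - l : ℕ) : ℤ) = k - l := by have := Finset.mem_range.1 hl; omega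
    rw [this, mul_comm, sub_sub_cancel]

theorem sinPow_sub_sinPow (i j : Fin N) (k : ℕ) :
    sinPow i k * sinPow i 1 - sinPow j k * sinPow j 1
      = pairQuot i j k * (cosPow i 1 - cosPow j 1) := by
  let g (l : ℕ) : TorusRing N := cosPow i l * cosPow j (k - l + 1 : ℤ)
    - cosPow i (l - 1 : ℤ) * cosPow j (k - l : ℤ)
  have h : (∑ l ∈ Finset.range (k + 1), cosPow i l * cosPow j (k - l : ℤ))
      * (cosPow i 1 - cosPow j 1) = g (k + 1) - g 0 := by
    rw [← Finset.sum_range_sub, Finset.sum_mul]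
    refine Finset.sum_congr rfl fun l _ => ?_
    have h1 := cosPow_mul_cosPow i l 1
    have h2 := cosPow_mul_cosPow j (k - l) 1
    simp only [g]
    push_cast
    rw [show (k - (l + 1) + 1 : ℤ) = k - l by ring, show (l + 1 - 1 : ℤ) = l by ring,
      show (k - (l + 1) : ℤ) = k - l - 1 by ring]
    linear_combination cosPow j (k - l) * h1 - cosPow i l * h2
  have h1 := cosPow_mul_cosPow i k 1
  have h2 := cosPow_mul_cosPow j k 1
  simp only [g] at h
  push_cast at h
  rw [show (k - (k + 1) + 1 : ℤ) = 0 by ring, show (k - (k + 1) : ℤ) = -1 by ring,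
    show (k + 1 - 1 : ℤ) = k by ring, show (k - 0 + 1 : ℤ) = k + 1 by ring, sub_zero,
    cosPow_neg, cosPow_neg, cosPow_zero, cosPow_zero] at h
  rw [pairQuot, sub_mul, sub_mul, h, sinPow_mul_sinPow, sinPow_mul_sinPow]
  linear_combination h1 - h2

theorem derivation_prod_of_eq_mul {B ι : Type*} [CommRing B] [Algebra ℝ B] (D : Derivation ℝ B B)
    (s : Finset ι) (f b : ι → B) (h : ∀ a ∈ s, D (f a) = b a * f a) :
    D (∏ a ∈ s, f a) = (∑ a ∈ s, b a) * ∏ a ∈ s, f a := by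
  classical
  induction s using Finset.induction_on with
  | empty => simp
  | insert a s ha ih =>
    rw [Finset.prod_insert ha, Finset.sum_insert ha, Derivation.leibniz,
      ih fun c hc => h c (Finset.mem_insert_of_mem hc), h a (Finset.mem_insert_self _ _),
      smul_eq_mul, smul_eq_mul]
    ring

/-- The Weyl denominator of type `B`, in product form. -/
def weylDenom (N : ℕ) : TorusRing N :=
  (∏ i, halfSin i) * ∏ i : Fin N, ∏ j ∈ Finset.Ioi i, (cosPow j 1 - cosPow i 1)

/-- The trace of the `k`-th power of the element of `SO(2N+1)` with eigenvalues `1, zᵢ, zᵢ⁻¹`. -/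
def powerSum (N : ℕ) (k : ℤ) : TorusRing N := 1 + ∑ i, cosPow i k

/-- The derivation `f ↦ ⟨∇ pₖ, ∇ f⟩` for the `k`-th power sum `pₖ`. -/
def gradDerivation (N : ℕ) (k : ℕ) : Derivation ℝ (TorusRing N) (TorusRing N) :=
  ∑ i, ((2 * k : ℝ) • sinPow i k) • eulerDerivation i

theorem gradDerivation_apply (k : ℕ) (f : TorusRing N) :
    gradDerivation N k f = ∑ i, ((2 * k : ℝ) • sinPow i k) * eulerDerivation i f := by
  rw [gradDerivation, ← Derivation.coeFnAddMonoidHom_apply, map_sum, Finset.sum_apply]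
  rfl

theorem eulerDerivation_powerSum (i : Fin N) (k : ℤ) :
    eulerDerivation i (powerSum N k) = (2 * k : ℝ) • sinPow i k := by
  simp [powerSum, eulerDerivation_cosPow]

theorem gradDerivation_cosPow (k : ℕ) (j : Fin N) (l : ℤ) :
    gradDerivation N k (cosPow j l)
      = (4 * k * l : ℝ) • (cosPow j (k + l) - cosPow j (k - l)) := by
  simp only [gradDerivation_apply, eulerDerivation_cosPow, mul_ite, mul_zero, Finset.sum_ite_eq',
    Finset.mem_univ, if_true, smul_mul_smul_comm, sinPow_mul_sinPow]
  congr 1; ring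

theorem gradDerivation_halfSin (k : ℕ) (j : Fin N) :
    gradDerivation N k (halfSin j)
      = ((2 * k : ℝ) • (cosPow j k - 2 + 2 * ∑ l ∈ Finset.range k, cosPow j l)) * halfSin j := by
  simp only [gradDerivation_apply, eulerDerivation_halfSin, mul_ite, mul_zero, Finset.sum_ite_eq',
    Finset.mem_univ, if_true, smul_mul_assoc, sinPow_mul_halfCos]

theorem gradDerivation_cosPow_sub (k : ℕ) (i j : Fin N) :
    gradDerivation N k (cosPow j 1 - cosPow i 1)
      = ((4 * k : ℝ) • pairQuot i j k) * (cosPow j 1 - cosPow i 1) := by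
  rw [pairQuot_comm, smul_mul_assoc, ← sinPow_sub_sinPow, map_sub, gradDerivation_cosPow,
    gradDerivation_cosPow, sinPow_mul_sinPow, sinPow_mul_sinPow]
  push_cast; module

theorem gradDerivation_weylDenom (k : ℕ) :
    gradDerivation N k (weylDenom N)
      = ((∑ i, (2 * k : ℝ) • (cosPow i k - 2 + 2 * ∑ l ∈ Finset.range k, cosPow i l))
        + ∑ i : Fin N, ∑ j ∈ Finset.Ioi i, (4 * k : ℝ) • pairQuot i j k) * weylDenom N := by
  rw [weylDenom, Derivation.leibniz,
    derivation_prod_of_eq_mul _ _ _ _ fun i _ => gradDerivation_halfSin k i,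
    derivation_prod_of_eq_mul _ _ _ _ fun i _ =>
      derivation_prod_of_eq_mul _ _ _ _ fun j _ => gradDerivation_cosPow_sub k i j,
    smul_eq_mul, smul_eq_mul]
  ring

end Torus

section Radial

variable {N : ℕ}

/-- Evaluation of a polynomial in the power sums in the Laurent polynomial ring. -/
def evalPowerSums (N : ℕ) : MvPolynomial ℕ ℝ →ₐ[ℝ] TorusRing N :=
  MvPolynomial.aeval fun k => powerSum N k

theorem evalPowerSums_X (k : ℕ) : evalPowerSums N (MvPolynomial.X k) = powerSum N k := by
  simp [evalPowerSums]

theorem powerSum_natAbs (k : ℤ) : powerSum N k.natAbs = powerSum N k := by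
  simp only [powerSum, cosPow_natAbs]

theorem sum_sum_Ioi_pairQuot (k : ℕ) :
    2 * ∑ i : Fin N, ∑ j ∈ Finset.Ioi i, pairQuot i j k
      = ∑ i : Fin N, ∑ j : Fin N, pairQuot i j k - ∑ i : Fin N, pairQuot i i k := by
  have h (i : Fin N) : ∑ j : Fin N, pairQuot i j k
      = ∑ j ∈ Finset.Ioi i, pairQuot i j k + ∑ j ∈ Finset.Iio i, pairQuot i j k
        + pairQuot i i k := by
    have : (Finset.univ : Finset (Fin N)) = insert i (Finset.Ioi i ∪ Finset.Iio i) := by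
      ext j
      simp only [Finset.mem_univ, Finset.mem_insert, Finset.mem_union, Finset.mem_Ioi,
        Finset.mem_Iio, true_iff]
      rcases lt_trichotomy i j with h | h | h
      · exact .inr (.inl h)
      · exact .inl h.symm
      · exact .inr (.inr h)
    rw [this, Finset.sum_insert (by simp), Finset.sum_union]
    · ring
    · rw [Finset.disjoint_left]
      intro j hj hj'
      exact lt_asymm (Finset.mem_Ioi.1 hj) (Finset.mem_Iio.1 hj')
  have h2 : ∑ i : Fin N, ∑ j ∈ Finset.Iio i, pairQuot i j k
      = ∑ i : Fin N, ∑ j ∈ Finset.Ioi i, pairQuot i j k := by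
    rw [Finset.sum_comm' (t' := Finset.univ) (s' := fun j => Finset.Ioi j) (by simp)]
    simp only [pairQuot_comm]
  simp only [h, Finset.sum_add_distrib, h2]
  ring

theorem evalPowerSums_laplacePower (k : ℕ) :
    - evalPowerSums N (laplacePower k) =
      k * ∑ i : Fin N, cosPow i k
        + ∑ i : Fin N, (cosPow i k - 2 + 2 * ∑ l ∈ Finset.range k, cosPow i l)
        + 2 * ∑ i : Fin N, ∑ j ∈ Finset.Ioi i, pairQuot i j k := by
  have hterm (l : ℕ) (hl : l ∈ Finset.range k) :
      evalPowerSums N (MvPolynomial.X l * MvPolynomial.X (k - l)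
        - MvPolynomial.X ((l : ℤ) - (k - l : ℕ)).natAbs)
      = ∑ i : Fin N, cosPow i l + ∑ i : Fin N, cosPow i (k - l)
        + ∑ i : Fin N, ∑ j : Fin N, cosPow i l * cosPow j (k - l)
        + ∑ i : Fin N, (cosPow i k - cosPow i l * cosPow i (k - l)) := by
    have hkl : ((k - l : ℕ) : ℤ) = k - l := by have := Finset.mem_range.1 hl; omega
    have hd (i : Fin N) : cosPow i k - cosPow i l * cosPow i (k - l)
        = - cosPow i (l - (k - l)) := by
      rw [cosPow_mul_cosPow, show (l + (k - l) : ℤ) = k by ring]; ring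
    simp only [map_sub, map_mul, evalPowerSums_X, powerSum_natAbs, hkl, hd]
    simp only [powerSum, ← Finset.sum_mul_sum, Finset.sum_neg_distrib]
    ring
  have hneg : - evalPowerSums N (laplacePower k)
      = ∑ l ∈ Finset.range k, evalPowerSums N (MvPolynomial.X l * MvPolynomial.X (k - l)
        - MvPolynomial.X ((l : ℤ) - (k - l : ℕ)).natAbs) := by
    rw [laplacePower, map_sum, ← Finset.sum_neg_distrib]
    exact Finset.sum_congr rfl fun l _ => by rw [← map_neg, neg_sub]
  have hrefl (i : Fin N) : ∑ l ∈ Finset.range k, cosPow i (k - l)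
      = ∑ l ∈ Finset.range k, cosPow i l + cosPow i k - 2 := by
    have h1 : ∑ l ∈ Finset.range (k + 1), cosPow i (k - l)
        = ∑ l ∈ Finset.range (k + 1), cosPow i l := by
      rw [← Finset.sum_range_reflect]
      refine Finset.sum_congr rfl fun l hl => ?_
      congr 1
      have := Finset.mem_range.1 hl; omega
    rw [Finset.sum_range_succ, Finset.sum_range_succ, sub_self, cosPow_zero] at h1
    linear_combination h1
  have hdiag (i : Fin N) : pairQuot i i k
      = ∑ l ∈ Finset.range k, cosPow i l * cosPow i (k - l) := by
    rw [pairQuot, Finset.sum_range_succ, sub_self, cosPow_zero]; ring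
  have hpair (i j : Fin N) : pairQuot i j k
      = ∑ l ∈ Finset.range k, cosPow i l * cosPow j (k - l) + cosPow i k - cosPow j k := by
    rw [pairQuot, Finset.sum_range_succ, sub_self, cosPow_zero]; ring
  rw [hneg, Finset.sum_congr rfl hterm, sum_sum_Ioi_pairQuot]
  simp only [hdiag]
  simp only [hpair]
  have htwo : ∑ i : Fin N, 2 * ∑ l ∈ Finset.range k, cosPow i l
      = 2 * ∑ i : Fin N, ∑ l ∈ Finset.range k, cosPow i l := (Finset.mul_sum _ _ _).symm
  have hnat (m : ℕ) : ∑ i : Fin N, (m : TorusRing N) * cosPow i k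
      = m * ∑ i : Fin N, cosPow i k := (Finset.mul_sum _ _ _).symm
  simp only [htwo, Finset.sum_add_distrib, Finset.sum_sub_distrib, Finset.sum_const, Finset.card_univ,
    Fintype.card_fin, Finset.card_range, Finset.sum_comm (s := Finset.range k), hrefl,
    nsmul_eq_mul, hnat]
  ring

theorem laplacian_powerSum_add_gradDerivation (k : ℕ) :
    (∑ i, eulerDerivation i (eulerDerivation i (powerSum N k))) * weylDenom N
        + 2 * gradDerivation N k (weylDenom N)
      = ((-4 * k : ℝ) • evalPowerSums N (laplacePower k)) * weylDenom N := by
  have h1 : ∑ i, eulerDerivation i (eulerDerivation i (powerSum N k))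
      = (4 * k : ℝ) • (k * ∑ i : Fin N, cosPow i k) := by
    simp only [eulerDerivation_powerSum, Derivation.map_smul, eulerDerivation_sinPow, if_true,
      smul_smul, ← Finset.smul_sum]
    rw [← nsmul_eq_mul, ← Nat.cast_smul_eq_nsmul ℝ, smul_smul]
    congr 1; push_cast; ring
  have h2 : (-4 * k : ℝ) • evalPowerSums N (laplacePower k)
      = (4 * k : ℝ) • (- evalPowerSums N (laplacePower k)) := by module
  have h3 (a b d : TorusRing N) :
      (4 * k : ℝ) • a + 2 * ((2 * k : ℝ) • b + (4 * k : ℝ) • d)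
        = (4 * k : ℝ) • (a + b + 2 * d) := by
    simp only [two_mul (_ : TorusRing N)]; module
  rw [h1, h2, gradDerivation_weylDenom, evalPowerSums_laplacePower, ← h3]
  simp only [← Finset.smul_sum]
  rw [add_mul, add_mul, mul_assoc, add_mul]

theorem gradDerivation_evalPowerSums (k : ℕ) (g : MvPolynomial ℕ ℝ) :
    gradDerivation N k (evalPowerSums N g)
      = (-4 * k : ℝ) • evalPowerSums N (gradPower k g) := by
  rw [gradPower_eq_sum, evalPowerSums, derivation_aeval_eq_sum, map_sum, Finset.smul_sum]
  refine Finset.sum_congr rfl fun l _ => ?_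
  have h : gradDerivation N k (powerSum N l)
      = (-4 * k * l : ℝ) • (powerSum N (k - l) - powerSum N (k + l)) := by
    simp only [powerSum, map_add, map_sum, gradDerivation_cosPow, Derivation.map_one_eq_zero,
      add_sub_add_left_eq_sub, ← Finset.sum_sub_distrib, Finset.smul_sum, zero_add]
    exact Finset.sum_congr rfl fun i _ => by push_cast; module
  rw [h]
  change _ = (-4 * k : ℝ) • evalPowerSums N _
  rw [map_mul, map_smul, map_sub, evalPowerSums_X, evalPowerSums_X, powerSum_natAbs,
    mul_smul_comm, mul_smul_comm, smul_smul]
  push_cast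
  rfl

end Radial

section Denominator

variable {N : ℕ}

/-- Monic polynomials expressing `(x²ʲ⁺¹ - x⁻²ʲ⁻¹) / (x - x⁻¹)` in terms of `x² + x⁻²`. -/
def oddQuotPoly (R : Type*) [CommRing R] : ℕ → Polynomial R
  | 0 => 1
  | 1 => Polynomial.X + 1
  | (j + 2) => Polynomial.X * oddQuotPoly R (j + 1) - oddQuotPoly R j

theorem monic_oddQuotPoly (R : Type*) [CommRing R] [Nontrivial R] (j : ℕ) :
    (oddQuotPoly R j).Monic ∧ (oddQuotPoly R j).natDegree = j := by
  induction j using Nat.twoStepInduction with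
  | zero => simp [oddQuotPoly]
  | one =>
    simp only [oddQuotPoly]
    exact ⟨Polynomial.monic_X_add_C 1, Polynomial.natDegree_X_add_C 1⟩
  | more j ih₀ ih₁ =>
    have hm : (Polynomial.X * oddQuotPoly R (j + 1)).Monic := Polynomial.monic_X.mul ih₁.1
    have hd : (Polynomial.X * oddQuotPoly R (j + 1)).natDegree = j + 2 := by
      rw [Polynomial.Monic.natDegree_mul Polynomial.monic_X ih₁.1, ih₁.2, Polynomial.natDegree_X]
      ring
    have hlt : (oddQuotPoly R j).natDegree
        < (Polynomial.X * oddQuotPoly R (j + 1)).natDegree := by rw [hd, ih₀.2]; omega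
    simp only [oddQuotPoly]
    refine ⟨hm.sub_of_left (Polynomial.degree_lt_degree hlt), ?_⟩
    rw [Polynomial.natDegree_sub_eq_left_of_natDegree_lt hlt, hd]

theorem halfSin_mul_eval_oddQuotPoly (i : Fin N) (j : ℕ) :
    halfSin i * (oddQuotPoly (TorusRing N) j).eval (cosPow i 1)
      = varPow i (2 * j + 1) - varPow i (-(2 * j + 1)) := by
  induction j using Nat.twoStepInduction with
  | zero => simp [oddQuotPoly, halfSin]
  | one =>
    simp only [oddQuotPoly, Polynomial.eval_add, Polynomial.eval_X, Polynomial.eval_one, halfSin,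
      cosPow, mul_add, sub_mul, mul_one, varPow_mul]
    norm_num
    ring
  | more j ih₀ ih₁ =>
    simp only [oddQuotPoly, Polynomial.eval_sub, Polynomial.eval_mul, Polynomial.eval_X]
    rw [mul_sub, ih₀, mul_left_comm, ih₁]
    simp only [cosPow, mul_sub, add_mul, varPow_mul]
    push_cast
    ring_nf

theorem weylDenom_eq_det (N : ℕ) :
    weylDenom N = (Matrix.of fun i j : Fin N =>
      varPow i (2 * (j : ℕ) + 1) - varPow i (-(2 * (j : ℕ) + 1))).det := by
  rw [weylDenom, ← Matrix.det_vandermonde, Matrix.det_eval_matrixOfPolynomials_eq_det_vandermonde _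
    (fun j : Fin N => oddQuotPoly (TorusRing N) j) (fun j => (monic_oddQuotPoly _ _).2)
    (fun j => (monic_oddQuotPoly _ _).1), ← Matrix.det_mul_column]
  simp only [Matrix.of_apply, halfSin_mul_eval_oddQuotPoly]

/-- The coefficient of `xᵃ` in `xᵇ - x⁻ᵇ`. -/
def signedDelta (a b : ℤ) : ℝ := (if b = a then 1 else 0) - (if -b = a then 1 else 0)

theorem coeff_prod_varPow_sub (a m : Fin N → ℤ) :
    (∏ i, (varPow i (a i) - varPow i (-(a i)))).coeff m = ∏ i, signedDelta (m i) (a i) := by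
  have h1 (i : Fin N) : varPow i (a i) - varPow i (-(a i))
      = ∑ b : Bool, AddMonoidAlgebra.single (Pi.single i (if b then a i else -(a i)) : Fin N → ℤ)
          (if b then (1 : ℝ) else -1) := by
    simp [varPow, sub_eq_add_neg]
  have h2 (i : Fin N) : signedDelta (m i) (a i)
      = ∑ b : Bool, if (if b then a i else -(a i)) = m i then (if b then (1 : ℝ) else -1) else 0 := by
    simp only [Fintype.sum_bool, signedDelta]
    split_ifs <;> simp_all
  simp only [h1, h2, Finset.prod_univ_sum, AddMonoidAlgebra.coeff_sum, Finset.sum_apply',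
    AddMonoidAlgebra.prod_single, Finset.univ_sum_single, Fintype.prod_ite_zero,
    AddMonoidAlgebra.coeff_single, Finsupp.single_apply, funext_iff]
  exact Finset.sum_congr rfl fun x _ => by congr

theorem coeff_weylDenom (m : Fin N → ℤ) :
    (weylDenom N).coeff m
      = (Matrix.of fun i j : Fin N => signedDelta (m i) (2 * (j : ℕ) + 1)).det := by
  rw [weylDenom_eq_det, ← Matrix.det_transpose, ← Matrix.det_transpose (Matrix.of _),
    Matrix.det_apply, Matrix.det_apply, AddMonoidAlgebra.coeff_sum, Finset.sum_apply']
  refine Finset.sum_congr rfl fun σ _ => ?_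
  simp only [Matrix.transpose_apply, Matrix.of_apply,
    ← coeff_prod_varPow_sub (fun i => 2 * ((σ i : Fin N) : ℕ) + 1)]
  rcases Int.units_eq_one_or (Equiv.Perm.sign σ) with h | h <;> simp [h]

/-- The Weyl vector (doubled). -/
def weylVector (N : ℕ) (i : Fin N) : ℤ := 2 * (i : ℕ) + 1

theorem sum_sq_eq_of_coeff_weylDenom_ne_zero {m : Fin N → ℤ} (h : (weylDenom N).coeff m ≠ 0) :
    ∑ i, m i ^ 2 = ∑ i, weylVector N i ^ 2 := by
  rw [coeff_weylDenom, ← Matrix.det_transpose, Matrix.det_apply] at h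
  obtain ⟨σ, -, hσ⟩ := Finset.exists_ne_zero_of_sum_ne_zero h
  have hprod : ∏ i, signedDelta (m i) (weylVector N (σ i)) ≠ 0 := by
    intro h0; exact hσ (by simp only [Matrix.transpose_apply, Matrix.of_apply]; erw [h0]; simp)
  rw [← Equiv.sum_comp σ fun i => weylVector N i ^ 2]
  refine Finset.sum_congr rfl fun i _ => ?_
  have := Finset.prod_ne_zero_iff.1 hprod i (Finset.mem_univ _)
  by_contra hne
  apply this
  rw [signedDelta, if_neg, if_neg, sub_zero]
  · rintro h'; exact hne (by rw [← h', neg_sq])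
  · rintro h'; exact hne (by rw [← h'])

/-- The radial part of the Laplacian, conjugated by the Weyl denominator. -/
def radialOp (N : ℕ) : TorusRing N →ₗ[ℝ] TorusRing N :=
  weightMap fun m => ((∑ i, m i ^ 2 - ∑ i, weylVector N i ^ 2 : ℤ) : ℝ)

theorem radialOp_apply (f : TorusRing N) :
    radialOp N f = ∑ i, eulerDerivation i (eulerDerivation i f)
      - ((∑ i, weylVector N i ^ 2 : ℤ) : ℝ) • f := by
  ext m
  simp only [radialOp, coeff_weightMap, AddMonoidAlgebra.coeff_sub, AddMonoidAlgebra.coeff_sum,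
    AddMonoidAlgebra.coeff_smul, Finsupp.sub_apply, Finset.sum_apply', Finsupp.smul_apply,
    coeff_eulerDerivation, smul_eq_mul, ← mul_assoc, ← Finset.sum_mul, ← sub_mul]
  push_cast
  simp only [sq]

theorem radialOp_weylDenom : radialOp N (weylDenom N) = 0 := by
  ext m
  by_cases h : (weylDenom N).coeff m = 0
  · simp [radialOp, h]
  · rw [radialOp, coeff_weightMap, sum_sq_eq_of_coeff_weylDenom_ne_zero h]; simp

theorem radialOp_weylDenom_mul (f : TorusRing N) :
    radialOp N (weylDenom N * f) = weylDenom N * ∑ i, eulerDerivation i (eulerDerivation i f)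
      + 2 * ∑ i, eulerDerivation i (weylDenom N) * eulerDerivation i f := by
  have h := radialOp_weylDenom (N := N)
  rw [radialOp_apply] at h ⊢
  have h1 (i : Fin N) : eulerDerivation i (eulerDerivation i (weylDenom N * f))
      = weylDenom N * eulerDerivation i (eulerDerivation i f)
        + 2 * (eulerDerivation i (weylDenom N) * eulerDerivation i f)
        + f * eulerDerivation i (eulerDerivation i (weylDenom N)) := by
    simp only [Derivation.leibniz, map_add, smul_eq_mul]; ring
  simp only [h1, Finset.sum_add_distrib, ← Finset.mul_sum]
  rw [sub_eq_zero.1 h, mul_smul_comm, mul_comm f]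
  abel

/-- The polynomial in the power sums representing the Laplacian of a polynomial in the power
sums. -/
def laplaceTraces (s : MvPolynomial ℕ ℝ) : MvPolynomial ℕ ℝ :=
  ∑ k ∈ s.vars, (-4 * k : ℝ) • (laplacePower k * MvPolynomial.pderiv k s
    + gradPower k (MvPolynomial.pderiv k s))

theorem weylDenom_mul_evalPowerSums_laplaceTraces (s : MvPolynomial ℕ ℝ) :
    weylDenom N * evalPowerSums N (laplaceTraces s)
      = radialOp N (weylDenom N * evalPowerSums N s) := by
  have hD (i : Fin N) : eulerDerivation i (evalPowerSums N s)
      = ∑ k ∈ s.vars, evalPowerSums N (MvPolynomial.pderiv k s)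
          * eulerDerivation i (powerSum N k) :=
    derivation_aeval_eq_sum _ _ _
  have hgrad (k : ℕ) (f : TorusRing N) :
      ∑ i, eulerDerivation i (powerSum N k) * eulerDerivation i f = gradDerivation N k f := by
    simp only [gradDerivation_apply, eulerDerivation_powerSum, Int.cast_natCast]
  have h1 : ∑ i, eulerDerivation i (eulerDerivation i (evalPowerSums N s))
      = ∑ k ∈ s.vars, (gradDerivation N k (evalPowerSums N (MvPolynomial.pderiv k s))
        + evalPowerSums N (MvPolynomial.pderiv k s)
          * ∑ i, eulerDerivation i (eulerDerivation i (powerSum N k))) := by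
    simp only [hD, map_sum, ← hgrad, Finset.mul_sum, ← Finset.sum_add_distrib]
    rw [Finset.sum_comm]
    refine Finset.sum_congr rfl fun k _ => Finset.sum_congr rfl fun i _ => ?_
    rw [Derivation.leibniz, smul_eq_mul, smul_eq_mul]; ring
  have h2 : ∑ i, eulerDerivation i (weylDenom N) * eulerDerivation i (evalPowerSums N s)
      = ∑ k ∈ s.vars, evalPowerSums N (MvPolynomial.pderiv k s)
        * gradDerivation N k (weylDenom N) := by
    simp only [hD, ← hgrad, Finset.mul_sum]
    rw [Finset.sum_comm]
    refine Finset.sum_congr rfl fun k _ => Finset.sum_congr rfl fun i _ => ?_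
    ring
  rw [radialOp_weylDenom_mul, h1, h2, laplaceTraces, map_sum, Finset.mul_sum, Finset.mul_sum,
    Finset.mul_sum, ← Finset.sum_add_distrib]
  refine Finset.sum_congr rfl fun k _ => ?_
  have h3 := laplacian_powerSum_add_gradDerivation (N := N) k
  have h4 := gradDerivation_evalPowerSums (N := N) k (MvPolynomial.pderiv k s)
  rw [map_smul, map_add, map_mul, smul_add, ← h4, ← smul_mul_assoc]
  linear_combination -evalPowerSums N (MvPolynomial.pderiv k s) * h3

theorem integral_laplaceTraces {n : Type*} [Fintype n] [DecidableEq n]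
    (μ : Measure (Matrix n n ℝ)) [IsProbabilityMeasure μ]
    (hsupp : μ {A | A ∈ specialOrthogonalGroup n ℝ} = 1)
    (hinv : ∀ g ∈ specialOrthogonalGroup n ℝ, μ.map (fun A => g * A) = μ)
    (s : MvPolynomial ℕ ℝ) : ∫ A, evalTraces A (laplaceTraces s) ∂μ = 0 := by
  simp only [laplaceTraces, map_sum, map_smul, smul_eq_mul]
  rw [integral_finsetSum _ fun k _ => (integrable_evalTraces μ hsupp _).const_mul _]
  refine Finset.sum_eq_zero fun k _ => ?_
  rw [integral_const_mul, integral_laplacePower_mul_add_gradPower μ hsupp hinv, mul_zero]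

/-- A polynomial in the power sums has the same integral as one obtained by removing any finite
set of nonzero frequencies of the radial Laplacian. -/
theorem exists_integral_eq_and_coeff {n : Type*} [Fintype n] [DecidableEq n]
    (μ : Measure (Matrix n n ℝ)) [IsProbabilityMeasure μ]
    (hsupp : μ {A | A ∈ specialOrthogonalGroup n ℝ} = 1)
    (hinv : ∀ g ∈ specialOrthogonalGroup n ℝ, μ.map (fun A => g * A) = μ)
    (s : MvPolynomial ℕ ℝ) (Λ : Finset ℤ) (hΛ : ∀ l ∈ Λ, l ≠ 0) :
    ∃ s', ∫ A, evalTraces A s' ∂μ = ∫ A, evalTraces A s ∂μ ∧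
      ∀ m, (weylDenom N * evalPowerSums N s').coeff m
        = (∏ l ∈ Λ, (1 - ((∑ i, m i ^ 2 - ∑ i, weylVector N i ^ 2 : ℤ) : ℝ) / l))
          * (weylDenom N * evalPowerSums N s).coeff m := by
  classical
  induction Λ using Finset.induction_on with
  | empty => exact ⟨s, rfl, fun m => by simp⟩
  | insert l Λ hl ih =>
    obtain ⟨s', h1, h2⟩ := ih fun l hl => hΛ l (Finset.mem_insert_of_mem hl)
    refine ⟨s' - (l⁻¹ : ℝ) • laplaceTraces s', ?_, fun m => ?_⟩
    · simp only [map_sub, map_smul, smul_eq_mul]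
      rw [integral_sub (integrable_evalTraces μ hsupp _)
        ((integrable_evalTraces μ hsupp _).const_mul _), integral_const_mul,
        integral_laplaceTraces μ hsupp hinv, mul_zero, sub_zero, h1]
    · rw [Finset.prod_insert hl, map_sub, map_smul, mul_sub, mul_smul_comm,
        weylDenom_mul_evalPowerSums_laplaceTraces, AddMonoidAlgebra.coeff_sub, Finsupp.sub_apply,
        AddMonoidAlgebra.coeff_smul, Finsupp.smul_apply, radialOp, coeff_weightMap, h2 m,
        smul_eq_mul]
      ring

end Denominator

section Symmetry

variable {N : ℕ}

theorem signedDelta_units_mul (u : ℤˣ) (a b : ℤ) :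
    signedDelta ((u : ℤ) * a) b = ((u : ℤ) : ℝ) * signedDelta a b := by
  rcases Int.units_eq_one_or u with rfl | rfl
  · simp
  · have h1 : (b = -a) = (-b = a) := by simp [neg_eq_iff_eq_neg]
    have h2 : (-b = -a) = (b = a) := by simp
    simp only [signedDelta, Units.val_neg, Units.val_one, neg_mul, one_mul, h1, h2]
    push_cast; ring

theorem coeff_weylDenom_comp (σ : Equiv.Perm (Fin N)) (m : Fin N → ℤ) :
    (weylDenom N).coeff (m ∘ σ) = ((Equiv.Perm.sign σ : ℤ) : ℝ) * (weylDenom N).coeff m := by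
  rw [coeff_weylDenom, coeff_weylDenom, ← Matrix.det_permute]
  rfl

theorem coeff_weylDenom_units_mul (u : Fin N → ℤˣ) (m : Fin N → ℤ) :
    (weylDenom N).coeff (fun i => (u i : ℤ) * m i)
      = (∏ i, ((u i : ℤ) : ℝ)) * (weylDenom N).coeff m := by
  rw [coeff_weylDenom, coeff_weylDenom, ← Matrix.det_mul_column]
  simp only [signedDelta_units_mul, Matrix.of_apply]

theorem algHom_evalPowerSums (φ : TorusRing N →ₐ[ℝ] TorusRing N)
    (hφ : ∀ k : ℕ, φ (powerSum N k) = powerSum N k) (s : MvPolynomial ℕ ℝ) :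
    φ (evalPowerSums N s) = evalPowerSums N s := by
  rw [evalPowerSums, ← AlgHom.comp_apply, MvPolynomial.comp_aeval]
  simp only [hφ]

theorem coeff_weylDenom_mul_of_symm (e : (Fin N → ℤ) ≃+ (Fin N → ℤ)) (c : ℝ)
    (hP : ∀ k : ℕ, AddMonoidAlgebra.domCongr ℝ ℝ e.symm (powerSum N k) = powerSum N k)
    (hc : ∀ m, (weylDenom N).coeff (e m) = c * (weylDenom N).coeff m)
    (s : MvPolynomial ℕ ℝ) (m : Fin N → ℤ) :
    (weylDenom N * evalPowerSums N s).coeff (e m)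
      = c * (weylDenom N * evalPowerSums N s).coeff m := by
  have h1 : AddMonoidAlgebra.domCongr ℝ ℝ e.symm (weylDenom N) = c • weylDenom N := by
    ext m; simp [hc]
  have h2 := algHom_evalPowerSums (AddMonoidAlgebra.domCongr ℝ ℝ e.symm).toAlgHom hP s
  have h3 := AddMonoidAlgebra.coeff_domCongr (R := ℝ) (A := ℝ) e.symm
    (weylDenom N * evalPowerSums N s) m
  rw [map_mul, h1] at h3
  erw [h2] at h3
  rw [smul_mul_assoc, AddMonoidAlgebra.coeff_smul, Finsupp.smul_apply] at h3
  exact h3.symm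

theorem coeff_weylDenom_mul_comp (σ : Equiv.Perm (Fin N)) (s : MvPolynomial ℕ ℝ)
    (m : Fin N → ℤ) :
    (weylDenom N * evalPowerSums N s).coeff (m ∘ σ)
      = ((Equiv.Perm.sign σ : ℤ) : ℝ) * (weylDenom N * evalPowerSums N s).coeff m := by
  let e : (Fin N → ℤ) ≃+ (Fin N → ℤ) :=
    { toFun m := m ∘ σ
      invFun m := m ∘ σ.symm
      left_inv m := by ext; simp
      right_inv m := by ext; simp
      map_add' m m' := rfl }
  have he (i : Fin N) (n : ℤ) : e.symm (Pi.single i n) = Pi.single (σ i) n := by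
    ext j
    change (Pi.single i n : Fin N → ℤ) (σ.symm j) = _
    simp only [Pi.single_apply, Equiv.symm_apply_eq]
  refine coeff_weylDenom_mul_of_symm e _ (fun k => ?_) (coeff_weylDenom_comp σ) s m
  simp only [powerSum, map_add, map_one, map_sum, cosPow, varPow,
    AddMonoidAlgebra.domCongr_single, he]
  congr 1
  exact Equiv.sum_comp σ fun i => cosPow i (k : ℤ)

theorem coeff_weylDenom_mul_units_mul (u : Fin N → ℤˣ) (s : MvPolynomial ℕ ℝ)
    (m : Fin N → ℤ) :
    (weylDenom N * evalPowerSums N s).coeff (fun i => (u i : ℤ) * m i)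
      = (∏ i, ((u i : ℤ) : ℝ)) * (weylDenom N * evalPowerSums N s).coeff m := by
  have hinv (m : Fin N → ℤ) : (fun i => (u i : ℤ) * ((u i : ℤ) * m i)) = m := by
    ext i; rw [← mul_assoc, ← Units.val_mul, Int.units_mul_self]; simp
  let e : (Fin N → ℤ) ≃+ (Fin N → ℤ) :=
    { toFun m := fun i => (u i : ℤ) * m i
      invFun m := fun i => (u i : ℤ) * m i
      left_inv m := hinv m
      right_inv m := hinv m
      map_add' m m' := by ext; simp [mul_add] }
  have he (i : Fin N) (n : ℤ) : e.symm (Pi.single i n) = Pi.single i ((u i : ℤ) * n) := by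
    ext j
    change (u j : ℤ) * (Pi.single i n : Fin N → ℤ) j = _
    by_cases h : j = i
    · subst h; simp
    · simp [h]
  refine coeff_weylDenom_mul_of_symm e _ (fun k => ?_) (coeff_weylDenom_units_mul u) s m
  simp only [powerSum, map_add, map_one, map_sum, cosPow, varPow,
    AddMonoidAlgebra.domCongr_single, he]
  congr 1
  refine Finset.sum_congr rfl fun i _ => ?_
  rcases Int.units_eq_one_or (u i) with h | h <;> simp [h, add_comm]

/-- A weight that is multiplicative acts on Laurent polynomials by an algebra homomorphism. -/
def weightAlgHom (w : (Fin N → ℤ) → ℝ) (h0 : w 0 = 1) (hadd : ∀ m m', w (m + m') = w m * w m') :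
    TorusRing N →ₐ[ℝ] TorusRing N :=
  AlgHom.ofLinearMap (weightMap w)
    (by rw [AddMonoidAlgebra.one_def, weightMap_single, h0, one_mul]) fun f g => by
      induction f using AddMonoidAlgebra.induction_linear with
      | zero => simp
      | add f₁ f₂ h₁ h₂ => rw [add_mul, map_add, h₁, h₂, map_add, add_mul]
      | single m a =>
        induction g using AddMonoidAlgebra.induction_linear with
        | zero => simp
        | add g₁ g₂ h₁ h₂ => rw [mul_add, map_add, h₁, h₂, map_add, mul_add]
        | single m' a' =>
          simp only [AddMonoidAlgebra.single_mul_single, weightMap_single, hadd]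
          congr 1; ring

theorem odd_of_coeff_weylDenom_mul_ne_zero (s : MvPolynomial ℕ ℝ) {m : Fin N → ℤ}
    (h : (weylDenom N * evalPowerSums N s).coeff m ≠ 0) (i : Fin N) : Odd (m i) := by
  by_contra hodd
  rw [Int.not_odd_iff_even] at hodd
  let w (m : Fin N → ℤ) : ℝ := ((Int.negOnePow (m i) : ℤˣ) : ℤ)
  have hw1 (m : Fin N → ℤ) (hm : Even (m i)) : w m = 1 := by
    simp only [w, Int.negOnePow_even _ hm]; simp
  have hw2 (m : Fin N → ℤ) (hm : Odd (m i)) : w m = -1 := by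
    simp only [w, Int.negOnePow_odd _ hm]; simp
  let φ := weightAlgHom w (by simp [w]) fun m m' => by
    simp only [w, Pi.add_apply, Int.negOnePow_add]; push_cast; rfl
  have hφ (f : TorusRing N) (m : Fin N → ℤ) : (φ f).coeff m = w m * f.coeff m := rfl
  have hφs (m : Fin N → ℤ) (a : ℝ) : φ (.single m a) = .single m (w m * a) :=
    weightMap_single w m a
  have h1 : φ (weylDenom N) = -weylDenom N := by
    ext m
    rw [hφ, AddMonoidAlgebra.coeff_neg, Finsupp.neg_apply]
    rcases Int.even_or_odd (m i) with hm | hm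
    · have : (weylDenom N).coeff m = 0 := by
        rw [coeff_weylDenom]
        refine Matrix.det_eq_zero_of_row_eq_zero i fun j => ?_
        rw [Matrix.of_apply, signedDelta, if_neg, if_neg, sub_zero]
        · rintro h'; rw [← h'] at hm; revert hm; grind
        · rintro h'; rw [← h'] at hm; revert hm; grind
      rw [this]; simp
    · rw [hw2 m hm]; ring
  have h2 : φ (evalPowerSums N s) = evalPowerSums N s := by
    refine algHom_evalPowerSums φ (fun k => ?_) s
    have hs (j : Fin N) (n : ℤ) : w (Pi.single j (2 * n)) = 1 := by
      apply hw1
      by_cases hij : i = j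
      · subst hij; simp
      · simp [hij]
    simp only [powerSum, map_add, map_one, map_sum, cosPow, varPow, hφs, ← mul_neg, hs, mul_one]
  have h3 := hφ (weylDenom N * evalPowerSums N s) m
  rw [map_mul, h1, h2, neg_mul, AddMonoidAlgebra.coeff_neg, Finsupp.neg_apply, hw1 m hodd] at h3
  apply h; linarith

theorem coeff_weylDenom_weylVector : (weylDenom N).coeff (weylVector N) = 1 := by
  rw [coeff_weylDenom]
  suffices h : (Matrix.of fun i j : Fin N => signedDelta (weylVector N i) (2 * (j : ℕ) + 1)) = 1 by
    rw [h, Matrix.det_one]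
  ext i j
  rw [Matrix.of_apply, signedDelta, weylVector, Matrix.one_apply]
  have h1 : (2 * (j : ℕ) + 1 = 2 * ((i : ℕ) : ℤ) + 1) = (i = j) := by
    rw [eq_iff_iff, Fin.ext_iff]; omega
  rw [if_neg (by omega : ¬ (-(2 * ((j : ℕ) : ℤ) + 1) = 2 * ((i : ℕ) : ℤ) + 1)), sub_zero]
  simp only [h1]

theorem weylDenom_ne_zero : weylDenom N ≠ 0 := by
  intro h
  have := coeff_weylDenom_weylVector (N := N)
  simp [h] at this

theorem weylVector_nonneg (i : Fin N) : 0 ≤ weylVector N i := by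
  rw [weylVector]; positivity

theorem eq_weylVector_of_strictMono {m : Fin N → ℤ} (hm : StrictMono m) (hpos : ∀ i, 0 < m i)
    (hodd : ∀ i, Odd (m i)) (hsq : ∑ i, m i ^ 2 = ∑ i, weylVector N i ^ 2) :
    m = weylVector N := by
  have hle : ∀ (n : ℕ) (hn : n < N), 2 * (n : ℤ) + 1 ≤ m ⟨n, hn⟩ := by
    intro n
    induction n with
    | zero => intro hn; have := hpos ⟨0, hn⟩; push_cast; omega
    | succ n ih =>
      intro hn
      have h1 := ih (by omega)
      have h2 : m ⟨n, by omega⟩ < m ⟨n + 1, hn⟩ := hm (by simp)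
      obtain ⟨a, ha⟩ := hodd ⟨n, by omega⟩
      obtain ⟨b, hb⟩ := hodd ⟨n + 1, hn⟩
      push_cast; omega
  have hle' (i : Fin N) : weylVector N i ^ 2 ≤ m i ^ 2 :=
    pow_le_pow_left₀ (weylVector_nonneg i) (hle i i.2) 2
  have heq := (Finset.sum_eq_sum_iff_of_le fun i _ => hle' i).1 hsq.symm
  ext i
  exact ((pow_left_inj₀ (weylVector_nonneg i) (hpos i).le two_ne_zero).1
    (heq i (Finset.mem_univ i))).symm

theorem evalPowerSums_eq_zero_of_coeff (s : MvPolynomial ℕ ℝ)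
    (h0 : (weylDenom N * evalPowerSums N s).coeff (weylVector N) = 0)
    (hsupp : ∀ m, (weylDenom N * evalPowerSums N s).coeff m ≠ 0 →
      ∑ i, m i ^ 2 = ∑ i, weylVector N i ^ 2) :
    evalPowerSums N s = 0 := by
  suffices h : weylDenom N * evalPowerSums N s = 0 from
    (mul_eq_zero.1 h).resolve_left weylDenom_ne_zero
  by_contra hne
  obtain ⟨m, hm⟩ : ∃ m, (weylDenom N * evalPowerSums N s).coeff m ≠ 0 := by
    by_contra! hall; exact hne (by ext m; simp [hall m])
  have hu (i : Fin N) : ∃ u : ℤˣ, 0 ≤ (u : ℤ) * m i := by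
    rcases le_total 0 (m i) with h | h
    · exact ⟨1, by simpa⟩
    · exact ⟨-1, by simpa⟩
  choose u hu using hu
  set m₁ : Fin N → ℤ := fun i => (u i : ℤ) * m i with hm₁
  have h1 : (weylDenom N * evalPowerSums N s).coeff m₁ ≠ 0 := by
    rw [hm₁, coeff_weylDenom_mul_units_mul]
    refine mul_ne_zero (Finset.prod_ne_zero_iff.2 fun i _ => ?_) hm
    exact_mod_cast (u i).ne_zero
  have hinj : Function.Injective m₁ := by
    intro a b hab
    by_contra hne
    have h2 := coeff_weylDenom_mul_comp (Equiv.swap a b) s m₁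
    have h3 : m₁ ∘ Equiv.swap a b = m₁ := by
      ext c
      simp only [Function.comp_apply, Equiv.swap_apply_def]
      split_ifs with h h
      · rw [h, hab]
      · rw [h, hab]
      · rfl
    rw [h3, Equiv.Perm.sign_swap hne] at h2
    apply h1
    push_cast at h2
    linarith
  set m₂ := m₁ ∘ Tuple.sort m₁ with hm₂
  have h2 : (weylDenom N * evalPowerSums N s).coeff m₂ ≠ 0 := by
    rw [hm₂, coeff_weylDenom_mul_comp]
    refine mul_ne_zero ?_ h1
    exact_mod_cast (Equiv.Perm.sign _).ne_zero
  have hodd := odd_of_coeff_weylDenom_mul_ne_zero s h2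
  have hmono : StrictMono m₂ :=
    (Tuple.monotone_sort m₁).strictMono_of_injective (hinj.comp (Equiv.injective _))
  have hpos (i : Fin N) : 0 < m₂ i := by
    refine lt_of_le_of_ne (hu _) fun h => ?_
    have := hodd i
    rw [← h] at this
    revert this; decide
  rw [eq_weylVector_of_strictMono hmono hpos hodd (hsupp _ h2)] at h2
  exact h2 h0

/-- The integral of a polynomial in the traces equals the coefficient of its product with the Weyl
denominator at the Weyl vector. -/
theorem integral_evalTraces_eq_coeff (μ : Measure (Matrix (Fin (2 * N + 1)) (Fin (2 * N + 1)) ℝ))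
    [IsProbabilityMeasure μ]
    (hsupp : μ {A | A ∈ specialOrthogonalGroup (Fin (2 * N + 1)) ℝ} = 1)
    (hinv : ∀ g ∈ specialOrthogonalGroup (Fin (2 * N + 1)) ℝ, μ.map (fun A => g * A) = μ)
    (s : MvPolynomial ℕ ℝ) :
    ∫ A, evalTraces A s ∂μ = (weylDenom N * evalPowerSums N s).coeff (weylVector N) := by
  classical
  let d (m : Fin N → ℤ) : ℤ := ∑ i, m i ^ 2 - ∑ i, weylVector N i ^ 2
  let Λ : Finset ℤ := ((weylDenom N * evalPowerSums N s).coeff.support.image d).erase 0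
  obtain ⟨s', hint, hcoeff⟩ := exists_integral_eq_and_coeff (N := N) μ hsupp hinv s Λ
    fun l hl => Finset.ne_of_mem_erase hl
  set c := (weylDenom N * evalPowerSums N s).coeff (weylVector N) with hc
  have hzero : evalPowerSums N (s' - MvPolynomial.C c) = 0 := by
    have hC : evalPowerSums N (MvPolynomial.C c) = c • 1 := by
      rw [evalPowerSums, MvPolynomial.aeval_C, Algebra.algebraMap_eq_smul_one]
    have hcoeff' (m : Fin N → ℤ) :
        (weylDenom N * evalPowerSums N (s' - MvPolynomial.C c)).coeff m
        = (∏ l ∈ Λ, (1 - (d m : ℝ) / l)) * (weylDenom N * evalPowerSums N s).coeff m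
          - c * (weylDenom N).coeff m := by
      rw [map_sub, hC, mul_sub, mul_smul_comm, mul_one, AddMonoidAlgebra.coeff_sub,
        Finsupp.sub_apply, hcoeff, AddMonoidAlgebra.coeff_smul, Finsupp.smul_apply, smul_eq_mul]
    refine evalPowerSums_eq_zero_of_coeff _ ?_ fun m hm => ?_
    · rw [hcoeff', coeff_weylDenom_weylVector]
      simp [d, hc]
    · by_contra hne
      apply hm
      have hδ : (weylDenom N).coeff m = 0 := by
        by_contra h; exact hne (sum_sq_eq_of_coeff_weylDenom_ne_zero h)
      rw [hcoeff', hδ, mul_zero, sub_zero]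
      by_cases hm0 : (weylDenom N * evalPowerSums N s).coeff m = 0
      · rw [hm0, mul_zero]
      · rw [Finset.prod_eq_zero (i := d m), zero_mul]
        · exact Finset.mem_erase.2 ⟨sub_ne_zero.2 hne,
            Finset.mem_image_of_mem d (Finsupp.mem_support_iff.2 hm0)⟩
        · rw [div_self, sub_self]
          exact_mod_cast sub_ne_zero.2 hne
  have heval (A : Matrix (Fin (2 * N + 1)) (Fin (2 * N + 1)) ℝ)
      (hA : A ∈ specialOrthogonalGroup (Fin (2 * N + 1)) ℝ) : evalTraces A s' = c := by
    obtain ⟨z, hz0, hz⟩ := exists_eigenvalues_specialOrthogonal N A hA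
    choose w hw using fun i => IsAlgClosed.exists_pow_nat_eq (z i) (n := 2) two_pos
    have hw0 (i : Fin N) : w i ≠ 0 := fun h => hz0 i (by rw [← hw i, h]; simp)
    let χ : Multiplicative (Fin N → ℤ) →* ℂ :=
      { toFun m := ∏ i, w i ^ (m.toAdd i)
        map_one' := by simp
        map_mul' m m' := by
          rw [← Finset.prod_mul_distrib]
          exact Finset.prod_congr rfl fun i _ => by
            rw [toAdd_mul, Pi.add_apply, zpow_add₀ (hw0 i)] }
    let θ : TorusRing N →ₐ[ℝ] ℂ := AddMonoidAlgebra.lift ℝ ℂ (Fin N → ℤ) χ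
    have hθv (i : Fin N) (n : ℤ) : θ (varPow i n) = w i ^ n := by
      simp only [θ, varPow, AddMonoidAlgebra.lift_single, one_smul]
      change ∏ j, w j ^ ((Pi.single i n : Fin N → ℤ) j) = _
      rw [Finset.prod_eq_single i]
      · simp
      · intro j _ hj; simp [hj]
      · simp
    have hθ (k : ℕ) : θ (powerSum N k) = ((A ^ k).trace : ℂ) := by
      simp only [hz, powerSum, map_add, map_one, map_sum, cosPow, hθv]
      congr 1
      refine Finset.sum_congr rfl fun i _ => ?_
      rw [_root_.zpow_neg, _root_.zpow_mul, zpow_natCast, inv_pow]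
      norm_cast
      rw [hw]
    have hcomp : (Algebra.ofId ℝ ℂ).comp (evalTraces A) = θ.comp (evalPowerSums N) := by
      refine MvPolynomial.algHom_ext fun k => ?_
      rw [AlgHom.comp_apply, AlgHom.comp_apply, evalPowerSums_X, hθ]
      simp [evalTraces, Algebra.ofId_apply]
    have h1 := DFunLike.congr_fun hcomp (s' - MvPolynomial.C c)
    rw [AlgHom.comp_apply, AlgHom.comp_apply, hzero, map_zero, Algebra.ofId_apply,
      Complex.coe_algebraMap, Complex.ofReal_eq_zero, map_sub, sub_eq_zero] at h1
    rw [h1]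
    simp [evalTraces]
  rw [← hint, integral_congr_ae (g := fun _ => c)]
  · simp
  · filter_upwards [ae_mem_specialOrthogonalGroup μ hsupp] with A hA using heval A hA

end Symmetry

section SecondMoment

variable {N : ℕ}

theorem signedDelta_weylVector (i j : Fin N) :
    signedDelta (weylVector N i) (2 * (j : ℕ) + 1) = (1 : Matrix (Fin N) (Fin N) ℝ) i j := by
  have h1 : (2 * ((j : ℕ) : ℤ) + 1 = 2 * ((i : ℕ) : ℤ) + 1) = (i = j) := by
    rw [Fin.ext_iff, eq_iff_iff]; omega
  have h2 : ¬ (-(2 * ((j : ℕ) : ℤ) + 1) = 2 * ((i : ℕ) : ℤ) + 1) := by omega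
  simp only [signedDelta, weylVector, h1, h2, if_false, sub_zero, Matrix.one_apply]

theorem coeff_weylDenom_weylVector_add_single (i : Fin N) (a : ℤ) :
    (weylDenom N).coeff (weylVector N + Pi.single i a)
      = signedDelta (weylVector N i + a) (weylVector N i) := by
  rw [coeff_weylDenom]
  let u : Fin N → ℝ := fun b => signedDelta (weylVector N i + a) (weylVector N b)
  have h : (Matrix.of fun p q : Fin N =>
      signedDelta ((weylVector N + Pi.single i a : Fin N → ℤ) p) (2 * (q : ℕ) + 1))
      = (1 : Matrix (Fin N) (Fin N) ℝ).updateRow i u := by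
    ext p q
    by_cases hp : p = i
    · subst hp; simp [u, weylVector]
    · simp [hp, signedDelta_weylVector]
  rw [h, ← Matrix.det_transpose, ← Matrix.updateCol_transpose, Matrix.transpose_one, ← Matrix.cramer_apply]
  simp [u]

theorem det_updateRow_updateRow_one {i j : Fin N} (hij : i ≠ j) (u v : Fin N → ℝ) :
    (((1 : Matrix (Fin N) (Fin N) ℝ).updateRow i u).updateRow j v).det
      = u i * v j - u j * v i := by
  let U : Matrix (Fin N) (Fin 2) ℝ := (Matrix.of ![Pi.single i 1, Pi.single j 1])ᵀ
  let V : Matrix (Fin 2) (Fin N) ℝ := Matrix.of ![u - Pi.single i 1, v - Pi.single j 1]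
  have h : ((1 : Matrix (Fin N) (Fin N) ℝ).updateRow i u).updateRow j v = 1 + U * V := by
    ext p q
    by_cases hj : p = j
    · subst hj
      simp [U, V, Matrix.mul_apply, hij.symm, Matrix.one_apply, Pi.single_apply, @eq_comm _ q]
    · by_cases hi : p = i
      · subst hi
        simp [U, V, Matrix.mul_apply, hij, Matrix.one_apply, Pi.single_apply, @eq_comm _ q]
      · simp [U, V, Matrix.mul_apply, hi, hj]
  have hVU : V * U = !![u i - 1, u j; v i, v j - 1] := by
    have hs (w : Fin N → ℝ) (c : Fin N) : ∑ x, w x * (Pi.single c 1 : Fin N → ℝ) x = w c :=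
      dotProduct_single_one w c
    ext p q
    fin_cases p <;> fin_cases q <;> simp [U, V, Matrix.mul_apply, hs, hij, hij.symm]
  rw [h, Matrix.det_one_add_mul_comm, hVU, Matrix.det_fin_two]
  simp

theorem coeff_weylDenom_weylVector_add_single_add_single {i j : Fin N} (hij : i ≠ j) (a b : ℤ) :
    (weylDenom N).coeff (weylVector N + Pi.single i a + Pi.single j b)
      = signedDelta (weylVector N i + a) (weylVector N i)
          * signedDelta (weylVector N j + b) (weylVector N j)
        - signedDelta (weylVector N i + a) (weylVector N j)
          * signedDelta (weylVector N j + b) (weylVector N i) := by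
  rw [coeff_weylDenom, ← det_updateRow_updateRow_one hij
    (fun q => signedDelta (weylVector N i + a) (weylVector N q))
    (fun q => signedDelta (weylVector N j + b) (weylVector N q))]
  congr 1
  ext p q
  by_cases hj : p = j
  · subst hj; simp [hij.symm, weylVector]
  · by_cases hi : p = i
    · subst hi; simp [hij, weylVector]
    · simp [hi, hj, signedDelta_weylVector]

theorem coeff_mul_cosPow (f : TorusRing N) (i : Fin N) (k : ℤ) (m : Fin N → ℤ) :
    (f * cosPow i k).coeff m
      = f.coeff (m + Pi.single i (-(2 * k))) + f.coeff (m + Pi.single i (2 * k)) := by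
  simp [cosPow, varPow, mul_add, Pi.single_neg]

/-- The matrix of multiplication by `z ^ k + z ^ (-k)` on the odd trigonometric functions
`z ^ (i + 1/2) - z ^ (-(i + 1/2))`, where `z ^ (1/2)` is the torus variable. -/
def shiftMatrix (N : ℕ) (k : ℤ) : Matrix (Fin N) (Fin N) ℝ :=
  Matrix.of fun i j => signedDelta (weylVector N i + -(2 * k)) (weylVector N j)
    + signedDelta (weylVector N i + 2 * k) (weylVector N j)

theorem coeff_weylDenom_mul_cosPow (i : Fin N) (k : ℤ) :
    (weylDenom N * cosPow i k).coeff (weylVector N) = shiftMatrix N k i i := by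
  rw [coeff_mul_cosPow, coeff_weylDenom_weylVector_add_single,
    coeff_weylDenom_weylVector_add_single]
  rfl

theorem coeff_weylDenom_mul_cosPow_mul_cosPow {i j : Fin N} (hij : i ≠ j) (k : ℤ) :
    (weylDenom N * (cosPow i k * cosPow j k)).coeff (weylVector N)
      = shiftMatrix N k i i * shiftMatrix N k j j - shiftMatrix N k i j * shiftMatrix N k j i := by
  rw [mul_comm (cosPow i k), ← mul_assoc, coeff_mul_cosPow, coeff_mul_cosPow, coeff_mul_cosPow]
  simp only [coeff_weylDenom_weylVector_add_single_add_single hij, shiftMatrix, Matrix.of_apply]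
  ring

theorem shiftMatrix_apply {k : ℕ} (hk : 1 ≤ k) (i j : Fin N) :
    shiftMatrix N k i j = (if (i : ℕ) = j + k then 1 else 0) + (if (j : ℕ) = i + k then 1 else 0)
      - (if (i : ℕ) + j + 1 = k then 1 else 0) := by
  have h1 : (weylVector N j = weylVector N i + -(2 * (k : ℤ))) = ((i : ℕ) = j + k) := by
    simp only [weylVector, eq_iff_iff]; omega
  have h2 : (-weylVector N j = weylVector N i + -(2 * (k : ℤ))) = ((i : ℕ) + j + 1 = k) := by
    simp only [weylVector, eq_iff_iff]; omega
  have h3 : (weylVector N j = weylVector N i + 2 * (k : ℤ)) = ((j : ℕ) = i + k) := by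
    simp only [weylVector, eq_iff_iff]; omega
  have h4 : ¬ (-weylVector N j = weylVector N i + 2 * (k : ℤ)) := by
    simp only [weylVector]; omega
  simp only [shiftMatrix, Matrix.of_apply, signedDelta, h1, h2, h3, h4, if_false]
  ring

theorem shiftMatrix_apply_self_of_even {k : ℕ} (hk : 1 ≤ k) (i : Fin N) :
    shiftMatrix N (k + k) i i = 0 := by
  have := shiftMatrix_apply (k := k + k) (by omega) i i
  push_cast at this
  rw [this, if_neg (by omega), if_neg (by omega)]
  simp

theorem shiftMatrix_mul_swap {k : ℕ} (hk : 1 ≤ k) (i j : Fin N) :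
    shiftMatrix N k i j * shiftMatrix N k j i = (if (i : ℕ) = j + k then 1 else 0)
      + (if (j : ℕ) = i + k then 1 else 0) + (if (i : ℕ) + j + 1 = k then 1 else 0) := by
  rw [shiftMatrix_apply hk, shiftMatrix_apply hk, add_comm (j : ℕ) i]
  split_ifs <;> first | omega | norm_num

theorem sum_fin_ite_val_eq (N a : ℕ) :
    ∑ j : Fin N, (if (j : ℕ) = a then (1 : ℝ) else 0) = if a < N then 1 else 0 := by
  rw [Fin.sum_univ_eq_sum_range fun j => if j = a then (1 : ℝ) else 0]
  simp

theorem sum_fin_ite_val_lt (N a : ℕ) :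
    ∑ j : Fin N, (if (j : ℕ) < a then (1 : ℝ) else 0) = min N a := by
  rw [Fin.sum_univ_eq_sum_range fun j => if j < a then (1 : ℝ) else 0, Finset.sum_boole]
  have : {j ∈ Finset.range N | j < a} = Finset.range (min N a) := by ext; simp
  simp [this]

theorem trace_shiftMatrix {k : ℕ} (hk : 1 ≤ k) : (shiftMatrix N k).trace = -eps N k := by
  have h (i : Fin N) : shiftMatrix N k i i = -if Odd k ∧ (i : ℕ) = (k - 1) / 2 then 1 else 0 := by
    have h' : ((i : ℕ) + i + 1 = k) = (Odd k ∧ (i : ℕ) = (k - 1) / 2) := by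
      rw [eq_iff_iff, Nat.odd_iff]; omega
    rw [shiftMatrix_apply hk, if_neg (by omega)]
    simp only [h']; ring
  simp only [Matrix.trace, Matrix.diag_apply, h, Finset.sum_neg_distrib, ite_and, eps]
  by_cases ho : Odd k
  · simp only [ho, if_true, sum_fin_ite_val_eq]
    have h1 : ((k - 1) / 2 < N) = (k ≤ 2 * N - 1) := by
      rw [Nat.odd_iff] at ho; rw [eq_iff_iff]; omega
    simp [h1, hk]
  · simp [ho]

theorem sum_shiftMatrix_mul_swap {k : ℕ} (hk : 1 ≤ k) :
    ∑ i : Fin N, ∑ j : Fin N, shiftMatrix N k i j * shiftMatrix N k j i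
      = 2 * N - min (k : ℝ) (2 * N) := by
  have h (i : Fin N) : ∑ j : Fin N, shiftMatrix N k i j * shiftMatrix N k j i
      = 1 + (if (i : ℕ) < N - k then 1 else 0) - (if (i : ℕ) < k - N then 1 else 0) := by
    have h1 (j : Fin N) : ((i : ℕ) = j + k) = (k ≤ i ∧ (j : ℕ) = i - k) := by
      rw [eq_iff_iff]; omega
    have h2 (j : Fin N) : ((i : ℕ) + j + 1 = k) = (i < k ∧ (j : ℕ) = k - 1 - i) := by
      rw [eq_iff_iff]; omega
    have hc (p : Prop) [Decidable p] (a : ℕ) :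
        ∑ j : Fin N, (if p ∧ (j : ℕ) = a then (1 : ℝ) else 0)
          = if p ∧ a < N then 1 else 0 := by
      by_cases hp : p <;> simp only [hp, true_and, false_and, if_false, sum_fin_ite_val_eq,
        Finset.sum_const_zero]
    simp only [shiftMatrix_mul_swap hk, Finset.sum_add_distrib, h1, h2, hc, sum_fin_ite_val_eq]
    have := i.isLt
    split_ifs <;> first | omega | norm_num
  simp only [h, Finset.sum_add_distrib, Finset.sum_sub_distrib, sum_fin_ite_val_lt]
  have hnat : N + min N (N - k) + min k (2 * N) = 2 * N + min N (k - N) := by omega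
  have hreal := congrArg (Nat.cast (R := ℝ)) hnat
  push_cast at hreal ⊢
  simp only [Finset.sum_const, Finset.card_univ, Fintype.card_fin, nsmul_eq_mul, mul_one]
  linarith

theorem coeff_weylDenom_mul_sum_cosPow_sq {k : ℕ} (hk : 1 ≤ k) :
    (weylDenom N * (∑ i, cosPow i k) ^ 2).coeff (weylVector N)
      = min (k : ℝ) (2 * N) + eps N k := by
  have h (i j : Fin N) : (weylDenom N * (cosPow i k * cosPow j k)).coeff (weylVector N)
      = (if i = j then 2 else 0) + shiftMatrix N k i i * shiftMatrix N k j j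
        - shiftMatrix N k i j * shiftMatrix N k j i := by
    by_cases hij : i = j
    · subst hij
      rw [cosPow_mul_cosPow, sub_self, cosPow_zero, mul_add, AddMonoidAlgebra.coeff_add,
        Finsupp.add_apply, coeff_weylDenom_mul_cosPow, shiftMatrix_apply_self_of_even hk,
        mul_two, AddMonoidAlgebra.coeff_add, Finsupp.add_apply, coeff_weylDenom_weylVector]
      simp; norm_num
    · simp [hij, coeff_weylDenom_mul_cosPow_mul_cosPow hij]
  have he : eps N k ^ 2 = eps N k := by simp [eps]
  have ht : ∑ i : Fin N, ∑ j : Fin N, shiftMatrix N k i i * shiftMatrix N k j j = eps N k := by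
    rw [← Finset.sum_mul_sum, ← he, ← neg_sq, ← trace_shiftMatrix hk, sq]; rfl
  rw [sq, Finset.sum_mul_sum]
  simp only [Finset.mul_sum, AddMonoidAlgebra.coeff_sum, Finsupp.finsetSum_apply, h,
    Finset.sum_add_distrib, Finset.sum_sub_distrib, ht, sum_shiftMatrix_mul_swap hk]
  simp; ring

theorem integral_trace_pow_sub_one_sq
    (μ : Measure (Matrix (Fin (2 * N + 1)) (Fin (2 * N + 1)) ℝ)) [IsProbabilityMeasure μ]
    (hsupp : μ {A | A ∈ Matrix.specialOrthogonalGroup (Fin (2 * N + 1)) ℝ} = 1)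
    (hinv : ∀ g ∈ Matrix.specialOrthogonalGroup (Fin (2 * N + 1)) ℝ,
      μ.map (fun A => g * A) = μ) {k : ℕ} (hk : 1 ≤ k) :
    ∫ A, ((A ^ k).trace - 1) ^ 2 ∂μ = min (k : ℝ) (2 * N) + eps N k := by
  have := integral_evalTraces_eq_coeff μ hsupp hinv ((MvPolynomial.X k - 1) ^ 2)
  rw [← coeff_weylDenom_mul_sum_cosPow_sq hk]
  simpa [evalTraces, evalPowerSums_X, powerSum] using this

end SecondMoment

/-- For `A` Haar-distributed on `SO(2N+1)`,
`E[ Σ_{k≥1} (Tr(A^k) − 1)²/k² ] = Σ_{k≥1} (min{k, 2N} + ε(k))/k²`. -/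
theorem expected_traceSum_specialOrthogonal_odd
    (N : ℕ) (hN : 1 ≤ N)
    (μ : Measure (Matrix (Fin (2 * N + 1)) (Fin (2 * N + 1)) ℝ)) [IsProbabilityMeasure μ]
    (hsupp : μ {A | A ∈ Matrix.specialOrthogonalGroup (Fin (2 * N + 1)) ℝ} = 1)
    (hinv : ∀ g ∈ Matrix.specialOrthogonalGroup (Fin (2 * N + 1)) ℝ,
      μ.map (fun A => g * A) = μ) :
    ∫ A, (∑' k : ℕ, ((A ^ (k + 1)).trace - 1) ^ 2 / ((k : ℝ) + 1) ^ 2) ∂μ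
      = ∑' k : ℕ, (min ((k : ℝ) + 1) (2 * (N : ℝ)) + eps N (k + 1)) / ((k : ℝ) + 1) ^ 2 := by
  have hint (k : ℕ) :
      Integrable (fun A : Matrix (Fin (2 * N + 1)) (Fin (2 * N + 1)) ℝ =>
        ((A ^ (k + 1)).trace - 1) ^ 2 / ((k : ℝ) + 1) ^ 2) μ := by
    have := (integrable_evalTraces μ hsupp ((MvPolynomial.X (k + 1) - 1) ^ 2)).div_const
      (((k : ℝ) + 1) ^ 2)
    simpa [evalTraces] using this
  have hval (k : ℕ) : ∫ A, ((A ^ (k + 1)).trace - 1) ^ 2 / ((k : ℝ) + 1) ^ 2 ∂μ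
      = (min ((k : ℝ) + 1) (2 * (N : ℝ)) + eps N (k + 1)) / ((k : ℝ) + 1) ^ 2 := by
    rw [integral_div, integral_trace_pow_sub_one_sq μ hsupp hinv (Nat.le_add_left 1 k)]
    push_cast; rfl
  have hsum : Summable fun k : ℕ => (2 * N + 1 : ℝ) / ((k : ℝ) + 1) ^ 2 := by
    have := (summable_nat_add_iff 1).2 (Real.summable_one_div_nat_pow.2 one_lt_two)
    simpa [div_eq_mul_inv] using this.mul_left (2 * N + 1 : ℝ)
  have hnorm : Summable fun k : ℕ => ∫ A : Matrix (Fin (2 * N + 1)) (Fin (2 * N + 1)) ℝ,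
      ‖((A ^ (k + 1)).trace - 1) ^ 2 / ((k : ℝ) + 1) ^ 2‖ ∂μ := by
    have habs (k : ℕ) (A : Matrix (Fin (2 * N + 1)) (Fin (2 * N + 1)) ℝ) :
        ‖((A ^ (k + 1)).trace - 1) ^ 2 / ((k : ℝ) + 1) ^ 2‖
          = ((A ^ (k + 1)).trace - 1) ^ 2 / ((k : ℝ) + 1) ^ 2 :=
      Real.norm_of_nonneg (by positivity)
    simp only [habs, hval]
    refine hsum.of_nonneg_of_le (fun k => ?_) fun k => ?_
    · unfold eps; split_ifs <;> positivity
    · gcongr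
      · exact min_le_right _ _
      · unfold eps; split_ifs <;> simp
  rw [← integral_tsum_of_summable_integral_norm hint hnorm]
  exact tsum_congr hval
end
end
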